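/- Let R be a locally hypersurface ring (i.e., R_p is a hypersurface local ring for every prime p). Then the maps Φ and Ψ, defined by Φ(X) = (IPD(X), φ(X)) with φ(X)(p) = ht p − min_{X∈X} depth X_p, and Ψ(W, f) = { M ∈ IPD^{-1}(W) : depth M_p ≥ ht p − f(p) for all p ∈ Spec R }, are mutually inverse bijections between the set of resolving subcategories of mod R and the set of pairs (W, f) where W is a specialization closed subset of Sing R and f is a grade consistent function on Spec R. -/

import Mathlib

universe u

open CategoryTheory

namespace ResolvPaper

variable (R : Type u) [CommRing R]

/-- `IsSES f g` means `0 → A → B → C → 0` is a short exact sequence. -/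
def IsSES {R : Type u} [CommRing R] {A B C : Type u} [AddCommGroup A] [Module R A]
    [AddCommGroup B] [Module R B] [AddCommGroup C] [Module R C]
    (f : A →ₗ[R] B) (g : B →ₗ[R] C) : Prop :=
  Function.Injective f ∧ Function.Surjective g ∧ LinearMap.range f = LinearMap.ker g

/-- A resolving subcategory of `mod R`, viewed as a set of bundled modules
closed under isomorphism, containing the finitely generated projective modules, and closed
under direct summands, extensions and syzygies. -/
structure IsResolving (𝒳 : Set (ModuleCat.{u} R)) : Prop where
  fg : ∀ M ∈ 𝒳, Module.Finite R M
  iso_closed : ∀ M N : ModuleCat.{u} R, Nonempty (M ≃ₗ[R] N) → M ∈ 𝒳 → N ∈ 𝒳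
  proj_mem : ∀ M : ModuleCat.{u} R, Module.Finite R M → Module.Projective R M → M ∈ 𝒳
  summand_closed : ∀ M N : ModuleCat.{u} R, ModuleCat.of R (↥M × ↥N) ∈ 𝒳 → M ∈ 𝒳
  ext_closed : ∀ (A B C : ModuleCat.{u} R) (f : A →ₗ[R] B) (g : B →ₗ[R] C),
    IsSES f g → A ∈ 𝒳 → C ∈ 𝒳 → B ∈ 𝒳
  syzygy_closed : ∀ (K P M : ModuleCat.{u} R) (f : K →ₗ[R] P) (g : P →ₗ[R] M),
    IsSES f g → Module.Finite R K → Module.Finite R P → Module.Projective R P →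
    M ∈ 𝒳 → K ∈ 𝒳

/-- The resolving closure: the smallest resolving subcategory containing `S`. -/
def resClosure (S : Set (ModuleCat.{u} R)) : Set (ModuleCat.{u} R) :=
  ⋂₀ {𝒳 | IsResolving R 𝒳 ∧ S ⊆ 𝒳}

/-- An extension-closed subcategory of `mod R`: closed under isomorphism,
direct summands and extensions. -/
def IsExtClosed (𝒳 : Set (ModuleCat.{u} R)) : Prop :=
  (∀ M N : ModuleCat.{u} R, Nonempty (M ≃ₗ[R] N) → M ∈ 𝒳 → N ∈ 𝒳) ∧
  (∀ M N : ModuleCat.{u} R, ModuleCat.of R (↥M × ↥N) ∈ 𝒳 → M ∈ 𝒳) ∧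
  (∀ (A B C : ModuleCat.{u} R) (f : A →ₗ[R] B) (g : B →ₗ[R] C),
    IsSES f g → A ∈ 𝒳 → C ∈ 𝒳 → B ∈ 𝒳)

/-- The extension closure of a set of modules. -/
def extClosure (S : Set (ModuleCat.{u} R)) : Set (ModuleCat.{u} R) :=
  ⋂₀ {𝒳 | IsExtClosed R 𝒳 ∧ S ⊆ 𝒳}

/-- `add R`: direct summands of finite free modules. -/
def addR : Set (ModuleCat.{u} R) :=
  {M | ∃ (n : ℕ) (N : ModuleCat.{u} R), Nonempty ((↥M × ↥N) ≃ₗ[R] (Fin n → R))}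

/-- `pdLE n M` : the projective dimension of `M` is at most `n`. -/
def pdLE : ℕ → ModuleCat.{u} R → Prop
  | 0, M => Module.Projective R M
  | n+1, M => ∃ (K P : ModuleCat.{u} R) (f : K →ₗ[R] P) (g : P →ₗ[R] M),
      Module.Finite R P ∧ Module.Projective R P ∧ IsSES f g ∧ pdLE n K

/-- The projective dimension, an element of `WithBot ℕ∞`; the zero module
has projective dimension `⊥ = -∞`. -/
noncomputable def pdim (M : ModuleCat.{u} R) : WithBot ℕ∞ :=
  sInf {x : WithBot ℕ∞ | (x = ⊥ ∧ Subsingleton M) ∨ ∃ n : ℕ, x = (n : ℕ∞) ∧ pdLE R n M}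

/-- The depth of `M` with respect to the ideal `I`: the supremum of lengths of weakly
`M`-regular sequences contained in `I`.  The zero module has depth `∞`. -/
noncomputable def depthE (I : Ideal R) (M : Type u) [AddCommGroup M] [Module R M] : ℕ∞ :=
  sSup {x : ℕ∞ | ∃ rs : List R, (∀ r ∈ rs, r ∈ I) ∧
    RingTheory.Sequence.IsWeaklyRegular M rs ∧ x = rs.length}

/-- The grade of an ideal: the length of a maximal `R`-regular sequence in `I`. -/
noncomputable def gradeE (I : Ideal R) : ℕ∞ := depthE R I R

/-- A grade consistent function on `Spec R`. -/
def GradeConsistent (f : PrimeSpectrum R → ℕ) : Prop :=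
  (∀ p : PrimeSpectrum R, (f p : ℕ∞) ≤ gradeE R p.asIdeal) ∧
  (∀ p q : PrimeSpectrum R, p.asIdeal ≤ q.asIdeal → f p ≤ f q)

/-- The localization of a module at a prime, as a module over the local ring `R_p`. -/
noncomputable abbrev localizeM (p : PrimeSpectrum R) (M : ModuleCat.{u} R) :
    ModuleCat.{u} (Localization.AtPrime p.asIdeal) :=
  ModuleCat.of (Localization.AtPrime p.asIdeal) (LocalizedModule p.asIdeal.primeCompl M)

/-- `pd_{R_p} M_p`. -/
noncomputable def localPdim (p : PrimeSpectrum R) (M : ModuleCat.{u} R) : WithBot ℕ∞ :=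
  pdim (Localization.AtPrime p.asIdeal) (localizeM R p M)

/-- `depth_{R_p} M_p`. -/
noncomputable def localDepth (p : PrimeSpectrum R) (M : ModuleCat.{u} R) : ℕ∞ :=
  depthE (Localization.AtPrime p.asIdeal)
    (IsLocalRing.maximalIdeal (Localization.AtPrime p.asIdeal))
    (LocalizedModule p.asIdeal.primeCompl M)

/-- The height of a prime ideal. -/
noncomputable def heightE (p : PrimeSpectrum R) : ℕ∞ := Order.height p

/-- `PD(R)` : finitely generated modules of finite projective dimension. -/
def PDcat : Set (ModuleCat.{u} R) :=
  {M | Module.Finite R M ∧ ∃ n : ℕ, pdLE R n M}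

/-- `MCM(R)` : maximal Cohen-Macaulay modules. -/
def MCMcat : Set (ModuleCat.{u} R) :=
  {M | Module.Finite R M ∧ ∀ p : PrimeSpectrum R, heightE R p ≤ localDepth R p M}

/-- The nonfree locus of a module. -/
def NF (M : ModuleCat.{u} R) : Set (PrimeSpectrum R) :=
  {p | ¬ Module.Free (Localization.AtPrime p.asIdeal) (LocalizedModule p.asIdeal.primeCompl M)}

/-- The infinite projective dimension locus of a module. -/
def IPD (M : ModuleCat.{u} R) : Set (PrimeSpectrum R) :=
  {p | localPdim R p M = (⊤ : WithBot ℕ∞)}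

/-- The infinite projective dimension locus of a collection of modules. -/
def IPDcat (𝒳 : Set (ModuleCat.{u} R)) : Set (PrimeSpectrum R) :=
  ⋃ M ∈ 𝒳, IPD R M

/-- The modules in `mod R` whose infinite projective dimension locus lies in `W`. -/
def IPDinv (W : Set (PrimeSpectrum R)) : Set (ModuleCat.{u} R) :=
  {M | Module.Finite R M ∧ IPD R M ⊆ W}

/-- A specialization closed subset of `Spec R`. -/
def SpecClosed (W : Set (PrimeSpectrum R)) : Prop :=
  ∀ p ∈ W, ∀ q : PrimeSpectrum R, p.asIdeal ≤ q.asIdeal → q ∈ W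

/-- Membership in `add 𝒳_p`: direct summands of localizations of finite direct sums
of members of `𝒳`. -/
def memAddLocal (𝒳 : Set (ModuleCat.{u} R)) (p : PrimeSpectrum R)
    (N : ModuleCat.{u} (Localization.AtPrime p.asIdeal)) : Prop :=
  ∃ (n : ℕ) (X : Fin n → ModuleCat.{u} R), (∀ i, X i ∈ 𝒳) ∧
    ∃ (N' : ModuleCat.{u} (Localization.AtPrime p.asIdeal)),
      Nonempty ((↥N × ↥N') ≃ₗ[Localization.AtPrime p.asIdeal]
        ((i : Fin n) → LocalizedModule p.asIdeal.primeCompl (X i)))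

/-- `K` is an `n`-th syzygy of `M` computed from a minimal free resolution over the
local ring `S`. -/
def IsMinSyz (S : Type u) [CommRing S] [IsLocalRing S] :
    ℕ → ModuleCat.{u} S → ModuleCat.{u} S → Prop
  | 0, M, K => Nonempty (K ≃ₗ[S] M)
  | n+1, M, K => ∃ (F : ModuleCat.{u} S) (g : F →ₗ[S] M) (K' : ModuleCat.{u} S)
      (i : K' →ₗ[S] F),
      Module.Finite S F ∧ Module.Free S F ∧ Function.Surjective g ∧
      (LinearMap.ker g ≤ (IsLocalRing.maximalIdeal S) • (⊤ : Submodule S F)) ∧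
      Function.Injective i ∧ LinearMap.range i = LinearMap.ker g ∧
      IsMinSyz S n K' K

/-- `K` is an `n`-th syzygy of `M` in some projective resolution (over any ring). -/
def IsSyz : ℕ → ModuleCat.{u} R → ModuleCat.{u} R → Prop
  | 0, M, K => Nonempty (K ≃ₗ[R] M)
  | n+1, M, K => ∃ (F : ModuleCat.{u} R) (g : F →ₗ[R] M) (K' : ModuleCat.{u} R)
      (i : K' →ₗ[R] F),
      Module.Finite R F ∧ Module.Projective R F ∧ Function.Surjective g ∧
      Function.Injective i ∧ LinearMap.range i = LinearMap.ker g ∧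
      IsSyz n K' K

/-- `T` is (isomorphic to) the Auslander transpose of `M`, computed from a minimal
free presentation over the local ring `S`. -/
def IsTranspose (S : Type u) [CommRing S] [IsLocalRing S] (M T : ModuleCat.{u} S) : Prop :=
  ∃ (F1 F0 : ModuleCat.{u} S) (d : F1 →ₗ[S] F0) (e : F0 →ₗ[S] M),
    Module.Finite S F0 ∧ Module.Free S F0 ∧ Module.Finite S F1 ∧ Module.Free S F1 ∧
    Function.Surjective e ∧ LinearMap.range d = LinearMap.ker e ∧
    LinearMap.ker e ≤ (IsLocalRing.maximalIdeal S) • (⊤ : Submodule S F0) ∧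
    LinearMap.ker d ≤ (IsLocalRing.maximalIdeal S) • (⊤ : Submodule S F1) ∧
    Nonempty (T ≃ₗ[S] ((Module.Dual S F1) ⧸ LinearMap.range d.dualMap))

/-- `T` is (isomorphic to) `Tr Ω^n M` over the local ring `S`. -/
def IsTrOmega (S : Type u) [CommRing S] [IsLocalRing S] (n : ℕ) (M T : ModuleCat.{u} S) :
    Prop :=
  ∃ K : ModuleCat.{u} S, IsMinSyz S n M K ∧ IsTranspose S K T

/-- Resolving subcategory `𝒳` is dominant on `W ⊆ Spec R`. -/
def DominantOn (𝒳 : Set (ModuleCat.{u} R)) (W : Set (PrimeSpectrum R)) : Prop :=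
  ∀ p ∈ W, ∃ (n : ℕ) (K : ModuleCat.{u} (Localization.AtPrime p.asIdeal)),
    IsMinSyz (Localization.AtPrime p.asIdeal) n
      (ModuleCat.of (Localization.AtPrime p.asIdeal)
        (IsLocalRing.ResidueField (Localization.AtPrime p.asIdeal))) K ∧
    memAddLocal R 𝒳 p K

/-- Dominant resolving subcategory. -/
def Dominant (𝒳 : Set (ModuleCat.{u} R)) : Prop := DominantOn R 𝒳 Set.univ

/-- A (noetherian) local ring is Cohen-Macaulay if its depth equals its Krull dimension. -/
def IsCMLocalRing (S : Type u) [CommRing S] [IsLocalRing S] : Prop :=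
  IsNoetherianRing S ∧
    ((depthE S (IsLocalRing.maximalIdeal S) S : WithBot ℕ∞) = ringKrullDim S)

/-- A regular local ring: a noetherian local ring whose maximal ideal is generated by
`dim S` elements. -/
def IsRegLocalRing (S : Type u) [CommRing S] [IsLocalRing S] : Prop :=
  IsNoetherianRing S ∧ ∃ s : Finset S,
    Ideal.span (s : Set S) = IsLocalRing.maximalIdeal S ∧
    ringKrullDim S = (s.card : WithBot ℕ∞)

/-- The singular locus of `R`. -/
def SingLocus : Set (PrimeSpectrum R) :=
  {p | ¬ IsRegLocalRing (Localization.AtPrime p.asIdeal)}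

/-- A hypersurface local ring: the completion is a quotient of a regular local ring by
one element. -/
def IsHypersurfaceLocalRing (S : Type u) [CommRing S] [IsLocalRing S] : Prop :=
  ∃ (T : Type u) (_ : CommRing T) (_ : IsLocalRing T) (f : T),
    IsRegLocalRing T ∧
    Nonempty ((AdicCompletion (IsLocalRing.maximalIdeal S) S) ≃+* (T ⧸ Ideal.span {f}))

/-- A complete intersection local ring: the completion is a quotient of a regular local
ring by a regular sequence. -/
def IsCompleteIntersectionLocalRing (S : Type u) [CommRing S] [IsLocalRing S] : Prop :=
  ∃ (T : Type u) (_ : CommRing T) (_ : IsLocalRing T) (rs : List T),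
    IsRegLocalRing T ∧ RingTheory.Sequence.IsRegular T rs ∧
    Nonempty ((AdicCompletion (IsLocalRing.maximalIdeal S) S) ≃+*
      (T ⧸ Ideal.ofList rs))

/-- The subquotient `A / (A ⊓ B)` of two submodules, used for homology. -/
def subquot {S M : Type u} [CommRing S] [AddCommGroup M] [Module S M]
    (A B : Submodule S M) : Type u :=
  A ⧸ (B.comap A.subtype)

noncomputable instance {S M : Type u} [CommRing S] [AddCommGroup M] [Module S M]
    (A B : Submodule S M) : AddCommGroup (subquot A B) :=
  inferInstanceAs (AddCommGroup (A ⧸ (B.comap A.subtype)))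

noncomputable instance {S M : Type u} [CommRing S] [AddCommGroup M] [Module S M]
    (A B : Submodule S M) : Module S (subquot A B) :=
  inferInstanceAs (Module S (A ⧸ (B.comap A.subtype)))

/-- `E` is (isomorphic to) `Ext^{j+1}_S(M, S)`, computed from a finite free resolution. -/
def IsExtPos (S : Type u) [CommRing S] (j : ℕ) (M E : ModuleCat.{u} S) : Prop :=
  ∃ (F : ℕ → ModuleCat.{u} S) (d : ∀ i : ℕ, (F (i+1) : Type u) →ₗ[S] F i)
    (e : (F 0 : Type u) →ₗ[S] M),
    (∀ i, Module.Finite S (F i)) ∧ (∀ i, Module.Free S (F i)) ∧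
    Function.Surjective e ∧ LinearMap.range (d 0) = LinearMap.ker e ∧
    (∀ i, LinearMap.range (d (i+1)) = LinearMap.ker (d i)) ∧
    Nonempty (E ≃ₗ[S]
      subquot (LinearMap.ker ((d (j+1)).dualMap)) (LinearMap.range ((d j).dualMap)))

/-- `T` is (isomorphic to) `Tor_n^S(M, N)`, computed from a projective resolution of `M`. -/
def IsTor (S : Type u) [CommRing S] (n : ℕ) (M N T : ModuleCat.{u} S) : Prop :=
  ∃ (F : ℕ → ModuleCat.{u} S) (d : ∀ i : ℕ, (F (i+1) : Type u) →ₗ[S] F i)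
    (e : (F 0 : Type u) →ₗ[S] M),
    (∀ i, Module.Projective S (F i)) ∧
    Function.Surjective e ∧ LinearMap.range (d 0) = LinearMap.ker e ∧
    (∀ i, LinearMap.range (d (i+1)) = LinearMap.ker (d i)) ∧
    (match n with
      | 0 => Nonempty (T ≃ₗ[S] TensorProduct S M N)
      | (j+1) => Nonempty (T ≃ₗ[S]
          subquot (LinearMap.ker (LinearMap.rTensor (↥N) (d j)))
            (LinearMap.range (LinearMap.rTensor (↥N) (d (j+1))))))

/-- `idLE n M` : the injective dimension of `M` is at most `n`. -/
def idLE (S : Type u) [CommRing S] : ℕ → ModuleCat.{u} S → Prop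
  | 0, M => Module.Injective S M
  | n+1, M => ∃ (I C : ModuleCat.{u} S) (f : M →ₗ[S] I) (g : I →ₗ[S] C),
      IsSES f g ∧ Module.Injective S I ∧ idLE S n C

/-- `PD_0^n(R)` over a local ring: modules of projective dimension at most `n` that are
free on the punctured spectrum. -/
def PD0n [IsLocalRing R] (n : ℕ) : Set (ModuleCat.{u} R) :=
  {M | Module.Finite R M ∧ pdLE R n M ∧
    ∀ p : PrimeSpectrum R, p.asIdeal ≠ IsLocalRing.maximalIdeal R →
      Module.Free (Localization.AtPrime p.asIdeal) (LocalizedModule p.asIdeal.primeCompl M)}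

/-- `PD_0(R)` over a local ring: modules of finite projective dimension that are
free on the punctured spectrum. -/
def PD0 [IsLocalRing R] : Set (ModuleCat.{u} R) :=
  {M | Module.Finite R M ∧ (∃ n : ℕ, pdLE R n M) ∧
    ∀ p : PrimeSpectrum R, p.asIdeal ≠ IsLocalRing.maximalIdeal R →
      Module.Free (Localization.AtPrime p.asIdeal) (LocalizedModule p.asIdeal.primeCompl M)}

/-- The residue field of a local ring, as a bundled module. -/
noncomputable abbrev residueMod (S : Type u) [CommRing S] [IsLocalRing S] : ModuleCat.{u} S :=
  ModuleCat.of S (IsLocalRing.ResidueField S)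


/-- `Ψ(W, f)`: the modules `M` with `IPD(M) ⊆ W` and `depth M_p ≥ ht p - f(p)` for all `p`. -/
def PsiHyp (W : Set (PrimeSpectrum R)) (f : PrimeSpectrum R → ℕ) :
    Set (ModuleCat.{u} R) :=
  {M | Module.Finite R M ∧ IPD R M ⊆ W ∧
    ∀ p : PrimeSpectrum R, heightE R p - (f p : ℕ∞) ≤ localDepth R p M}

section Chunk1
set_option linter.unusedSectionVars false
set_option linter.style.haveILetI false
section PartOne

variable {R : Type u} [CommRing R]

/-- Unbundled membership. -/
def In (𝒳 : Set (ModuleCat.{u} R)) (M : Type u) [AddCommGroup M] [Module R M] : Prop :=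
  ModuleCat.of R M ∈ 𝒳

variable {A B C P K M N X Y Q : Type u} [AddCommGroup A] [Module R A] [AddCommGroup B] [Module R B]
  [AddCommGroup C] [Module R C] [AddCommGroup P] [Module R P] [AddCommGroup K] [Module R K]
  [AddCommGroup M] [Module R M] [AddCommGroup N] [Module R N] [AddCommGroup X] [Module R X]
  [AddCommGroup Y] [Module R Y] [AddCommGroup Q] [Module R Q]
  {𝒳 𝒴 : Set (ModuleCat.{u} R)}

lemma IsSES.zero {f : A →ₗ[R] B} {g : B →ₗ[R] C} (h : IsSES f g) (a : A) : g (f a) = 0 := by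
  have : f a ∈ LinearMap.ker g := h.2.2 ▸ LinearMap.mem_range_self f a
  simpa using this

lemma IsSES.ex {f : A →ₗ[R] B} {g : B →ₗ[R] C} (h : IsSES f g) {b : B} (hb : g b = 0) :
    ∃ a, f a = b := by
  have : b ∈ LinearMap.range f := h.2.2 ▸ (LinearMap.mem_ker.2 hb)
  simpa using this

lemma IsSES.mk' {f : A →ₗ[R] B} {g : B →ₗ[R] C} (h1 : ∀ a, f a = 0 → a = 0)
    (h2 : ∀ c, ∃ b, g b = c) (h3 : ∀ a, g (f a) = 0) (h4 : ∀ b, g b = 0 → ∃ a, f a = b) :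
    IsSES f g := by
  refine ⟨(injective_iff_map_eq_zero f).2 h1, h2, ?_⟩
  ext b
  constructor
  · rintro ⟨a, rfl⟩; exact h3 a
  · intro hb; exact h4 b hb

lemma isSES_ker (g : B →ₗ[R] C) (hg : Function.Surjective g) :
    IsSES (LinearMap.ker g).subtype g :=
  ⟨Subtype.val_injective, hg, by simp⟩

lemma isSES_mkQ (U : Submodule R B) : IsSES U.subtype U.mkQ :=
  ⟨Subtype.val_injective, U.mkQ_surjective, by simp⟩

lemma IsSES.lift {f : A →ₗ[R] B} {g : B →ₗ[R] C} (h : IsSES f g) (φ : X →ₗ[R] B)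
    (hφ : ∀ x, g (φ x) = 0) : ∃ ψ : X →ₗ[R] A, ∀ x, f (ψ x) = φ x := by
  have e := LinearEquiv.ofInjective f h.1
  refine ⟨(LinearEquiv.ofInjective f h.1).symm.toLinearMap ∘ₗ
    φ.codRestrict (LinearMap.range f) (fun x => h.ex (hφ x)), fun x => ?_⟩
  have := LinearEquiv.apply_symm_apply (LinearEquiv.ofInjective f h.1)
    (φ.codRestrict (LinearMap.range f) (fun x => h.ex (hφ x)) x)
  exact congrArg Subtype.val this

lemma IsSES.desc {f : A →ₗ[R] B} {g : B →ₗ[R] C} (h : IsSES f g) (φ : B →ₗ[R] X)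
    (hφ : ∀ a, φ (f a) = 0) : ∃ ψ : C →ₗ[R] X, ∀ b, ψ (g b) = φ b := by
  have hk : LinearMap.ker g ≤ LinearMap.ker φ := by
    rw [← h.2.2]; rintro _ ⟨a, rfl⟩; exact hφ a
  refine ⟨(LinearMap.ker g).liftQ φ hk ∘ₗ (g.quotKerEquivOfSurjective h.2.1).symm.toLinearMap,
    fun b => ?_⟩
  have : (g.quotKerEquivOfSurjective h.2.1).symm (g b) = (LinearMap.ker g).mkQ b := by
    rw [LinearEquiv.symm_apply_eq]; rfl
  simp [this]

lemma IsSES.finite_mid {f : A →ₗ[R] B} {g : B →ₗ[R] C} (h : IsSES f g) (hA : Module.Finite R A)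
    (hC : Module.Finite R C) : Module.Finite R B :=
  Module.Finite.of_exact (f := f) (g := g) (LinearMap.exact_iff.2 h.2.2.symm) h.2.1

lemma IsSES.finite_right {f : A →ₗ[R] B} {g : B →ₗ[R] C} (h : IsSES f g)
    (hB : Module.Finite R B) : Module.Finite R C := Module.Finite.of_surjective g h.2.1

lemma IsSES.finite_left [IsNoetherianRing R] {f : A →ₗ[R] B} {g : B →ₗ[R] C} (h : IsSES f g)
    (hB : Module.Finite R B) : Module.Finite R A :=
  Module.Finite.of_injective f h.1

namespace IsResolving

lemma finite (h : IsResolving R 𝒳) (hM : In 𝒳 M) : Module.Finite R M := h.fg _ hM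

lemma equiv (h : IsResolving R 𝒳) (e : M ≃ₗ[R] N) (hM : In 𝒳 M) : In 𝒳 N :=
  h.iso_closed (ModuleCat.of R M) (ModuleCat.of R N) ⟨e⟩ hM

lemma proj (h : IsResolving R 𝒳) [Module.Finite R M] [Module.Projective R M] : In 𝒳 M :=
  h.proj_mem (ModuleCat.of R M) ‹_› ‹_›

lemma ext (h : IsResolving R 𝒳) {f : A →ₗ[R] B} {g : B →ₗ[R] C} (s : IsSES f g)
    (hA : In 𝒳 A) (hC : In 𝒳 C) : In 𝒳 B :=
  h.ext_closed (ModuleCat.of R A) (ModuleCat.of R B) (ModuleCat.of R C) f g s hA hC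

lemma syz [IsNoetherianRing R] (h : IsResolving R 𝒳) {f : K →ₗ[R] P} {g : P →ₗ[R] M}
    (s : IsSES f g) [Module.Finite R P] [Module.Projective R P] (hM : In 𝒳 M) : In 𝒳 K :=
  h.syzygy_closed (ModuleCat.of R K) (ModuleCat.of R P) (ModuleCat.of R M) f g s
    (s.finite_left ‹_›) ‹_› ‹_› hM

lemma fst (h : IsResolving R 𝒳) (hM : In 𝒳 (M × N)) : In 𝒳 M :=
  h.summand_closed (ModuleCat.of R M) (ModuleCat.of R N) hM

lemma retract (h : IsResolving R 𝒳) (i : M →ₗ[R] Q) (r : Q →ₗ[R] M) (hri : ∀ m, r (i m) = m)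
    (hQ : In 𝒳 Q) : In 𝒳 M := by
  let e : Q ≃ₗ[R] M × LinearMap.ker r :=
    { toFun := fun q => (r q, ⟨q - i (r q), by simp [hri]⟩)
      invFun := fun x => i x.1 + x.2.1
      map_add' := fun a b => by ext <;> simp; abel
      map_smul' := fun a b => by ext <;> simp [smul_sub]
      left_inv := fun q => by simp
      right_inv := fun x => by
        obtain ⟨a, b, hb⟩ := x
        have hb : r b = 0 := hb
        ext <;> simp [hri, hb] }
  exact h.fst (h.equiv e hQ)

lemma prod (h : IsResolving R 𝒳) (hM : In 𝒳 M) (hN : In 𝒳 N) : In 𝒳 (M × N) :=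
  h.ext (f := LinearMap.inl R M N) (g := LinearMap.snd R M N)
    (IsSES.mk' (by simp) (fun c => ⟨(0, c), rfl⟩) (by simp)
      (by rintro ⟨a, b⟩ hb; exact ⟨a, by simp at hb; simp [hb]⟩)) hM hN

lemma of_ses_proj (h : IsResolving R 𝒳) {f : A →ₗ[R] B} {g : B →ₗ[R] C} (s : IsSES f g)
    [Module.Projective R C] (hB : In 𝒳 B) : In 𝒳 A := by
  obtain ⟨σ, hσ⟩ := Module.projective_lifting_property g LinearMap.id s.2.1
  have hσ' : ∀ c, g (σ c) = c := fun c => by simpa using congrArg (fun t => t c) hσ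
  obtain ⟨r, hr⟩ := s.lift (LinearMap.id - σ ∘ₗ g) (fun x => by simp [hσ'])
  refine h.retract f r (fun m => s.1 ?_) hB
  rw [hr]; simp [s.zero]

lemma of_subsingleton (h : IsResolving R 𝒳) [Subsingleton M] : In 𝒳 M := h.proj

end IsResolving

/-- The pullback of two maps. -/
def pb (g : B →ₗ[R] C) (h : P →ₗ[R] C) : Submodule R (B × P) :=
  LinearMap.ker (g ∘ₗ LinearMap.fst R B P - h ∘ₗ LinearMap.snd R B P)

lemma mem_pb {g : B →ₗ[R] C} {h : P →ₗ[R] C} {x : B × P} : x ∈ pb g h ↔ g x.1 = h x.2 := by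
  simp [pb, sub_eq_zero]

def pbInl (f : A →ₗ[R] B) (g : B →ₗ[R] C) (h : P →ₗ[R] C) (hf : ∀ a, g (f a) = 0) :
    A →ₗ[R] pb g h :=
  (LinearMap.inl R B P ∘ₗ f).codRestrict _ (fun a => by simp [mem_pb, hf])

def pbInr (f : K →ₗ[R] P) (g : B →ₗ[R] C) (h : P →ₗ[R] C) (hf : ∀ a, h (f a) = 0) :
    K →ₗ[R] pb g h :=
  (LinearMap.inr R B P ∘ₗ f).codRestrict _ (fun a => by simp [mem_pb, hf])

def pbFst (g : B →ₗ[R] C) (h : P →ₗ[R] C) : pb g h →ₗ[R] B := LinearMap.fst R B P ∘ₗ (pb g h).subtype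
def pbSnd (g : B →ₗ[R] C) (h : P →ₗ[R] C) : pb g h →ₗ[R] P := LinearMap.snd R B P ∘ₗ (pb g h).subtype

lemma pb_ses_fst {i : K →ₗ[R] P} {h : P →ₗ[R] C} (s : IsSES i h) (g : B →ₗ[R] C) :
    IsSES (pbInr i g h s.zero) (pbFst g h) := by
  refine IsSES.mk' ?_ ?_ ?_ ?_
  · intro a ha
    have := congrArg (fun x => (x : pb g h).1.2) ha
    exact s.1 (Eq.trans this (map_zero i).symm)
  · intro b
    obtain ⟨p, hp⟩ := s.2.1 (g b)
    exact ⟨⟨(b, p), mem_pb.2 hp.symm⟩, rfl⟩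
  · intro a; rfl
  · rintro ⟨⟨b, p⟩, hbp⟩ hb
    have hb : b = 0 := hb
    subst hb
    have : h p = 0 := by simpa using (mem_pb.1 hbp).symm
    obtain ⟨k, rfl⟩ := s.ex this
    exact ⟨k, rfl⟩

lemma pb_ses_snd {f : A →ₗ[R] B} {g : B →ₗ[R] C} (s : IsSES f g) (h : P →ₗ[R] C) :
    IsSES (pbInl f g h s.zero) (pbSnd g h) := by
  refine IsSES.mk' ?_ ?_ ?_ ?_
  · intro a ha
    have := congrArg (fun x => (x : pb g h).1.1) ha
    exact s.1 (Eq.trans this (map_zero f).symm)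
  · intro b
    obtain ⟨p, hp⟩ := s.2.1 (h b)
    exact ⟨⟨(p, b), mem_pb.2 hp⟩, rfl⟩
  · intro a; rfl
  · rintro ⟨⟨b, p⟩, hbp⟩ hb
    have hb : p = 0 := hb
    subst hb
    have : g b = 0 := by simpa using (mem_pb.1 hbp)
    obtain ⟨k, rfl⟩ := s.ex this
    exact ⟨k, rfl⟩

lemma exists_cover (M : Type u) [AddCommGroup M] [Module R M] [Module.Finite R M] :
    ∃ (n : ℕ) (g : (Fin n → R) →ₗ[R] M), Function.Surjective g :=
  Module.Finite.exists_fin' R M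

/-- Modules with first syzygy in `𝒳`. -/
def Syz1 (𝒳 : Set (ModuleCat.{u} R)) : Set (ModuleCat.{u} R) :=
  {Y | ∃ (n : ℕ) (g : (Fin n → R) →ₗ[R] Y), Function.Surjective g ∧ In 𝒳 (LinearMap.ker g)}

lemma in_Syz1 : In (Syz1 𝒳) M ↔ ∃ (n : ℕ) (g : (Fin n → R) →ₗ[R] M), Function.Surjective g ∧
    In 𝒳 (LinearMap.ker g) := Iff.rfl

lemma in_Syz1.finite (h : In (Syz1 𝒳) M) : Module.Finite R M := by
  obtain ⟨n, g, hg, -⟩ := in_Syz1.1 h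
  exact Module.Finite.of_surjective g hg

namespace IsResolving

lemma in_syz1 [IsNoetherianRing R] (h : IsResolving R 𝒳) (hM : In 𝒳 M) : In (Syz1 𝒳) M := by
  have := h.finite hM
  obtain ⟨n, g, hg⟩ := exists_cover (R := R) M
  exact in_Syz1.2 ⟨n, g, hg, h.syz (isSES_ker g hg) hM⟩

/-- kernel of `B → C`, with `B ∈ 𝒳`, `C ∈ S𝒳`. -/
lemma ker_mem (h : IsResolving R 𝒳) {f : A →ₗ[R] B} {g : B →ₗ[R] C} (s : IsSES f g)
    (hB : In 𝒳 B) (hC : In (Syz1 𝒳) C) : In 𝒳 A := by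
  obtain ⟨n, p, hp, hK⟩ := in_Syz1.1 hC
  have hQ : In 𝒳 (pb g p) := h.ext (pb_ses_fst (isSES_ker p hp) g) hK hB
  exact h.of_ses_proj (pb_ses_snd s p) hQ

lemma ker_mem' [IsNoetherianRing R] (h : IsResolving R 𝒳) {f : A →ₗ[R] B} {g : B →ₗ[R] C}
    (s : IsSES f g) (hB : In 𝒳 B) (hC : In 𝒳 C) : In 𝒳 A :=
  h.ker_mem s hB (h.in_syz1 hC)

lemma coker_mem [IsNoetherianRing R] (h : IsResolving R 𝒳) {f : A →ₗ[R] B} {g : B →ₗ[R] C}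
    (s : IsSES f g) (hA : In 𝒳 A) (hB : In 𝒳 B) : In (Syz1 𝒳) C := by
  have := h.finite hB
  have := s.finite_right this
  obtain ⟨n, p, hp⟩ := exists_cover (R := R) C
  have hQ : In 𝒳 (pb g p) := h.ext (pb_ses_snd s p) hA h.proj
  exact in_Syz1.2 ⟨n, p, hp, h.ker_mem' (pb_ses_fst (isSES_ker p hp) g) hQ hB⟩

lemma syz1_ker (h : IsResolving R 𝒳) {f : K →ₗ[R] P} {g : P →ₗ[R] M} (s : IsSES f g)
    [Module.Finite R P] [Module.Projective R P] (hM : In (Syz1 𝒳) M) : In 𝒳 K :=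
  h.ker_mem s h.proj hM

lemma kerProd {f : A →ₗ[R] B} {g : B →ₗ[R] C} {f' : K →ₗ[R] P} {g' : P →ₗ[R] M}
    (s : IsSES f g) (s' : IsSES f' g') : IsSES (f.prodMap f') (g.prodMap g') := by
  refine IsSES.mk' ?_ ?_ ?_ ?_
  · rintro ⟨a, b⟩ h
    simp at h
    exact Prod.ext (s.1 (by simp [h.1])) (s'.1 (by simp [h.2]))
  · rintro ⟨a, b⟩
    obtain ⟨x, rfl⟩ := s.2.1 a
    obtain ⟨y, rfl⟩ := s'.2.1 b
    exact ⟨(x, y), rfl⟩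
  · rintro ⟨a, b⟩; simp [s.zero, s'.zero]
  · rintro ⟨a, b⟩ h
    simp at h
    obtain ⟨x, rfl⟩ := s.ex h.1
    obtain ⟨y, rfl⟩ := s'.ex h.2
    exact ⟨(x, y), rfl⟩

/-- horseshoe -/
lemma horseshoe {f : A →ₗ[R] B} {g : B →ₗ[R] C} (s : IsSES f g)
    (a : X →ₗ[R] A) (ha : Function.Surjective a) (c : Y →ₗ[R] C) (hc : Function.Surjective c)
    [Module.Projective R Y] : ∃ b : (X × Y) →ₗ[R] B, Function.Surjective b ∧
      ∃ (i : LinearMap.ker a →ₗ[R] LinearMap.ker b) (j : LinearMap.ker b →ₗ[R] LinearMap.ker c),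
      IsSES i j := by
  obtain ⟨l, hl⟩ := Module.projective_lifting_property g c s.2.1
  have hl' : ∀ y, g (l y) = c y := fun y => by simpa using congrArg (fun t => t y) hl
  refine ⟨(f ∘ₗ a).coprod l, ?_, ?_⟩
  · intro b
    obtain ⟨y, hy⟩ := hc (g b)
    obtain ⟨a', ha'⟩ := s.ex (b := b - l y) (by simp [hl', hy])
    obtain ⟨x, rfl⟩ := ha a'
    exact ⟨(x, y), by simp [ha']⟩
  · refine ⟨(LinearMap.inl R X Y).restrict (fun x hx => ?_), (LinearMap.snd R X Y).restrict
      (fun x hx => ?_), ?_⟩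
    · simp at hx; simp [hx]
    · simp only [LinearMap.mem_ker, LinearMap.coprod_apply] at hx
      have := congrArg g hx
      simpa [s.zero, hl'] using this
    · refine IsSES.mk' ?_ ?_ ?_ ?_
      · rintro ⟨x, hx⟩ h
        have := congrArg (fun t => t.1.1) h
        exact Subtype.ext this
      · rintro ⟨y, hy⟩
        obtain ⟨a', ha'⟩ := s.ex (b := - l y) (by simp only [LinearMap.mem_ker] at hy; simp [hl', hy])
        obtain ⟨x, rfl⟩ := ha a'
        exact ⟨⟨(x, y), by simp [ha']⟩, rfl⟩
      · rintro ⟨x, hx⟩; rfl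
      · rintro ⟨⟨x, y⟩, hx⟩ h
        have hy : y = 0 := by simpa using congrArg Subtype.val h
        subst hy
        have hx : f (a x) = 0 := by simpa using hx
        exact ⟨⟨x, s.1 (by simp [hx])⟩, rfl⟩

lemma in_syz1_of_proj [IsNoetherianRing R] (h : IsResolving R 𝒳) {f : K →ₗ[R] P}
    {g : P →ₗ[R] M} (s : IsSES f g) [Module.Finite R P] [Module.Projective R P]
    (hK : In 𝒳 K) : In (Syz1 𝒳) M :=
  h.coker_mem s hK h.proj

protected lemma syz1 [IsNoetherianRing R] (h : IsResolving R 𝒳) : IsResolving R (Syz1 𝒳) where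
  fg M hM := in_Syz1.finite (M := M) hM
  iso_closed M N e hM := by
    obtain ⟨e⟩ := e
    obtain ⟨n, g, hg, hK⟩ := hM
    refine ⟨n, e.toLinearMap ∘ₗ g, by simpa using hg, ?_⟩
    rwa [LinearEquiv.ker_comp]
  proj_mem M h1 h2 := h.in_syz1 (M := M) (h.proj (M := M))
  summand_closed M N hMN := by
    have : Module.Finite R (M × N) := in_Syz1.finite (M := M × N) hMN
    have : Module.Finite R M := Module.Finite.of_surjective (LinearMap.fst R M N) Prod.fst_surjective
    have : Module.Finite R N := Module.Finite.of_surjective (LinearMap.snd R M N) Prod.snd_surjective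
    obtain ⟨n, p, hp⟩ := exists_cover (R := R) M
    obtain ⟨m, q, hq⟩ := exists_cover (R := R) N
    have := h.syz1_ker (kerProd (isSES_ker p hp) (isSES_ker q hq)) (M := M × N) hMN
    exact ⟨n, p, hp, h.fst this⟩
  ext_closed A B C f g s hA hC := by
    obtain ⟨n, p, hp, h1⟩ := hA
    obtain ⟨m, q, hq, h2⟩ := hC
    obtain ⟨b, hb, i, j, hij⟩ := horseshoe s p hp q hq
    exact h.in_syz1_of_proj (isSES_ker b hb) (h.ext hij h1 h2)
  syzygy_closed K P M f g s _ _ _ hM :=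
    h.in_syz1 (M := K) (h.syz1_ker s hM)

end IsResolving

lemma Syz1_mono (h : ∀ M : ModuleCat.{u} R, M ∈ 𝒳 → M ∈ 𝒴) {M : ModuleCat.{u} R}
    (hM : M ∈ Syz1 𝒳) : M ∈ Syz1 𝒴 := by
  obtain ⟨n, g, hg, hK⟩ := hM
  exact ⟨n, g, hg, h _ hK⟩

/-- iterated -/
def SyzN : ℕ → Set (ModuleCat.{u} R) → Set (ModuleCat.{u} R)
  | 0, 𝒳 => 𝒳
  | n+1, 𝒳 => Syz1 (SyzN n 𝒳)

lemma SyzN_mono (n : ℕ) (h : 𝒳 ⊆ 𝒴) : SyzN n 𝒳 ⊆ SyzN n 𝒴 := by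
  induction n with
  | zero => exact h
  | succ n ih => exact fun M hM => Syz1_mono (fun M h => ih h) hM

lemma IsResolving.syzN [IsNoetherianRing R] (h : IsResolving R 𝒳) (n : ℕ) :
    IsResolving R (SyzN n 𝒳) := by
  induction n with
  | zero => exact h
  | succ n ih => exact ih.syz1

lemma SyzN_succ' (n : ℕ) : SyzN (n+1) 𝒳 = SyzN n (Syz1 𝒳) := by
  induction n with
  | zero => rfl
  | succ n ih => show Syz1 (SyzN (n+1) 𝒳) = Syz1 (SyzN n (Syz1 𝒳)); rw [ih]

lemma SyzN_add (n m : ℕ) : SyzN (n + m) 𝒳 = SyzN n (SyzN m 𝒳) := by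
  induction n with
  | zero => simp [SyzN]
  | succ n ih => rw [Nat.succ_add]; show Syz1 _ = Syz1 _; rw [ih]

lemma IsResolving.syzN_le [IsNoetherianRing R] (h : IsResolving R 𝒳) {n m : ℕ} (hnm : n ≤ m) :
    SyzN n 𝒳 ⊆ SyzN m 𝒳 := by
  induction hnm with
  | refl => exact subset_rfl
  | step _ ih => exact fun M hM => (h.syzN _).in_syz1 (M := M) (ih hM)

end PartOne

end Chunk1

section Chunk2
open scoped Pointwise
set_option linter.unusedSectionVars false
set_option linter.style.haveILetI false
section PartTwo

variable {R : Type u} [CommRing R]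
variable {A B C P K M N X Y Q F : Type u} [AddCommGroup A] [Module R A] [AddCommGroup B] [Module R B]
  [AddCommGroup C] [Module R C] [AddCommGroup P] [Module R P] [AddCommGroup K] [Module R K]
  [AddCommGroup M] [Module R M] [AddCommGroup N] [Module R N] [AddCommGroup X] [Module R X]
  [AddCommGroup Y] [Module R Y] [AddCommGroup Q] [Module R Q] [AddCommGroup F] [Module R F]
  {𝒳 𝒴 : Set (ModuleCat.{u} R)}

/-- pushout -/
abbrev Po (i : A →ₗ[R] B) (α : A →ₗ[R] X) : Type u := (B × X) ⧸ LinearMap.range (i.prod (-α))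

lemma po_ses {i : A →ₗ[R] B} {g : B →ₗ[R] C} (s : IsSES i g) (α : A →ₗ[R] X) :
    ∃ q : Po i α →ₗ[R] C, (∀ b x, q ((LinearMap.range (i.prod (-α))).mkQ (b, x)) = g b) ∧
      IsSES ((LinearMap.range (i.prod (-α))).mkQ ∘ₗ LinearMap.inr R B X) q := by
  refine ⟨(LinearMap.range (i.prod (-α))).liftQ (g ∘ₗ LinearMap.fst R B X) ?_, ?_, ?_⟩
  · rintro _ ⟨a, rfl⟩; simp [s.zero]
  · intro b x; simp
  · refine IsSES.mk' ?_ ?_ ?_ ?_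
    · intro x hx
      simp only [LinearMap.comp_apply, Submodule.mkQ_apply, Submodule.Quotient.mk_eq_zero] at hx
      obtain ⟨a, ha⟩ := hx
      simp at ha
      have : a = 0 := s.1 (by simp [ha.1])
      rw [← ha.2, this]; simp
    · intro c
      obtain ⟨b, rfl⟩ := s.2.1 c
      exact ⟨(LinearMap.range (i.prod (-α))).mkQ (b, 0), by simp⟩
    · intro x; simp
    · intro y hy
      obtain ⟨⟨b, x⟩, rfl⟩ := Submodule.mkQ_surjective _ y
      have hb : g b = 0 := by simpa using hy
      obtain ⟨a, rfl⟩ := s.ex hb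
      refine ⟨x + α a, ?_⟩
      simp only [LinearMap.comp_apply, Submodule.mkQ_apply]
      rw [Submodule.Quotient.eq]
      exact ⟨-a, by simp⟩

lemma po_desc (i : A →ₗ[R] B) (α : A →ₗ[R] X) (b : B →ₗ[R] Y) (x : X →ₗ[R] Y)
    (h : ∀ a, b (i a) = x (α a)) : ∃ q : Po i α →ₗ[R] Y,
      ∀ u v, q ((LinearMap.range (i.prod (-α))).mkQ (u, v)) = b u + x v := by
  refine ⟨(LinearMap.range (i.prod (-α))).liftQ (b.coprod x) ?_, fun u v => (Submodule.liftQ_apply _ _ _).trans (by simp)⟩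
  rintro _ ⟨a, rfl⟩; simp [h]

/-- `s • id` factors through a member of `𝒳`. -/
def Fac (𝒳 : Set (ModuleCat.{u} R)) (M : Type u) [AddCommGroup M] [Module R M] (s : R) : Prop :=
  ∃ (X : ModuleCat.{u} R) (_ : X ∈ 𝒳) (α : M →ₗ[R] X) (β : X →ₗ[R] M), ∀ m, β (α m) = s • m

lemma Fac.mk (hX : In 𝒳 X) (α : M →ₗ[R] X) (β : X →ₗ[R] M) {s : R} (h : ∀ m, β (α m) = s • m) :
    Fac 𝒳 M s := ⟨ModuleCat.of R X, hX, α, β, h⟩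

lemma Fac.mul {s : R} (h : Fac 𝒳 M s) (r : R) : Fac 𝒳 M (r * s) := by
  obtain ⟨X, hX, α, β, h⟩ := h
  exact ⟨X, hX, α, r • β, fun m => by simp [h, mul_smul]⟩

lemma Fac.add (hr : IsResolving R 𝒳) {s t : R} (h : Fac 𝒳 M s) (h' : Fac 𝒳 M t) :
    Fac 𝒳 M (s + t) := by
  obtain ⟨X, hX, α, β, h⟩ := h
  obtain ⟨Y, hY, α', β', h'⟩ := h'
  exact Fac.mk (X := X × Y) (hr.prod (M := X) (N := Y) hX hY) (α.prod α') (β.coprod β')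
    (fun m => by simp [h, h', add_smul])

lemma Fac.one_mem (hr : IsResolving R 𝒳) (h : Fac 𝒳 M 1) : In 𝒳 M := by
  obtain ⟨X, hX, α, β, h⟩ := h
  exact hr.retract α β (fun m => by simp [h]) hX

lemma Fac.of_mem (h : In 𝒳 M) (s : R) : Fac 𝒳 M s :=
  Fac.mk h LinearMap.id (s • LinearMap.id) (fun m => by simp)

lemma Fac.retract {s t : R} (i : N →ₗ[R] M) (r : M →ₗ[R] N) (hir : ∀ n, r (i n) = t • n)
    (h : Fac 𝒳 M s) : Fac 𝒳 N (s * t) := by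
  obtain ⟨X, hX, α, β, h⟩ := h
  exact ⟨X, hX, α ∘ₗ i, r ∘ₗ β, fun m => by simp [h, hir, mul_smul]⟩

lemma Fac.equiv {s : R} (e : M ≃ₗ[R] N) (h : Fac 𝒳 M s) : Fac 𝒳 N s := by
  have := h.retract (t := 1) e.symm.toLinearMap e.toLinearMap (by simp)
  simpa using this

lemma Fac.zero (hr : IsResolving R 𝒳) : Fac 𝒳 M 0 :=
  Fac.mk (X := PUnit.{u+1}) hr.of_subsingleton 0 0 (by simp)

/-- the ideal of `s` such that `s • id` factors through `𝒳`. -/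
def facIdeal (hr : IsResolving R 𝒳) (M : Type u) [AddCommGroup M] [Module R M] : Ideal R where
  carrier := {s | Fac 𝒳 M s}
  add_mem' := fun h h' => Fac.add hr h h'
  zero_mem' := Fac.zero hr
  smul_mem' := fun r _ h => Fac.mul h r

lemma mem_facIdeal {hr : IsResolving R 𝒳} {s : R} : s ∈ facIdeal hr M ↔ Fac 𝒳 M s := Iff.rfl

lemma Fac.ext (hr : IsResolving R 𝒳) {f : A →ₗ[R] B} {g : B →ₗ[R] C} (σ : IsSES f g) {s t : R}
    (hA : Fac 𝒳 A s) (hC : Fac 𝒳 C t) : Fac 𝒳 B (s * t) := by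
  obtain ⟨X, hX, α, β, h⟩ := hA
  obtain ⟨Y, hY, γ, δ, h'⟩ := hC
  have s1 := pb_ses_snd σ δ
  set i := pbInl f g δ σ.zero with hi
  obtain ⟨q, hq, s2⟩ := po_ses s1 α
  have hB2 : In 𝒳 (Po i α) := hr.ext s2 hX hY
  obtain ⟨d, hd⟩ := po_desc i α (s • LinearMap.id) (i ∘ₗ β) (fun a => by simp [h])
  have hB1 : Fac 𝒳 (pb g δ) s := Fac.mk hB2
    ((LinearMap.range (i.prod (-α))).mkQ ∘ₗ LinearMap.inl R _ _) d
    (fun m => by simp only [LinearMap.comp_apply, LinearMap.inl_apply]; rw [hd]; simp)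
  exact hB1.retract ((t • (LinearMap.id : B →ₗ[R] B)).prod (γ ∘ₗ g) |>.codRestrict (pb g δ)
    (fun b => mem_pb.2 (by simp [h']))) (pbFst g δ) (fun b => rfl)

lemma proj_lift {g : B →ₗ[R] C} (hg : Function.Surjective g) [Module.Projective R P]
    (φ : P →ₗ[R] C) : ∃ ψ : P →ₗ[R] B, ∀ x, g (ψ x) = φ x := by
  obtain ⟨σ, hσ⟩ := Module.projective_lifting_property g φ hg
  exact ⟨σ, fun c => by simpa using congrArg (fun t => t c) hσ⟩

lemma Fac.syz (hr : IsResolving R 𝒳) {f : K →ₗ[R] P} {g : P →ₗ[R] M} (σ : IsSES f g)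
    [Module.Finite R P] [Module.Projective R P] {s : R} (hM : Fac (Syz1 𝒳) M s) : Fac 𝒳 K s := by
  obtain ⟨X, hX, α, β, h⟩ := hM
  obtain ⟨n, p, hp, hL⟩ := hX
  have σ' := isSES_ker p hp
  obtain ⟨a, ha⟩ := proj_lift hp (α ∘ₗ g)
  obtain ⟨b, hb⟩ := proj_lift σ.2.1 (β ∘ₗ p)
  obtain ⟨a', ha'⟩ := σ'.lift (a ∘ₗ f) (fun k => by simp [ha, σ.zero])
  obtain ⟨b', hb'⟩ := σ.lift (b ∘ₗ (LinearMap.ker p).subtype) (fun k => by simp [hb])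
  obtain ⟨d, hd⟩ := σ.lift (s • LinearMap.id - b ∘ₗ a) (fun k => by simp [hb, ha, h])
  refine Fac.mk (X := LinearMap.ker p × P) (hr.prod hL hr.proj) (a'.prod f) (b'.coprod d)
    (fun m => σ.1 ?_)
  have := ha' m
  simp only [Submodule.subtype_apply] at this
  simp [hb', hd, this]

/-- `𝒳^T` -/
def locT (𝒳 : Set (ModuleCat.{u} R)) (T : Submonoid R) : Set (ModuleCat.{u} R) :=
  {M | Module.Finite R M ∧ ∃ s ∈ T, Fac 𝒳 M s}

lemma in_locT {T : Submonoid R} : In (locT 𝒳 T) M ↔ Module.Finite R M ∧ ∃ s ∈ T, Fac 𝒳 M s :=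
  Iff.rfl

lemma Fac.mono (h : 𝒳 ⊆ 𝒴) {s : R} (hM : Fac 𝒳 M s) : Fac 𝒴 M s := by
  obtain ⟨X, hX, α, β, hh⟩ := hM
  exact ⟨X, h hX, α, β, hh⟩

lemma subset_Syz1 [IsNoetherianRing R] (hr : IsResolving R 𝒳) : 𝒳 ⊆ Syz1 𝒳 :=
  fun M hM => hr.in_syz1 (M := M) hM

lemma IsResolving.locT [IsNoetherianRing R] (hr : IsResolving R 𝒳) (T : Submonoid R) :
    IsResolving R (locT 𝒳 T) where
  fg M hM := hM.1
  iso_closed M N e hM := by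
    obtain ⟨e⟩ := e
    obtain ⟨h1, s, hs, h⟩ := hM
    exact ⟨Module.Finite.equiv e, s, hs, h.equiv e⟩
  proj_mem M h1 h2 := ⟨h1, 1, T.one_mem, Fac.of_mem (hr.proj (M := M)) 1⟩
  summand_closed M N hMN := by
    obtain ⟨h1, s, hs, h⟩ := hMN
    have h1 : Module.Finite R (M × N) := h1
    refine ⟨Module.Finite.of_surjective (LinearMap.fst R M N) Prod.fst_surjective, s, hs, ?_⟩
    have := Fac.retract (M := M × N) (t := 1) (LinearMap.inl R M N) (LinearMap.fst R M N) (by simp) h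
    simpa using this
  ext_closed A B C f g σ hA hC := by
    obtain ⟨h1, s, hs, h⟩ := hA
    obtain ⟨h2, t, ht, h'⟩ := hC
    exact ⟨σ.finite_mid h1 h2, s * t, T.mul_mem hs ht, Fac.ext hr σ h h'⟩
  syzygy_closed K P M f g σ h1 h2 h3 hM := by
    obtain ⟨h4, s, hs, h⟩ := hM
    exact ⟨h1, s, hs, Fac.syz hr σ (h.mono (subset_Syz1 hr))⟩

lemma subset_locT (hr : IsResolving R 𝒳) (T : Submonoid R) : 𝒳 ⊆ locT 𝒳 T :=
  fun M hM => ⟨hr.fg M hM, 1, T.one_mem, Fac.of_mem (M := M) hM 1⟩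

lemma locT_mono {T T' : Submonoid R} (h : T ≤ T') : locT 𝒳 T ⊆ locT 𝒳 T' :=
  fun _ hM => ⟨hM.1, hM.2.choose, h hM.2.choose_spec.1, hM.2.choose_spec.2⟩

lemma locT_mono' {T : Submonoid R} (h : 𝒳 ⊆ 𝒴) : locT 𝒳 T ⊆ locT 𝒴 T :=
  fun _ hM => ⟨hM.1, hM.2.choose, hM.2.choose_spec.1, hM.2.choose_spec.2.mono h⟩

lemma locT_Syz1 [IsNoetherianRing R] (hr : IsResolving R 𝒳) (T : Submonoid R) :
    locT (Syz1 𝒳) T ⊆ Syz1 (locT 𝒳 T) := by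
  rintro M ⟨h1, s, hs, h⟩
  obtain ⟨n, g, hg⟩ := exists_cover (R := R) M
  exact ⟨n, g, hg, inferInstance, s, hs, Fac.syz hr (isSES_ker g hg) h⟩

lemma locT_SyzN [IsNoetherianRing R] (hr : IsResolving R 𝒳) (T : Submonoid R) (n : ℕ) :
    locT (SyzN n 𝒳) T ⊆ SyzN n (locT 𝒳 T) := by
  induction n with
  | zero => exact subset_rfl
  | succ n ih =>
    exact (locT_Syz1 (hr.syzN n) T).trans (fun M hM => Syz1_mono (fun M h => ih h) hM)

lemma locT_locT [IsNoetherianRing R] {T : Submonoid R} :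
    locT (locT 𝒳 T) T ⊆ locT 𝒳 T := by
  rintro M ⟨h1, s, hs, X, ⟨h2, t, ht, h⟩, α, β, hh⟩
  exact ⟨h1, t * s, T.mul_mem ht hs, h.retract α β hh⟩

/-- `𝒴°` w.r.t. an ideal -/
def circ (I : Ideal R) (𝒳 : Set (ModuleCat.{u} R)) : Set (ModuleCat.{u} R) :=
  {M | Module.Finite R M ∧ ∀ s ∈ I, M ∈ locT 𝒳 (Submonoid.powers s)}

lemma IsResolving.circ [IsNoetherianRing R] (hr : IsResolving R 𝒳) (I : Ideal R) :
    IsResolving R (circ I 𝒳) where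
  fg M hM := hM.1
  iso_closed M N e hM := by
    have := hM.1
    exact ⟨Module.Finite.equiv e.some, fun s hs => (hr.locT _).iso_closed M N e (hM.2 s hs)⟩
  proj_mem M h1 h2 := ⟨h1, fun s hs => (hr.locT _).proj_mem M h1 h2⟩
  summand_closed M N hMN := by
    have h1 : Module.Finite R (M × N) := hMN.1
    exact ⟨Module.Finite.of_surjective (LinearMap.fst R M N) Prod.fst_surjective,
      fun s hs => (hr.locT _).summand_closed M N (hMN.2 s hs)⟩
  ext_closed A B C f g σ hA hC := ⟨σ.finite_mid hA.1 hC.1,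
    fun s hs => (hr.locT _).ext_closed A B C f g σ (hA.2 s hs) (hC.2 s hs)⟩
  syzygy_closed K P M f g σ h1 h2 h3 hM := ⟨h1,
    fun s hs => (hr.locT _).syzygy_closed K P M f g σ h1 h2 h3 (hM.2 s hs)⟩

lemma subset_circ (hr : IsResolving R 𝒳) (I : Ideal R) : 𝒳 ⊆ circ I 𝒳 :=
  fun M hM => ⟨hr.fg M hM, fun _ _ => subset_locT hr _ hM⟩

lemma circ_circ [IsNoetherianRing R] (I : Ideal R) : circ I (circ I 𝒳) ⊆ circ I 𝒳 := by
  intro M hM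
  refine ⟨hM.1, fun s hs => locT_locT ?_⟩
  exact locT_mono' (fun N hN => hN.2 s hs) (hM.2 s hs)

lemma circ_mono (I : Ideal R) (h : 𝒳 ⊆ 𝒴) : circ I 𝒳 ⊆ circ I 𝒴 :=
  fun _ hM => ⟨hM.1, fun s hs => locT_mono' h (hM.2 s hs)⟩

lemma circ_Syz1 [IsNoetherianRing R] (hr : IsResolving R 𝒳) (I : Ideal R) :
    circ I (Syz1 𝒳) ⊆ Syz1 (circ I 𝒳) := by
  rintro M ⟨h1, h2⟩
  obtain ⟨n, g, hg⟩ := exists_cover (R := R) M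
  refine ⟨n, g, hg, inferInstance, fun s hs => ?_⟩
  exact (hr.locT _).syz1_ker (isSES_ker g hg) (locT_Syz1 hr _ (h2 s hs))

lemma circ_SyzN [IsNoetherianRing R] (hr : IsResolving R 𝒳) (I : Ideal R) (n : ℕ) :
    circ I (SyzN n 𝒳) ⊆ SyzN n (circ I 𝒳) := by
  induction n with
  | zero => exact subset_rfl
  | succ n ih =>
    exact (circ_Syz1 (hr.syzN n) I).trans (fun M hM => Syz1_mono (fun M h => ih h) hM)

/-- `E_x` -/
abbrev Ex (π : F →ₗ[R] N) (x : R) : Submodule R (F × N) := pb π (x • (LinearMap.id : N →ₗ[R] N))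

lemma Ex_ses_snd {ι : K →ₗ[R] F} {π : F →ₗ[R] N} (s : IsSES ι π) (x : R) :
    IsSES (pbInl ι π (x • (LinearMap.id : N →ₗ[R] N)) s.zero) (pbSnd π (x • LinearMap.id)) :=
  pb_ses_snd s _

lemma Ex_ses_sub {π : F →ₗ[R] N} (hπ : Function.Surjective π) (x : R) :
    IsSES (Ex π x).subtype (π ∘ₗ LinearMap.fst R F N -
      (x • (LinearMap.id : N →ₗ[R] N)) ∘ₗ LinearMap.snd R F N) := by
  refine isSES_ker _ (fun n => ?_)
  obtain ⟨f, rfl⟩ := hπ n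
  exact ⟨(f, 0), by simp⟩

lemma Ex_fac (hr : IsResolving R 𝒳) (π : F →ₗ[R] N) (x : R) [Module.Finite R F]
    [Module.Projective R F] : Fac 𝒳 (Ex π x) x := by
  refine Fac.mk (X := F) hr.proj (pbFst π (x • LinearMap.id))
    (((x • (LinearMap.id : F →ₗ[R] F)).prod π).codRestrict _ (fun f => mem_pb.2 (by simp))) ?_
  rintro ⟨⟨f, n⟩, h⟩
  have h := mem_pb.1 h
  apply Subtype.ext
  exact Prod.ext rfl h

lemma Ex_ses_quot {π : F →ₗ[R] N} (hπ : Function.Surjective π) {x : R} (hx : IsSMulRegular N x) :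
    IsSES (pbFst π (x • LinearMap.id)) ((x • (⊤ : Submodule R N)).mkQ ∘ₗ π) := by
  refine IsSES.mk' ?_ ?_ ?_ ?_
  · rintro ⟨⟨f, n⟩, h⟩ hf
    have h := mem_pb.1 h
    have hf : f = 0 := hf
    subst hf
    have : x • n = x • (0 : N) := by simpa using h.symm
    have := hx this
    subst this; rfl
  · exact ((Submodule.mkQ_surjective _).comp hπ)
  · rintro ⟨⟨f, n⟩, h⟩
    have h := mem_pb.1 h
    have h : π f = x • n := h
    show (x • (⊤ : Submodule R N)).mkQ (π f) = 0
    rw [h]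
    exact (Submodule.Quotient.mk_eq_zero _).2 (Submodule.smul_mem_pointwise_smul n x (⊤ : Submodule R N) trivial)
  · intro f hf
    have : π f ∈ x • (⊤ : Submodule R N) := by simpa using hf
    obtain ⟨n, -, hn⟩ := (Submodule.mem_smul_pointwise_iff_exists _ _ _).1 this
    exact ⟨⟨(f, n), mem_pb.2 (by simpa using hn.symm)⟩, rfl⟩

lemma smul_ses {x : R} (hx : IsSMulRegular N x) :
    IsSES (x • (LinearMap.id : N →ₗ[R] N)) (x • (⊤ : Submodule R N)).mkQ := by
  refine IsSES.mk' (fun n hn => hx (by simpa using hn)) (Submodule.mkQ_surjective _) ?_ ?_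
  · intro n; exact (Submodule.Quotient.mk_eq_zero _).2 (Submodule.smul_mem_pointwise_smul n x (⊤ : Submodule R N) trivial)
  · intro f hf
    have : f ∈ x • (⊤ : Submodule R N) := by simpa using hf
    obtain ⟨n, -, hn⟩ := (Submodule.mem_smul_pointwise_iff_exists _ _ _).1 this
    exact ⟨n, by simpa using hn⟩

lemma quot_in_syz1 [IsNoetherianRing R] (hr : IsResolving R 𝒳) {x : R} (hx : IsSMulRegular N x)
    (hN : In 𝒳 N) : In (Syz1 𝒳) (QuotSMulTop x N) :=
  hr.coker_mem (smul_ses hx) hN hN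

/-- `{M | x • id factors}` -/
def facSet (𝒳 : Set (ModuleCat.{u} R)) (x : R) : Set (ModuleCat.{u} R) :=
  {M | Module.Finite R M ∧ Fac 𝒳 M x}

lemma Ex_base [IsNoetherianRing R] (hr : IsResolving R 𝒳) {π : F →ₗ[R] N}
    [Module.Finite R F] [Module.Projective R F]
    (hπ : Function.Surjective π) {x : R} (hE : In 𝒳 (Ex π x)) (hN : Fac 𝒳 N x) : In 𝒳 N := by
  obtain ⟨X, hX, α, β, h⟩ := hN
  let φ : Ex π x →ₗ[R] (pb β π × N) :=
    ((((α ∘ₗ pbSnd π _).prod (pbFst π _)).codRestrict (pb β π) (fun e => by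
      obtain ⟨⟨f, n⟩, he⟩ := e
      have he := mem_pb.1 he
      refine mem_pb.2 ?_
      simp only [LinearMap.id_coe, LinearMap.smul_apply, id] at he
      exact (h n).trans he.symm))).prod (pbSnd π _)
  let ψ : (pb β π × N) →ₗ[R] X := (pbFst β π).coprod (-α)
  have s : IsSES φ ψ := by
    refine IsSES.mk' ?_ ?_ ?_ ?_
    · rintro ⟨⟨f, n⟩, he⟩ h0
      have h1 := congrArg (fun t => t.1.1.2) h0
      have h2 := congrArg (fun t => t.2) h0
      exact Subtype.ext (Prod.ext h1 h2)
    · intro y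
      obtain ⟨f, hf⟩ := hπ (β y)
      exact ⟨(⟨(y, f), mem_pb.2 hf.symm⟩, 0), by simp [ψ, pbFst]⟩
    · rintro ⟨⟨f, n⟩, he⟩
      show α n + - α n = 0
      simp
    · rintro ⟨⟨⟨y, f⟩, hyf⟩, n⟩ h0
      have h0 : y + - α n = 0 := h0
      have h0 : y = α n := by rwa [← sub_eq_add_neg, sub_eq_zero] at h0
      subst h0
      have hyf := mem_pb.1 hyf
      refine ⟨⟨(f, n), mem_pb.2 ?_⟩, rfl⟩
      rw [← hyf]; simp [h]
  have := hr.ext s hE hX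
  exact hr.retract (LinearMap.inr R (pb β π) N) (LinearMap.snd R (pb β π) N) (by simp) this

lemma Ex_syz {ι : K →ₗ[R] F} {π : F →ₗ[R] N} (s : IsSES ι π) {G : Type u} [AddCommGroup G]
    [Module R G] {ρ : G →ₗ[R] K} (hρ : Function.Surjective ρ) (x : R) :
    ∃ (i : Ex ρ x →ₗ[R] G × F) (j : G × F →ₗ[R] Ex π x), IsSES i j := by
  let j : G × F →ₗ[R] Ex π x := (((ι ∘ₗ ρ).prod 0).coprod ((x • (LinearMap.id)).prod π)).codRestrict _
    (fun y => mem_pb.2 (by simp [s.zero]))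
  let i : Ex ρ x →ₗ[R] G × F := (pbFst ρ _).prod (-(ι ∘ₗ pbSnd ρ _))
  refine ⟨i, j, IsSES.mk' ?_ ?_ ?_ ?_⟩
  · rintro ⟨⟨g, k⟩, h⟩ h0
    have h1 : g = 0 := congrArg (fun t => t.1) h0
    have h2 : - ι k = 0 := congrArg (fun t => t.2) h0
    have h2 : k = 0 := s.1 (by simpa using h2)
    subst h1; subst h2; rfl
  · rintro ⟨⟨f, n⟩, h⟩
    have h := mem_pb.1 h
    obtain ⟨f', rfl⟩ := s.2.1 n
    obtain ⟨k, hk⟩ := s.ex (b := f - x • f') (by simpa [sub_eq_zero] using h)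
    obtain ⟨g, rfl⟩ := hρ k
    refine ⟨(g, f'), Subtype.ext ?_⟩
    show ((ι (ρ g), 0) + (x • f', π f') : F × N) = (f, π f')
    rw [hk]; simp
  · rintro ⟨⟨g, k⟩, h⟩
    have h := mem_pb.1 h
    apply Subtype.ext
    show ((ι (ρ g), 0) + (x • (- ι k), π (- ι k)) : F × N) = (0, 0)
    have h : ρ g = x • k := h
    rw [h]; simp [s.zero]
  · rintro ⟨g, f⟩ h
    have h : ((ι (ρ g), 0) + (x • f, π f) : F × N) = (0, 0) := congrArg Subtype.val h
    simp at h
    obtain ⟨k, rfl⟩ := s.ex h.2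
    refine ⟨⟨(g, -k), mem_pb.2 (s.1 ?_)⟩, ?_⟩
    · simp [eq_neg_of_add_eq_zero_left h.1]
    · show (g, - ι (-k)) = (g, ι k)
      simp

/-- Lemma `K_j`. -/
lemma Ex_main [IsNoetherianRing R] (hr : IsResolving R 𝒳) {x : R} (j : ℕ) :
    ∀ (N : Type u) [AddCommGroup N] [Module R N],
    (∀ (n : ℕ) (π : (Fin n → R) →ₗ[R] N), Function.Surjective π → In (SyzN j 𝒳) (Ex π x)) →
    In (SyzN j (facSet 𝒳 x)) N → In (SyzN j 𝒳) N := by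
  induction j with
  | zero =>
    intro N _ _ hE hN
    have := hN.1
    obtain ⟨n, g, hg⟩ := exists_cover (R := R) N
    exact Ex_base hr hg (hE n g hg) hN.2
  | succ j ih =>
    intro N _ _ hE hN
    obtain ⟨n, π, hπ, hK⟩ := in_Syz1.1 hN
    refine in_Syz1.2 ⟨n, π, hπ, ih _ ?_ hK⟩
    intro m ρ hρ
    obtain ⟨i, j', s⟩ := Ex_syz (isSES_ker π hπ) hρ x
    exact (hr.syzN j).syz1_ker s (hE n π hπ)

lemma SyzN_powers {y : R} (j : ℕ) : ∀ (N : Type u) [AddCommGroup N] [Module R N],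
    In (SyzN j (locT 𝒳 (Submonoid.powers y))) N → ∃ n, ∀ k ≥ n, In (SyzN j (facSet 𝒳 (y ^ k))) N := by
  induction j with
  | zero =>
    rintro N _ _ ⟨h1, _, ⟨n, rfl⟩, h⟩
    refine ⟨n, fun k hk => ⟨h1, ?_⟩⟩
    obtain ⟨d, rfl⟩ := Nat.exists_eq_add_of_le' hk
    show Fac 𝒳 N (y ^ (d + n))
    rw [pow_add]; exact h.mul _
  | succ j ih =>
    rintro N _ _ hN
    obtain ⟨n, π, hπ, hK⟩ := in_Syz1.1 hN
    obtain ⟨m, hm⟩ := ih _ hK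
    exact ⟨m, fun k hk => in_Syz1.2 ⟨n, π, hπ, hm k hk⟩⟩

/-- `K_j` for a regular element. -/
lemma quot_main [IsNoetherianRing R] (hr : IsResolving R 𝒳) {y : R} (j : ℕ)
    (hy : IsSMulRegular N y) (hN : In (SyzN j (locT 𝒳 (Submonoid.powers y))) N)
    (hQ : ∀ k ≥ 1, In (SyzN (j+1) 𝒳) (QuotSMulTop (y ^ k) N)) : In (SyzN j 𝒳) N := by
  obtain ⟨n, hn⟩ := SyzN_powers j N hN
  refine Ex_main hr (x := y ^ (n+1)) j N (fun m π hπ => ?_) (hn (n+1) (by omega))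
  exact (hr.syzN j).syz1_ker (Ex_ses_quot hπ (hy.pow (n+1))) (hQ (n+1) (by omega))

end PartTwo

end Chunk2

section Chunk3
open scoped Pointwise
set_option linter.unusedSectionVars false
set_option linter.style.haveILetI false
section PartThree

open RingTheory.Sequence IsLocalRing

lemma le_depthE_iff {R : Type u} [CommRing R] (I : Ideal R) (M : Type u) [AddCommGroup M]
    [Module R M] (j : ℕ) : (j : ℕ∞) ≤ depthE R I M ↔
      ∃ rs : List R, rs.length = j ∧ (∀ r ∈ rs, r ∈ I) ∧ IsWeaklyRegular M rs := by
  constructor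
  · intro h
    by_contra hc
    have h1 : depthE R I M < j := by
      cases j with
      | zero => exact absurd ⟨[], rfl, by simp, by simp⟩ hc
      | succ j =>
        have : depthE R I M ≤ j := by
          refine sSup_le ?_
          rintro _ ⟨rs, h1, h2, rfl⟩
          by_contra hlt
          push Not at hlt
          have hlt : j < rs.length := by exact_mod_cast hlt
          refine hc ⟨rs.take (j+1), by simp; omega, fun r hr => h1 r (List.mem_of_mem_take hr), ?_⟩
          have := h2
          rw [← List.take_append_drop (j+1) rs, isWeaklyRegular_append_iff] at this
          exact this.1
        refine lt_of_le_of_lt this ?_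
        exact_mod_cast Nat.lt_succ_self j
    exact absurd h (not_le.2 h1)
  · rintro ⟨rs, rfl, h1, h2⟩
    exact le_sSup ⟨rs, h1, h2, rfl⟩

variable {S : Type u} [CommRing S] [IsLocalRing S]
variable {A B C M N Y F : Type u} [AddCommGroup A] [Module S A] [AddCommGroup B] [Module S B]
  [AddCommGroup C] [Module S C] [AddCommGroup M] [Module S M] [AddCommGroup N] [Module S N]
   [AddCommGroup Y] [Module S Y] [AddCommGroup F] [Module S F]

variable (S) in
/-- residue field as quotient -/
abbrev kk : Type u := S ⧸ maximalIdeal S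

open Abelian in
/-- depth at least `j` -/
def dGE (S : Type u) [CommRing S] [IsLocalRing S] (j : ℕ) (M : Type u) [AddCommGroup M]
    [Module S M] : Prop :=
  ∀ i < j, Subsingleton (Ext (ModuleCat.of S (kk S)) (ModuleCat.of S M) i)

lemma dGE.mono {j j' : ℕ} (h : dGE S j M) (hj : j' ≤ j) : dGE S j' M :=
  fun i hi => h i (lt_of_lt_of_le hi hj)

lemma dGE_zero : dGE S 0 M := fun i hi => absurd hi (by omega)

/-- short complex -/
abbrev IsSES.sc {f : A →ₗ[S] B} {g : B →ₗ[S] C} (s : IsSES f g) : ShortComplex (ModuleCat.{u} S) :=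
  ShortComplex.mk (ModuleCat.ofHom f) (ModuleCat.ofHom g) (by ext a; simp [s.zero])

lemma IsSES.shortExact {f : A →ₗ[S] B} {g : B →ₗ[S] C} (s : IsSES f g) : s.sc.ShortExact where
  exact := by
    rw [ShortComplex.ShortExact.moduleCat_exact_iff_function_exact]
    exact LinearMap.exact_iff.2 s.2.2.symm
  mono_f := by rw [ModuleCat.mono_iff_injective]; exact s.1
  epi_g := by rw [ModuleCat.epi_iff_surjective]; exact s.2.1

open Abelian

lemma dGE.mid {f : A →ₗ[S] B} {g : B →ₗ[S] C} (s : IsSES f g) {j : ℕ} (hA : dGE S j A)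
    (hC : dGE S j C) : dGE S j B := by
  intro i hi
  have h1 := hA i hi
  have h2 := hC i hi
  refine subsingleton_of_forall_eq 0 (fun x => ?_)
  obtain ⟨y, rfl⟩ := Ext.covariant_sequence_exact₂ _ s.shortExact x (Subsingleton.elim (α := Ext _ (ModuleCat.of S C) i) _ _)
  rw [Subsingleton.elim (α := Ext _ (ModuleCat.of S A) i) y 0]; simp

lemma dGE.left {f : A →ₗ[S] B} {g : B →ₗ[S] C} (s : IsSES f g) {j : ℕ} (hB : dGE S (j+1) B)
    (hC : dGE S j C) : dGE S (j+1) A := by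
  intro i hi
  refine subsingleton_of_forall_eq 0 (fun x => ?_)
  have h1 := hB i hi
  cases i with
  | zero =>
    have := s.shortExact.mono_f
    apply Ext.postcomp_mk₀_injective_of_mono (ModuleCat.of S (kk S)) s.sc.f
    exact Subsingleton.elim (α := Ext _ (ModuleCat.of S B) 0) _ _
  | succ i =>
    have h2 := hC i (by omega)
    obtain ⟨y, rfl⟩ := Ext.covariant_sequence_exact₁ _ s.shortExact x (Subsingleton.elim (α := Ext _ (ModuleCat.of S B) (i+1)) _ _) rfl
    rw [Subsingleton.elim (α := Ext _ (ModuleCat.of S C) i) y 0]; simp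

lemma dGE.right {f : A →ₗ[S] B} {g : B →ₗ[S] C} (s : IsSES f g) {j : ℕ} (hA : dGE S (j+1) A)
    (hB : dGE S j B) : dGE S j C := by
  intro i hi
  refine subsingleton_of_forall_eq 0 (fun x => ?_)
  have h1 := hB i hi
  have h2 := hA (i+1) (by omega)
  obtain ⟨y, rfl⟩ := Ext.covariant_sequence_exact₃ _ s.shortExact x rfl (Subsingleton.elim (α := Ext _ (ModuleCat.of S A) (i+1)) _ _)
  rw [Subsingleton.elim (α := Ext _ (ModuleCat.of S B) i) y 0]; simp

lemma dGE_of_retract {j : ℕ} (i : M →ₗ[S] N) (r : N →ₗ[S] M) (hri : ∀ m, r (i m) = m)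
    (h : dGE S j N) : dGE S j M := by
  intro n hn
  refine subsingleton_of_forall_eq 0 (fun x => ?_)
  have h1 := h n hn
  have : (x.comp (Ext.mk₀ (ModuleCat.ofHom i)) (add_zero n)).comp (Ext.mk₀ (ModuleCat.ofHom r)) (add_zero n) = x := by
    rw [Ext.comp_assoc_of_third_deg_zero, Ext.mk₀_comp_mk₀, ← ModuleCat.ofHom_comp]
    have : r ∘ₗ i = LinearMap.id := by ext m; simp [hri]
    rw [this]
    exact Ext.comp_mk₀_id x
  rw [← this, Subsingleton.elim (x.comp (Ext.mk₀ (ModuleCat.ofHom i)) (add_zero n)) 0]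
  simp

lemma dGE_equiv {j : ℕ} (e : M ≃ₗ[S] N) (h : dGE S j M) : dGE S j N :=
  dGE_of_retract e.symm.toLinearMap e.toLinearMap (by simp) h

lemma dGE_of_subsingleton [Subsingleton M] (j : ℕ) : dGE S j M := by
  intro i _
  refine subsingleton_of_forall_eq 0 (fun x => ?_)
  have : 𝟙 (ModuleCat.of S M) = 0 := by ext m; exact Subsingleton.elim _ _
  rw [← Ext.comp_mk₀_id x, this, Ext.mk₀_zero]; simp

/-- multiplication by an element of `m` kills Ext. -/
lemma smul_ext_zero {a : S} (ha : a ∈ maximalIdeal S) {i : ℕ}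
    (x : Ext (ModuleCat.of S (kk S)) (ModuleCat.of S M) i) :
    x.comp (Ext.mk₀ (ModuleCat.ofHom (a • (LinearMap.id : M →ₗ[S] M)))) (add_zero i) = 0 := by
  have h1 := Ext.postcomp_smul_id_eq_zero_of_mem_annihilator (R := S) (N := ModuleCat.of S (kk S))
    (M := ModuleCat.of S M) (r := a) (by
      show a ∈ Module.annihilator S (kk S)
      rw [Ideal.annihilator_quotient]; exact ha) i
  have h2 : ModuleCat.ofHom (a • (LinearMap.id : M →ₗ[S] M)) = a • 𝟙 (ModuleCat.of S M) := by
    ext m; simp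
  have := congrArg (fun t => t.hom x) h1
  rw [h2]
  simpa using this

/-- depth of `E_a(Y)` is at most depth of `Y`. -/
lemma dGE_of_Ex {π : F →ₗ[S] Y} (hπ : Function.Surjective π) {a : S} (ha : a ∈ maximalIdeal S)
    {j : ℕ} (h : dGE S j (Ex π a)) : dGE S j Y := by
  have s := Ex_ses_sub hπ a
  intro i hi
  refine subsingleton_of_forall_eq 0 (fun x => ?_)
  have h1 := h i hi
  set x' := x.comp (Ext.mk₀ (ModuleCat.ofHom (LinearMap.inr S F Y))) (add_zero i) with hx'
  have h2 : x'.comp (Ext.mk₀ s.sc.g) (add_zero i) = 0 := by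
    rw [hx', Ext.comp_assoc_of_third_deg_zero, Ext.mk₀_comp_mk₀, ← ModuleCat.ofHom_comp]
    have : (π ∘ₗ LinearMap.fst S F Y - (a • (LinearMap.id : Y →ₗ[S] Y)) ∘ₗ LinearMap.snd S F Y) ∘ₗ
      LinearMap.inr S F Y = (-a) • LinearMap.id := by ext m; simp
    rw [this]
    exact smul_ext_zero (by simpa using ha) x
  obtain ⟨y, hy⟩ := Ext.covariant_sequence_exact₂ _ s.shortExact x' h2
  have h0 : x' = 0 := by
    rw [← hy, Subsingleton.elim (α := Ext _ (ModuleCat.of S (Ex π a)) i) y 0]; simp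
  have : x'.comp (Ext.mk₀ (ModuleCat.ofHom (LinearMap.snd S F Y))) (add_zero i) = x := by
    rw [hx', Ext.comp_assoc_of_third_deg_zero, Ext.mk₀_comp_mk₀, ← ModuleCat.ofHom_comp]
    rw [LinearMap.snd_comp_inr]
    exact Ext.comp_mk₀_id x
  rw [← this, h0]; simp

section Noeth
variable [IsNoetherianRing S]

lemma dGE_iff_exists [Module.Finite S M] (j : ℕ) : dGE S j M ↔
    ∃ rs : List S, rs.length = j ∧ (∀ r ∈ rs, r ∈ maximalIdeal S) ∧ IsWeaklyRegular M rs := by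
  rcases subsingleton_or_nontrivial M with hM | hM
  · refine ⟨fun _ => ⟨List.replicate j 0, by simp, fun r hr => ?_, ?_⟩, fun _ => dGE_of_subsingleton j⟩
    · rw [List.eq_of_mem_replicate hr]; exact zero_mem _
    · refine ⟨fun i hi => ?_⟩
      intro a b _
      have : Subsingleton (M ⧸ (Ideal.ofList (List.take i (List.replicate j (0 : S))) • (⊤ : Submodule S M))) :=
        (Submodule.mkQ_surjective _).subsingleton
      exact Subsingleton.elim _ _
  · have hlt : maximalIdeal S • (⊤ : Submodule S M) < ⊤ := by
      refine lt_of_le_of_ne le_top (fun h => ?_)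
      have := Submodule.eq_bot_of_le_smul_of_le_jacobson_bot (maximalIdeal S) (⊤ : Submodule S M)
        (Module.Finite.fg_top) (le_of_eq h.symm) (IsLocalRing.maximalIdeal_le_jacobson _)
      exact absurd this (by simp)
    have hsupp : Module.support S (kk S) = PrimeSpectrum.zeroLocus (maximalIdeal S : Set S) := by
      rw [Module.support_eq_zeroLocus, Ideal.annihilator_quotient]
    constructor
    · intro h
      obtain ⟨rs, h1, h2, h3⟩ := ModuleCat.exists_isRegular_of_exists_subsingleton_ext
        (maximalIdeal S) j (ModuleCat.of S M) hlt (ModuleCat.of S (kk S)) hsupp h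
      exact ⟨rs, h1, h2, h3.toIsWeaklyRegular⟩
    · rintro ⟨rs, rfl, h2, h3⟩
      exact ModuleCat.subsingleton_ext_of_exists_isRegular
        (maximalIdeal S) (ModuleCat.of S (kk S)) hsupp.le (ModuleCat.of S M) hlt rs h2
        ((IsLocalRing.isRegular_iff_isWeaklyRegular_of_subset_maximalIdeal h2).2 h3)

lemma le_depthE_iff_dGE [Module.Finite S M] (j : ℕ) :
    (j : ℕ∞) ≤ depthE S (maximalIdeal S) M ↔ dGE S j M := by
  rw [le_depthE_iff, dGE_iff_exists]

lemma dGE_quot_iff [Module.Finite S M] {x : S} (hx : x ∈ maximalIdeal S) (hreg : IsSMulRegular M x)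
    (j : ℕ) : dGE S (j+1) M ↔ dGE S j (QuotSMulTop x M) := by
  constructor
  · intro h
    exact dGE.right (smul_ses hreg) h (h.mono (by omega))
  · intro h
    obtain ⟨rs, h1, h2, h3⟩ := (dGE_iff_exists j).1 h
    exact (dGE_iff_exists (j+1)).2 ⟨x :: rs, by simp [h1], fun r hr => by
      rcases List.mem_cons.1 hr with rfl | hr
      exacts [hx, h2 r hr],
      (isWeaklyRegular_cons_iff _ _ _).2 ⟨hreg, h3⟩⟩

lemma dGE_one_iff [Module.Finite S M] :
    dGE S 1 M ↔ ∃ x ∈ maximalIdeal S, IsSMulRegular M x := by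
  rw [dGE_iff_exists]
  constructor
  · rintro ⟨rs, h1, h2, h3⟩
    obtain ⟨x, rfl⟩ := List.length_eq_one_iff.1 h1
    exact ⟨x, h2 x (by simp), (isWeaklyRegular_singleton_iff _ _).1 h3⟩
  · rintro ⟨x, h1, h2⟩
    exact ⟨[x], rfl, by simpa using h1, (isWeaklyRegular_singleton_iff _ _).2 h2⟩

/-- no socle implies a regular element -/
lemma exists_regular_of_socle [Module.Finite S M]
    (h : ∀ v : M, (∀ a ∈ maximalIdeal S, a • v = 0) → v = 0) :
    ∃ x ∈ maximalIdeal S, IsSMulRegular M x := by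
  have : Subsingleton (kk S →ₗ[S] M) := by
    refine subsingleton_of_forall_eq 0 (fun φ => ?_)
    have h1 : φ (Submodule.mkQ _ 1) = 0 := h _ (fun a ha => by
      rw [← map_smul, ← map_smul]
      have : (maximalIdeal S).mkQ (a • (1 : S)) = 0 := by
        rw [Submodule.mkQ_apply, Submodule.Quotient.mk_eq_zero]; simpa using ha
      rw [this, map_zero])
    refine LinearMap.ext (fun y => ?_)
    obtain ⟨s, rfl⟩ := Submodule.mkQ_surjective _ y
    have : (maximalIdeal S).mkQ s = s • (maximalIdeal S).mkQ 1 := by rw [← map_smul]; simp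
    rw [this, map_smul, h1]; simp
  obtain ⟨r, hr, hr'⟩ := IsSMulRegular.subsingleton_linearMap_iff.1 this
  rw [Ideal.annihilator_quotient] at hr
  exact ⟨r, hr, hr'⟩

lemma socle_zero_of_dGE_one [Module.Finite S M] (h : dGE S 1 M) {v : M}
    (hv : ∀ a ∈ maximalIdeal S, a • v = 0) : v = 0 := by
  obtain ⟨x, h1, h2⟩ := dGE_one_iff.1 h
  exact h2 (by simpa using hv x h1)

end Noeth
end PartThree

end Chunk3

section Chunk4
open scoped Pointwise
set_option linter.unusedSectionVars false
set_option linter.style.haveILetI false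
section PartFour

open RingTheory.Sequence IsLocalRing

variable {S : Type u} [CommRing S] [IsLocalRing S] [IsNoetherianRing S]
variable {A B C M N Y F U X : Type u} [AddCommGroup A] [Module S A] [AddCommGroup B] [Module S B]
  [AddCommGroup C] [Module S C] [AddCommGroup M] [Module S M] [AddCommGroup N] [Module S N]
   [AddCommGroup Y] [Module S Y] [AddCommGroup F] [Module S F] [AddCommGroup U] [Module S U]
   [AddCommGroup X] [Module S X]
   {𝒳 𝒲 𝒵 : Set (ModuleCat.{u} S)}

lemma in_of_finiteLength (hr : IsResolving S 𝒲) (hk : In 𝒲 (kk S)) [Module.Finite S N] {r : ℕ}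
    (hN : ∀ a ∈ maximalIdeal S ^ r, ∀ v : N, a • v = 0) : In 𝒲 N := by
  revert hN
  induction ‹Module.Finite S N› using IsNoetherianRing.induction_on_isQuotientEquivQuotientPrime S with
  | subsingleton N => exact fun _ => hr.of_subsingleton
  | quotient N p e =>
    intro h
    have h1 : maximalIdeal S ^ r ≤ p.1 := by
      intro a ha
      have := h a ha (e.symm (Submodule.mkQ _ 1))
      rw [← map_smul, ← map_smul] at this
      have := e.symm.injective (this.trans (map_zero _).symm)
      simpa using (Submodule.Quotient.mk_eq_zero _).1 this
    have h2 : p.1 = maximalIdeal S := by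
      have := p.2.le_of_pow_le h1
      exact ((maximalIdeal.isMaximal S).eq_of_le p.2.ne_top this).symm
    rw [h2] at e
    exact hr.equiv e.symm hk
  | exact N₁ N₂ N₃ f g hf hg hfg h1 h3 =>
    intro h
    refine hr.ext (f := f) (g := g) ⟨hf, hg, (LinearMap.exact_iff.1 hfg).symm⟩ (h1 ?_) (h3 ?_)
    · intro a ha v; exact hf (by simp [h a ha])
    · intro a ha v
      obtain ⟨v, rfl⟩ := hg v
      rw [← map_smul, h a ha, map_zero]

lemma exists_gam (N : Type u) [AddCommGroup N] [Module S N] [Module.Finite S N] :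
    ∃ (G : Submodule S N) (r : ℕ), (∀ a ∈ maximalIdeal S ^ r, ∀ v ∈ G, a • v = 0) ∧
      ∀ v, (∀ a ∈ maximalIdeal S, a • v ∈ G) → v ∈ G := by
  have hne : {G : Submodule S N | ∃ r, ∀ a ∈ maximalIdeal S ^ r, ∀ v ∈ G, a • v = 0}.Nonempty :=
    ⟨⊥, 0, fun a _ v hv => by simp [(Submodule.mem_bot S).1 hv]⟩
  obtain ⟨G, ⟨r, hr⟩, hmax⟩ := WellFounded.has_min (wellFounded_gt (α := Submodule S N)) _ hne
  refine ⟨G, r, hr, fun v hv => ?_⟩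
  by_contra hvG
  refine hmax (G ⊔ Submodule.span S {v}) ⟨r + 1, ?_⟩ ?_
  · intro a ha w hw
    obtain ⟨g, hg, y, hy, rfl⟩ := Submodule.mem_sup.1 hw
    obtain ⟨c, rfl⟩ := Submodule.mem_span_singleton.1 hy
    have h1 : a • g = 0 := hr a (Ideal.pow_le_pow_right (Nat.le_succ r) ha) g hg
    have h2 : a • v = 0 := by
      rw [pow_succ] at ha
      refine Submodule.mul_induction_on ha (fun x hx y hy => ?_) (fun x y hx hy => ?_)
      · rw [mul_smul]; exact hr x hx _ (hv y hy)
      · rw [add_smul, hx, hy, add_zero]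
    rw [smul_add, h1, smul_comm, h2]; simp
  · refine lt_of_le_of_ne le_sup_left (fun h => hvG ?_)
    rw [h]; exact Submodule.mem_sup_right (Submodule.mem_span_singleton_self v)

lemma gam_regular [Module.Finite S N] {G : Submodule S N}
    (h : ∀ v, (∀ a ∈ maximalIdeal S, a • v ∈ G) → v ∈ G) :
    ∃ x ∈ maximalIdeal S, IsSMulRegular (N ⧸ G) x := by
  refine exists_regular_of_socle (fun v hv => ?_)
  obtain ⟨v, rfl⟩ := G.mkQ_surjective v
  refine (Submodule.Quotient.mk_eq_zero _).2 (h v (fun a ha => ?_))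
  exact (Submodule.Quotient.mk_eq_zero _).1 (hv a ha)

lemma gam_circ (hr : IsResolving S 𝒲) {G : Submodule S N} {r : ℕ}
    (h : ∀ a ∈ maximalIdeal S ^ r, ∀ v ∈ G, a • v = 0) (hN : In 𝒲 N) :
    In (circ (maximalIdeal S) 𝒲) (N ⧸ G) := by
  have := hr.finite hN
  refine ⟨inferInstanceAs (Module.Finite S (N ⧸ G)), fun s hs => ⟨inferInstanceAs (Module.Finite S (N ⧸ G)),
    s ^ r, ⟨r, rfl⟩, ?_⟩⟩
  refine Fac.mk hN (G.liftQ (s ^ r • LinearMap.id) (fun v hv => LinearMap.mem_ker.2 (h _ (Ideal.pow_mem_pow hs r) v hv)))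
    G.mkQ (fun v => ?_)
  obtain ⟨v, rfl⟩ := G.mkQ_surjective v
  rfl

/-- `C(j)` -/
lemma Cj (hr : IsResolving S 𝒵) : ∀ (I : Ideal S) (j : ℕ) (N : Type u) [AddCommGroup N] [Module S N],
    Module.annihilator S N = I → In (SyzN j 𝒵) (kk S) →
    In (SyzN j (circ (maximalIdeal S) 𝒵)) N → In (SyzN j 𝒵) N := by
  intro I
  induction I using WellFoundedGT.induction with
  | ind I ih =>
  intro j N _ _ hI hk hN
  have hc := hr.circ (maximalIdeal S)
  have := (hc.syzN j).finite hN
  obtain ⟨G, r, h1, h2⟩ := exists_gam (S := S) N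
  have hG : In (SyzN j 𝒵) G := in_of_finiteLength (hr.syzN j) hk (r := r)
    (fun a ha v => Subtype.ext (h1 a ha v v.2))
  suffices hQ : In (SyzN j 𝒵) (N ⧸ G) from (hr.syzN j).ext (isSES_mkQ G) hG hQ
  have hN' : In (SyzN j (circ (maximalIdeal S) 𝒵)) (N ⧸ G) :=
    SyzN_mono j (circ_circ _) (circ_SyzN hc _ j (gam_circ (hc.syzN j) h1 hN))
  rcases subsingleton_or_nontrivial (N ⧸ G) with hs | hnt
  · exact (hr.syzN j).of_subsingleton
  obtain ⟨y, hy, hreg⟩ := gam_regular h2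
  refine quot_main hr j hreg (SyzN_mono j (fun M hM => hM.2 y hy) hN') (fun k hk1 => ?_)
  refine ih _ ?_ (j+1) _ rfl ((hr.syzN j).in_syz1 hk) (quot_in_syz1 (hc.syzN j) (hreg.pow k) hN')
  rw [← hI]
  refine lt_of_le_of_ne ?_ ?_
  · intro a ha
    rw [Module.mem_annihilator] at ha ⊢
    intro v
    obtain ⟨v, rfl⟩ := Submodule.mkQ_surjective _ v
    obtain ⟨v, rfl⟩ := Submodule.mkQ_surjective _ v
    rw [← map_smul, ← map_smul, ha, map_zero, map_zero]
  · intro he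
    have h3 : y ^ k ∈ Module.annihilator S (QuotSMulTop (y ^ k) (N ⧸ G)) := by
      rw [Module.mem_annihilator]
      intro v
      obtain ⟨v, rfl⟩ := Submodule.mkQ_surjective _ v
      exact (Submodule.Quotient.mk_eq_zero _).2 (Submodule.smul_mem_pointwise_smul v _ (⊤ : Submodule S (N ⧸ G)) trivial)
    rw [← he, Module.mem_annihilator] at h3
    obtain ⟨v, hv⟩ := exists_ne (0 : N ⧸ G)
    refine hv (hreg.pow k ?_)
    obtain ⟨w, rfl⟩ := Submodule.mkQ_surjective _ v
    show y ^ k • G.mkQ w = y ^ k • 0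
    rw [← map_smul, h3]; simp

/-- Claim(i,j) -/
lemma claim_ij (hr : IsResolving S 𝒵) (i : ℕ) : ∀ (j : ℕ) (N : Type u) [AddCommGroup N] [Module S N],
    dGE S i N → In (SyzN (i + j) 𝒵) (kk S) →
    In (SyzN j (circ (maximalIdeal S) 𝒵)) N → In (SyzN j 𝒵) N := by
  have hc := hr.circ (maximalIdeal S)
  induction i with
  | zero =>
    intro j N _ _ _ hk hN
    rw [zero_add] at hk
    exact Cj hr _ j N rfl hk hN
  | succ i ih =>
    intro j N _ _ hd hk hN
    have := (hc.syzN j).finite hN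
    obtain ⟨y, hy, hreg⟩ := dGE_one_iff.1 (hd.mono (by omega : 1 ≤ i + 1))
    refine quot_main hr j hreg (SyzN_mono j (fun M hM => hM.2 y hy) hN) (fun k hk1 => ?_)
    refine ih (j+1) _ ?_ (by rwa [show i + (j + 1) = i + 1 + j by omega])
      (quot_in_syz1 (hc.syzN j) (hreg.pow k) hN)
    exact (dGE_quot_iff (Ideal.pow_mem_of_mem _ hy k hk1) (hreg.pow k) i).1 hd

lemma exists_depth_zero (hr : IsResolving S 𝒵) (c : ℕ) : ∀ (a : ℕ) (X : Type u) [AddCommGroup X] [Module S X],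
    In (SyzN a 𝒵) X → dGE S c X → ¬ dGE S (c+1) X →
    ∃ Y : ModuleCat.{u} S, Y ∈ SyzN (a + c) 𝒵 ∧ ¬ dGE S 1 Y := by
  induction c with
  | zero => exact fun a X _ _ h1 h2 h3 => ⟨ModuleCat.of S X, h1, h3⟩
  | succ c ih =>
    intro a X _ _ h1 h2 h3
    have := (hr.syzN a).finite h1
    obtain ⟨y, hy, hreg⟩ := dGE_one_iff.1 (h2.mono (by omega : 1 ≤ c + 1))
    obtain ⟨Y, h4, h5⟩ := ih (a+1) (QuotSMulTop y X) (quot_in_syz1 (hr.syzN a) hreg h1)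
      ((dGE_quot_iff hy hreg c).1 h2) (fun h => h3 ((dGE_quot_iff hy hreg (c+1)).2 h))
    exact ⟨Y, by rwa [show a + (c+1) = a + 1 + c by omega], h5⟩

/-- `k` is a summand of nonzero `k`-vector spaces -/
lemma in_kk_of_killed (hr : IsResolving S 𝒲) [Nontrivial U] (hU : In 𝒲 U)
    (h : ∀ a ∈ maximalIdeal S, ∀ v : U, a • v = 0) : In 𝒲 (kk S) := by
  have := hr.finite hU
  obtain ⟨V, hV, -⟩ := (eq_top_or_exists_le_coatom (⊥ : Submodule S U)).resolve_left bot_ne_top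
  have hs : IsSimpleModule S (U ⧸ V) := isSimpleModule_iff_isCoatom.2 hV
  obtain ⟨I, hI, ⟨e⟩⟩ := isSimpleModule_iff_quot_maximal.1 hs
  obtain rfl := IsLocalRing.eq_maximalIdeal hI
  let p : U →ₗ[S] kk S := e.toLinearMap ∘ₗ V.mkQ
  have hp : Function.Surjective p := e.surjective.comp V.mkQ_surjective
  obtain ⟨u, hu⟩ := hp ((maximalIdeal S).mkQ 1)
  refine hr.retract ((maximalIdeal S).liftQ (LinearMap.toSpanSingleton S U u)
    (fun a ha => h a ha u)) p (fun m => ?_) hU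
  obtain ⟨s, rfl⟩ := (maximalIdeal S).mkQ_surjective m
  show p (s • u) = _
  rw [map_smul, hu, ← map_smul]
  simp

lemma Cdom (hr : IsResolving S 𝒵) {j : ℕ} (hk : In (SyzN (j+1) 𝒵) (kk S)) (hY : In (SyzN j 𝒵) Y)
    (hd : ¬ dGE S 1 Y) : In (SyzN j 𝒵) (kk S) := by
  have := (hr.syzN j).finite hY
  obtain ⟨G, r, h1, h2⟩ := exists_gam (S := S) Y
  have hQ : In (SyzN (j+1) 𝒵) (Y ⧸ G) := by
    refine Cj hr _ (j+1) _ rfl hk ?_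
    exact circ_SyzN hr _ (j+1) (gam_circ (hr.syzN (j+1)) h1 ((hr.syzN j).in_syz1 hY))
  have hG : In (SyzN j 𝒵) G := (hr.syzN j).ker_mem (isSES_mkQ G) hY hQ
  have hG0 : Nontrivial G := by
    by_contra hn
    rw [not_nontrivial_iff_subsingleton] at hn
    refine hd (dGE_one_iff.2 (exists_regular_of_socle (fun v hv => ?_)))
    have : v ∈ G := h2 v (fun a ha => by rw [hv a ha]; exact zero_mem _)
    exact congrArg Subtype.val (Subsingleton.elim (⟨v, this⟩ : G) 0)
  -- descend
  have key : ∀ (r : ℕ) (G : Type u) [AddCommGroup G] [Module S G] [Nontrivial G], In (SyzN j 𝒵) G →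
      (∀ a ∈ maximalIdeal S ^ r, ∀ v : G, a • v = 0) → In (SyzN j 𝒵) (kk S) := by
    intro r
    induction r with
    | zero =>
      intro G _ _ _ _ h
      obtain ⟨v, hv⟩ := exists_ne (0 : G)
      exact absurd (by simpa using h 1 (by simp) v) hv
    | succ r ih =>
      intro G _ _ _ hG h
      have := (hr.syzN j).finite hG
      by_cases h0 : ∀ a ∈ maximalIdeal S, ∀ v : G, a • v = 0
      · exact in_kk_of_killed (hr.syzN j) hG h0
      push Not at h0
      obtain ⟨a, ha, v, hv⟩ := h0
      let mG : Submodule S G := maximalIdeal S • ⊤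
      have hq : In (SyzN (j+1) 𝒵) (G ⧸ mG) := in_of_finiteLength (hr.syzN (j+1)) hk (r := 1)
        (fun a ha v => by
          obtain ⟨v, rfl⟩ := mG.mkQ_surjective v
          rw [pow_one] at ha
          exact (Submodule.Quotient.mk_eq_zero _).2 (Submodule.smul_mem_smul ha trivial))
      have hm : In (SyzN j 𝒵) mG := (hr.syzN j).ker_mem (isSES_mkQ mG) hG hq
      have : Nontrivial mG := ⟨⟨⟨a • v, Submodule.smul_mem_smul ha trivial⟩, 0,
        fun h => hv (congrArg Subtype.val h)⟩⟩
      refine ih mG hm (fun b hb v => Subtype.ext ?_)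
      obtain ⟨v, hv⟩ := v
      show b • v = 0
      refine Submodule.smul_induction_on hv (fun c hc n _ => ?_) (fun x y hx hy => ?_)
      · rw [← mul_smul]; exact h _ (by rw [pow_succ]; exact Ideal.mul_mem_mul hb hc) n
      · rw [smul_add, hx, hy, add_zero]
  exact key r G hG (fun a ha v => Subtype.ext (h1 a ha v v.2))

/-- Core. -/
theorem core (hr : IsResolving S 𝒵) {n : ℕ} (hk : In (SyzN n 𝒵) (kk S)) (hX : In 𝒵 X)
    (hXM : ∀ j, dGE S j X → dGE S j M) (hM : In (circ (maximalIdeal S) 𝒵) M) : In 𝒵 M := by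
  classical
  have hex : ∃ c, In (SyzN c 𝒵) (kk S) := ⟨n, hk⟩
  let c := Nat.find hex
  have hc : In (SyzN c 𝒵) (kk S) := Nat.find_spec hex
  have hdX : dGE S c X := by
    by_contra hd
    have hex' : ∃ d, ¬ dGE S d X := ⟨c, hd⟩
    have h1 := Nat.find_spec hex'
    have h2 : Nat.find hex' ≤ c := Nat.find_min' hex' hd
    obtain ⟨c', hc'⟩ : ∃ c', Nat.find hex' = c' + 1 :=
      Nat.exists_eq_succ_of_ne_zero (fun h => by rw [h] at h1; exact h1 dGE_zero)
    have h3 : dGE S c' X := by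
      have := Nat.find_min hex' (m := c') (by omega)
      simpa using this
    rw [hc'] at h1 h2
    obtain ⟨Y, hY, hY'⟩ := exists_depth_zero hr c' 0 X hX h3 h1
    obtain ⟨j, hj⟩ : ∃ j, c = j + 1 := ⟨c - 1, by omega⟩
    rw [hj] at hc
    have hY2 : In (SyzN j 𝒵) Y := hr.syzN_le (by omega) hY
    exact Nat.find_min hex (m := j) (by change j < c; omega) (Cdom hr hc hY2 hY')
  exact claim_ij hr c 0 M (hXM c hdX) hc hM

end PartFour

end Chunk4

section Chunk5
open scoped Pointwise
set_option linter.unusedSectionVars false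
set_option linter.style.haveILetI false
section PartFive

open RingTheory.Sequence IsLocalRing

section General
variable {R : Type u} [CommRing R]
variable {A B C K P M N Y F U X : Type u} [AddCommGroup A] [Module R A] [AddCommGroup B] [Module R B]
  [AddCommGroup C] [Module R C] [AddCommGroup M] [Module R M] [AddCommGroup N] [Module R N]
   [AddCommGroup Y] [Module R Y] [AddCommGroup F] [Module R F] [AddCommGroup U] [Module R U]
   [AddCommGroup X] [Module R X] [AddCommGroup K] [Module R K] [AddCommGroup P] [Module R P]

lemma mem_smul_top {x : R} {m : M} : m ∈ x • (⊤ : Submodule R M) ↔ ∃ n, x • n = m := by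
  rw [Submodule.mem_smul_pointwise_iff_exists]; simp

/-- reduce a short exact sequence mod an element regular on the right. -/
lemma IsSES.quot {f : A →ₗ[R] B} {g : B →ₗ[R] C} (s : IsSES f g) {x : R} (hx : IsSMulRegular C x) :
    IsSES (QuotSMulTop.map x f) (QuotSMulTop.map x g) := by
  refine IsSES.mk' ?_ (QuotSMulTop.map_surjective x s.2.1) ?_ ?_
  · intro a ha
    obtain ⟨a, rfl⟩ := Submodule.mkQ_surjective _ a
    have ha : f a ∈ x • (⊤ : Submodule R B) := (Submodule.Quotient.mk_eq_zero _).1 ha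
    obtain ⟨b, hb⟩ := mem_smul_top.1 ha
    have h1 : x • g b = x • (0 : C) := by rw [← map_smul, hb, s.zero, smul_zero]
    obtain ⟨a', rfl⟩ := s.ex (hx h1)
    rw [← map_smul] at hb
    exact (Submodule.Quotient.mk_eq_zero _).2 (mem_smul_top.2 ⟨a', s.1 hb⟩)
  · intro a
    obtain ⟨a, rfl⟩ := Submodule.mkQ_surjective _ a
    show Submodule.mkQ _ (g (f a)) = 0
    rw [s.zero, map_zero]
  · intro b hb
    obtain ⟨b, rfl⟩ := Submodule.mkQ_surjective _ b
    have hb : g b ∈ x • (⊤ : Submodule R C) := (Submodule.Quotient.mk_eq_zero _).1 hb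
    obtain ⟨c, hc⟩ := mem_smul_top.1 hb
    obtain ⟨b', rfl⟩ := s.2.1 c
    obtain ⟨a, ha⟩ := s.ex (b := b - x • b') (by rw [map_sub, map_smul, hc, sub_self])
    refine ⟨Submodule.mkQ _ a, ?_⟩
    show Submodule.mkQ _ (f a) = _
    rw [ha, map_sub, sub_eq_self]
    exact (Submodule.Quotient.mk_eq_zero _).2 (mem_smul_top.2 ⟨b', rfl⟩)

lemma IsSES.reg_mid {f : A →ₗ[R] B} {g : B →ₗ[R] C} (s : IsSES f g) {x : R} (hA : IsSMulRegular A x)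
    (hC : IsSMulRegular C x) : IsSMulRegular B x := by
  rw [isSMulRegular_iff_right_eq_zero_of_smul]
  intro b hb
  have h1 : g b = 0 := by
    apply hC.right_eq_zero_of_smul
    rw [← map_smul, hb, map_zero]
  obtain ⟨a, rfl⟩ := s.ex h1
  rw [← map_smul] at hb
  have : x • a = 0 := s.1 (by rw [hb, map_zero])
  rw [hA.right_eq_zero_of_smul this, map_zero]

lemma wreg_mid (xs : List R) : ∀ {A B C : Type u} [AddCommGroup A] [Module R A] [AddCommGroup B] [Module R B]
    [AddCommGroup C] [Module R C] {f : A →ₗ[R] B} {g : B →ₗ[R] C}, IsSES f g →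
    IsWeaklyRegular A xs → IsWeaklyRegular C xs → IsWeaklyRegular B xs := by
  induction xs with
  | nil => intros; simp
  | cons x xs ih =>
    intro A B C _ _ _ _ _ _ f g s hA hC
    rw [isWeaklyRegular_cons_iff] at hA hC ⊢
    exact ⟨s.reg_mid hA.1 hC.1, ih (s.quot hC.1) hA.2 hC.2⟩

lemma wreg_left (xs : List R) (z : List R) (hz : z.length ≤ 1) :
    ∀ {A B C : Type u} [AddCommGroup A] [Module R A] [AddCommGroup B] [Module R B]
    [AddCommGroup C] [Module R C] {f : A →ₗ[R] B} {g : B →ₗ[R] C}, IsSES f g →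
    IsWeaklyRegular B (xs ++ z) → IsWeaklyRegular C xs → IsWeaklyRegular A (xs ++ z) := by
  induction xs with
  | nil =>
    intro A B C _ _ _ _ _ _ f g s hB hC
    simp only [List.nil_append] at *
    match z, hz with
    | [], _ => simp
    | [x], _ =>
      rw [isWeaklyRegular_singleton_iff] at *
      exact hB.of_injective f s.1
  | cons x xs ih =>
    intro A B C _ _ _ _ _ _ f g s hB hC
    simp only [List.cons_append] at *
    rw [isWeaklyRegular_cons_iff] at hB hC ⊢
    exact ⟨hB.1.of_injective f s.1, ih (s.quot hC.1) hB.2 hC.2⟩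

lemma wreg_retract (xs : List R) : ∀ {M N : Type u} [AddCommGroup M] [Module R M] [AddCommGroup N] [Module R N]
    (i : M →ₗ[R] N) (r : N →ₗ[R] M), (∀ m, r (i m) = m) → IsWeaklyRegular N xs → IsWeaklyRegular M xs := by
  induction xs with
  | nil => intros; simp
  | cons x xs ih =>
    intro M N _ _ _ _ i r h hN
    rw [isWeaklyRegular_cons_iff] at hN ⊢
    refine ⟨hN.1.of_injective i (Function.LeftInverse.injective h), ih (QuotSMulTop.map x i) (QuotSMulTop.map x r) ?_ hN.2⟩
    intro m
    obtain ⟨m, rfl⟩ := Submodule.mkQ_surjective _ m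
    show Submodule.mkQ _ (r (i m)) = _
    rw [h]

/-- xs-regular modules -/
def MCM (xs : List R) : Set (ModuleCat.{u} R) := {C | Module.Finite R C ∧ IsWeaklyRegular C xs}

lemma in_MCM {xs : List R} : In (MCM xs) M ↔ Module.Finite R M ∧ IsWeaklyRegular M xs := Iff.rfl

lemma wreg_flat {xs : List R} (h : IsWeaklyRegular R xs) [Module.Flat R M] : IsWeaklyRegular M xs := by
  have : IsWeaklyRegular (TensorProduct R M R) xs := h.isWeaklyRegular_lTensor
  exact (LinearEquiv.isWeaklyRegular_congr (TensorProduct.rid R M) xs).1 this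

lemma MCM_resolving [IsNoetherianRing R] {xs : List R} (h : IsWeaklyRegular R xs) :
    IsResolving R (MCM xs) where
  fg M hM := hM.1
  iso_closed M N e hM := by
    have := hM.1
    exact ⟨Module.Finite.equiv e.some, (LinearEquiv.isWeaklyRegular_congr e.some xs).1 hM.2⟩
  proj_mem M h1 h2 := ⟨h1, wreg_flat h⟩
  summand_closed M N hMN := by
    have h1 : Module.Finite R (M × N) := hMN.1
    exact ⟨Module.Finite.of_surjective (LinearMap.fst R M N) Prod.fst_surjective,
      wreg_retract xs (LinearMap.inl R M N) (LinearMap.fst R M N) (by simp) hMN.2⟩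
  ext_closed A B C f g σ hA hC := ⟨σ.finite_mid hA.1 hC.1, wreg_mid xs σ hA.2 hC.2⟩
  syzygy_closed K P M f g σ h1 h2 h3 hM := ⟨h1, by
    have := wreg_left xs [] (by simp) σ (by simpa using wreg_flat h) hM.2
    simpa using this⟩

lemma in_SyzN_MCM [IsNoetherianRing R] {xs : List R} (h : IsWeaklyRegular R xs) (k : ℕ) :
    ∀ (i : ℕ) (M : Type u) [AddCommGroup M] [Module R M] [Module.Finite R M], i + k = xs.length →
      IsWeaklyRegular M (xs.take i) → In (SyzN k (MCM xs)) M := by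
  induction k with
  | zero =>
    intro i M _ _ _ hi hM
    have : xs.take i = xs := List.take_of_length_le (by omega)
    rw [this] at hM
    exact ⟨‹_›, hM⟩
  | succ k ih =>
    intro i M _ _ _ hi hM
    obtain ⟨n, g, hg⟩ := exists_cover (R := R) M
    refine in_Syz1.2 ⟨n, g, hg, ih (i+1) _ (by omega) ?_⟩
    have hi' : i < xs.length := by omega
    rw [List.take_succ_eq_append_getElem hi']
    refine wreg_left _ [xs[i]] (by simp) (isSES_ker g hg) ?_ hM
    rw [← List.take_succ_eq_append_getElem hi']
    have : IsWeaklyRegular (Fin n → R) xs := wreg_flat h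
    rw [← List.take_append_drop (i+1) xs, isWeaklyRegular_append_iff] at this
    exact this.1

lemma in_SyzN_MCM' [IsNoetherianRing R] {xs : List R} (h : IsWeaklyRegular R xs) [Module.Finite R M] :
    In (SyzN xs.length (MCM xs)) M :=
  in_SyzN_MCM h xs.length 0 M (by simp) (by simp)

/-- `K ∩ IP = IK`. -/
lemma wreg_inter (xs : List R) :
    ∀ {A B C : Type u} [AddCommGroup A] [Module R A] [AddCommGroup B] [Module R B]
    [AddCommGroup C] [Module R C] {f : A →ₗ[R] B} {g : B →ₗ[R] C}, IsSES f g →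
    IsWeaklyRegular C xs → ∀ a, f a ∈ Ideal.ofList xs • (⊤ : Submodule R B) →
      a ∈ Ideal.ofList xs • (⊤ : Submodule R A) := by
  induction xs with
  | nil =>
    intro A B C _ _ _ _ _ _ f g s _ a ha
    simp at ha ⊢
    exact s.1 (by simp [ha])
  | cons x xs ih =>
    intro A B C _ _ _ _ _ _ f g s hC a ha
    rw [isWeaklyRegular_cons_iff] at hC
    rw [Ideal.ofList_cons, Submodule.sup_smul, Submodule.ideal_span_singleton_smul] at ha ⊢
    have key : ∀ {M : Type u} [AddCommGroup M] [Module R M] (m : M),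
      m ∈ x • (⊤ : Submodule R M) ⊔ Ideal.ofList xs • (⊤ : Submodule R M) ↔
        (x • (⊤ : Submodule R M)).mkQ m ∈ Ideal.ofList xs • (⊤ : Submodule R (QuotSMulTop x M)) := by
      intro M _ _ m
      have : Ideal.ofList xs • (⊤ : Submodule R (QuotSMulTop x M)) =
        (Ideal.ofList xs • (⊤ : Submodule R M)).map (x • (⊤ : Submodule R M)).mkQ := by
        rw [Submodule.map_smul'', Submodule.map_top, Submodule.range_mkQ]
      rw [this, ← Submodule.mem_comap, Submodule.comap_map_mkQ]
    rw [key] at ha ⊢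
    exact ih (s.quot hC.1) hC.2 _ ha

end General

/-- A local principal artinian ring is self-injective. -/
lemma baer_of_principal {A : Type u} [CommRing A] [IsLocalRing A] {t : A} {n : ℕ}
    (hm : maximalIdeal A = Ideal.span {t}) (hn : t ^ n = 0) : Module.Baer A A := by
  classical
  have hex : ∃ n, t ^ n = 0 := ⟨n, hn⟩
  set N := Nat.find hex with hN
  have hN0 : t ^ N = 0 := Nat.find_spec hex
  have hmin : ∀ i, t ^ i = 0 → N ≤ i := fun i hi => Nat.find_min' hex hi
  have form : ∀ a : A, ∃ i ≤ N, ∃ u : Aˣ, a = u * t ^ i := by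
    intro a
    have : ∀ k ≤ N, (∃ i ≤ N, ∃ u : Aˣ, a = u * t ^ i) ∨ ∃ b, a = b * t ^ k := by
      intro k
      induction k with
      | zero => exact fun _ => Or.inr ⟨a, by simp⟩
      | succ k ih =>
        intro hk
        rcases ih (by omega) with h | ⟨b, rfl⟩
        · exact Or.inl h
        by_cases hb : IsUnit b
        · exact Or.inl ⟨k, by omega, hb.unit, rfl⟩
        · have : b ∈ maximalIdeal A := hb
          rw [hm, Ideal.mem_span_singleton'] at this
          obtain ⟨c, rfl⟩ := this
          exact Or.inr ⟨c, by ring⟩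
    rcases this N le_rfl with h | ⟨b, rfl⟩
    · exact h
    · exact ⟨N, le_rfl, 1, by simp [hN0]⟩
  intro J g
  have hexJ : ∃ i, t ^ i ∈ J := ⟨N, by rw [hN0]; exact zero_mem _⟩
  set j := Nat.find hexJ with hj
  have hjJ : t ^ j ∈ J := Nat.find_spec hexJ
  have hjN : j ≤ N := Nat.find_min' hexJ (by rw [hN0]; exact zero_mem _)
  obtain ⟨i, hi, u, hu⟩ := form (g ⟨t ^ j, hjJ⟩)
  have h1 : t ^ (N - j) * g ⟨t ^ j, hjJ⟩ = 0 := by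
    rw [← smul_eq_mul, ← map_smul]
    have : t ^ (N - j) • (⟨t ^ j, hjJ⟩ : J) = 0 := by
      apply Subtype.ext
      show t ^ (N - j) * t ^ j = 0
      rw [← pow_add, Nat.sub_add_cancel hjN, hN0]
    rw [this, map_zero]
  have h2 : t ^ (N - j + i) = 0 := by
    rw [hu] at h1
    have : (u : A) * t ^ (N - j + i) = 0 := by rw [← h1, pow_add]; ring
    exact (Units.mul_right_eq_zero u).1 this
  have h3 : j ≤ i := by have := hmin _ h2; omega
  refine ⟨LinearMap.toSpanSingleton A A (u * t ^ (i - j)), fun x hx => ?_⟩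
  obtain ⟨l, hl, v, rfl⟩ := form x
  have hl' : t ^ l ∈ J := (Submodule.smul_mem_iff_of_isUnit J v.isUnit).1 hx
  have hjl : j ≤ l := Nat.find_min' hexJ hl'
  have : (⟨v * t ^ l, hx⟩ : J) = (v * t ^ (l - j)) • ⟨t ^ j, hjJ⟩ := by
    apply Subtype.ext
    show (v : A) * t ^ l = v * t ^ (l - j) * t ^ j
    rw [mul_assoc, ← pow_add, Nat.sub_add_cancel hjl]
  rw [this, map_smul, hu]
  show (v : A) * t ^ l * (u * t ^ (i - j)) = v * t ^ (l - j) * (u * t ^ i)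
  obtain ⟨l', rfl⟩ := Nat.exists_eq_add_of_le hjl
  obtain ⟨i', rfl⟩ := Nat.exists_eq_add_of_le h3
  simp only [Nat.add_sub_cancel_left]
  ring

variable {S : Type u} [CommRing S] [IsLocalRing S]
variable {U V : Type u} [AddCommGroup U] [Module S U] [AddCommGroup V] [Module S V]

lemma inj_quot {J : Ideal S} {t : S} {n : ℕ} (hJ : J ≠ ⊤) (hm : maximalIdeal S = J ⊔ Ideal.span {t})
    (hn : t ^ n ∈ J) (ι : U →ₗ[S] V) (hι : Function.Injective ι) (hV : ∀ a ∈ J, ∀ v : V, a • v = 0)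
    (φ : U →ₗ[S] S ⧸ J) : ∃ ψ : V →ₗ[S] S ⧸ J, ∀ x, ψ (ι x) = φ x := by
  have : Nontrivial (S ⧸ J) := Ideal.Quotient.nontrivial_iff.2 hJ
  have : IsLocalRing (S ⧸ J) := IsLocalRing.of_surjective' (Ideal.Quotient.mk J) Ideal.Quotient.mk_surjective
  have hb : Module.Baer (S ⧸ J) (S ⧸ J) := by
    refine baer_of_principal (t := Ideal.Quotient.mk J t) (n := n) ?_ ?_
    · have h1 : maximalIdeal (S ⧸ J) = (maximalIdeal S).map (Ideal.Quotient.mk J) := by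
        have h2 : (maximalIdeal S).map (Ideal.Quotient.mk J) = ⊤ ∨ ((maximalIdeal S).map (Ideal.Quotient.mk J)).IsMaximal :=
          (Ideal.map_eq_top_or_isMaximal_of_surjective _ Ideal.Quotient.mk_surjective (maximalIdeal.isMaximal S))
        rcases h2 with h2 | h2
        · exfalso
          have : (1 : S ⧸ J) ∈ (maximalIdeal S).map (Ideal.Quotient.mk J) := h2 ▸ trivial
          rw [← map_one (Ideal.Quotient.mk J), Ideal.mem_quotient_iff_mem_sup] at this
          rw [sup_eq_left.2 (hm ▸ le_sup_left)] at this
          exact (Ideal.ne_top_iff_one _).1 (maximalIdeal.isMaximal S).ne_top this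
        · exact (IsLocalRing.eq_maximalIdeal h2).symm
      rw [h1, hm, Ideal.map_sup, Ideal.map_quotient_self, bot_sup_eq, Ideal.map_span, Set.image_singleton]
    · rw [← map_pow]; exact Ideal.Quotient.eq_zero_iff_mem.2 hn
  have hVt : Module.IsTorsionBySet S V J := fun v a => hV a a.2 v
  have hUt : Module.IsTorsionBySet S U J := fun v a => hι (by
    rw [map_smul, map_zero]; exact hV a a.2 _)
  letI := hVt.module
  letI := hUt.module
  have : IsScalarTower S (S ⧸ J) V := hVt.isScalarTower
  have : IsScalarTower S (S ⧸ J) U := hUt.isScalarTower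
  have hs : Function.Surjective (algebraMap S (S ⧸ J)) := Ideal.Quotient.mk_surjective
  obtain ⟨h, hh⟩ := hb.injective.out (ι.extendScalarsOfSurjective hs) hι (φ.extendScalarsOfSurjective hs)
  exact ⟨h.restrictScalars S, hh⟩

end PartFive

end Chunk5

section Chunk6
open scoped Pointwise
set_option linter.unusedSectionVars false
set_option linter.style.haveILetI false
section PartSix

open RingTheory.Sequence IsLocalRing

/-- finitely generated projective modules -/
def PJ (R : Type u) [CommRing R] : Set (ModuleCat.{u} R) := {M | Module.Finite R M ∧ Module.Projective R M}

section General
variable {R : Type u} [CommRing R]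
variable {A B C K P M N Y F U X Z Z' : Type u} [AddCommGroup A] [Module R A] [AddCommGroup B] [Module R B]
  [AddCommGroup C] [Module R C] [AddCommGroup M] [Module R M] [AddCommGroup N] [Module R N]
   [AddCommGroup Y] [Module R Y] [AddCommGroup F] [Module R F] [AddCommGroup U] [Module R U]
   [AddCommGroup X] [Module R X] [AddCommGroup K] [Module R K] [AddCommGroup P] [Module R P]
   [AddCommGroup Z] [Module R Z] [AddCommGroup Z'] [Module R Z']
variable {𝒳 𝒴 : Set (ModuleCat.{u} R)}

lemma in_PJ : In (PJ R) M ↔ Module.Finite R M ∧ Module.Projective R M := Iff.rfl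

lemma PJ_resolving [IsNoetherianRing R] : IsResolving R (PJ R) where
  fg M hM := hM.1
  iso_closed M N e hM := by
    have h1 := hM.1
    have h2 := hM.2
    exact ⟨Module.Finite.equiv e.some, Module.Projective.of_equiv e.some⟩
  proj_mem M h1 h2 := ⟨h1, h2⟩
  summand_closed M N hMN := by
    have h1 : Module.Finite R (M × N) := hMN.1
    have h2 : Module.Projective R (M × N) := hMN.2
    exact ⟨Module.Finite.of_surjective (LinearMap.fst R M N) Prod.fst_surjective,
      Module.Projective.of_split (LinearMap.inl R M N) (LinearMap.fst R M N) (by ext; simp)⟩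
  ext_closed A B C f g s hA hC := by
    have h1 : Module.Projective R A := hA.2
    have h2 : Module.Projective R C := hC.2
    refine ⟨s.finite_mid hA.1 hC.1, ?_⟩
    obtain ⟨σ, hσ⟩ := proj_lift s.2.1 (LinearMap.id : C →ₗ[R] C)
    have hz : ∀ b, g (b - σ (g b)) = 0 := fun b => by rw [map_sub, hσ]; simp
    obtain ⟨ρ, hρ⟩ := s.lift (LinearMap.id - σ ∘ₗ g) (by simpa using hz)
    refine Module.Projective.of_split (P := B) (M := A × C) (ρ.prod g) (f.coprod σ) ?_
    ext b
    simp [hρ]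
  syzygy_closed K P M f g s h1 h2 h3 hM := by
    have h4 : Module.Projective R M := hM.2
    refine ⟨h1, ?_⟩
    obtain ⟨σ, hσ⟩ := proj_lift s.2.1 (LinearMap.id : M →ₗ[R] M)
    have hz : ∀ b, g (b - σ (g b)) = 0 := fun b => by rw [map_sub, hσ]; simp
    obtain ⟨ρ, hρ⟩ := s.lift (LinearMap.id - σ ∘ₗ g) (by simpa using hz)
    refine Module.Projective.of_split (P := K) (M := P) f ρ ?_
    ext k
    apply s.1
    simp [hρ, s.zero]

lemma PJ_subset (hr : IsResolving R 𝒳) : PJ R ⊆ 𝒳 := fun M hM => hr.proj_mem M hM.1 hM.2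

/-- The extension property: `Ext¹(C, L) = 0` for all xs-regular `C`. -/
def EP (xs : List R) (L : Type u) [AddCommGroup L] [Module R L] : Prop :=
  ∀ (K P C : Type u) [AddCommGroup K] [Module R K] [AddCommGroup P] [Module R P]
    [AddCommGroup C] [Module R C] (f : K →ₗ[R] P) (g : P →ₗ[R] C), IsSES f g →
    Module.Finite R P → Module.Projective R P → IsWeaklyRegular C xs →
    ∀ φ : K →ₗ[R] L, ∃ ψ : P →ₗ[R] L, ∀ k, ψ (f k) = φ k

lemma EP.retract {xs : List R} (h : EP xs M) (i : N →ₗ[R] M) (r : M →ₗ[R] N) (hri : ∀ n, r (i n) = n) : EP xs N := by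
  intro K P C _ _ _ _ _ _ f g s h1 h2 h3 φ
  obtain ⟨ψ, hψ⟩ := h K P C f g s h1 h2 h3 (i ∘ₗ φ)
  exact ⟨r ∘ₗ ψ, fun k => by simp [hψ, hri]⟩

lemma EP.equiv {xs : List R} (h : EP xs M) (e : M ≃ₗ[R] N) : EP xs N :=
  h.retract e.symm.toLinearMap e.toLinearMap (by simp)

lemma EP.pi {xs : List R} (h : EP xs R) (n : ℕ) : EP xs (Fin n → R) := by
  intro K P C _ _ _ _ _ _ f g s h1 h2 h3 φ
  have := fun i : Fin n => h K P C f g s h1 h2 h3 (LinearMap.proj i ∘ₗ φ)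
  choose ψ hψ using this
  exact ⟨LinearMap.pi ψ, fun k => by ext i; simp [hψ]⟩

lemma EP.of_proj {xs : List R} (h : EP xs R) [Module.Finite R N] [Module.Projective R N] : EP xs N := by
  obtain ⟨n, g, hg⟩ := exists_cover (R := R) N
  obtain ⟨σ, hσ⟩ := proj_lift hg (LinearMap.id : N →ₗ[R] N)
  exact (h.pi n).retract σ g hσ

section noeth
variable [IsNoetherianRing R]

/-- lifting along a surjection with kernel having EP -/
lemma EP.lift {xs : List R} (h : EP xs Y) {f : Y →ₗ[R] F} {g : F →ₗ[R] M}
    (s : IsSES f g) [Module.Finite R C] (hC : IsWeaklyRegular C xs) (φ : C →ₗ[R] M) :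
    ∃ ψ : C →ₗ[R] F, ∀ c, g (ψ c) = φ c := by
  obtain ⟨n, c, hc⟩ := exists_cover (R := R) C
  obtain ⟨l, hl⟩ := proj_lift s.2.1 (φ ∘ₗ c)
  have sc := isSES_ker c hc
  obtain ⟨α, hα⟩ := s.lift (l ∘ₗ (LinearMap.ker c).subtype) (fun x => by
    have : c x = 0 := x.2
    simp [hl, this])
  obtain ⟨β, hβ⟩ := h _ _ _ _ _ sc inferInstance inferInstance hC α
  obtain ⟨ψ, hψ⟩ := sc.desc (l - f ∘ₗ β) (fun a => by
    have := hα a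
    simp at this ⊢
    rw [← this, ← hβ]; simp)
  refine ⟨ψ, fun x => ?_⟩
  obtain ⟨y, rfl⟩ := hc x
  rw [hψ]
  simp [hl, s.zero]

lemma EP.coker {xs : List R} (hxs : IsWeaklyRegular R xs) (h : EP xs Y) (hF : EP xs F) {f : Y →ₗ[R] F} {g : F →ₗ[R] M}
    (s : IsSES f g) : EP xs M := by
  intro K P C _ _ _ _ _ _ i p s' h1 h2 h3 φ
  have : In (MCM xs) K := (MCM_resolving hxs).syz s' (show In (MCM xs) C from ⟨s'.finite_right h1, h3⟩)
  have hK := this.1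
  obtain ⟨ψ, hψ⟩ := h.lift s this.2 φ
  obtain ⟨χ, hχ⟩ := hF K P C i p s' h1 h2 h3 ψ
  exact ⟨g ∘ₗ χ, fun k => by simp [hχ, hψ]⟩

/-- extension along any mono with xs-regular cokernel -/
lemma EP.extend {xs : List R} (h : EP xs Y) {f : A →ₗ[R] B} {g : B →ₗ[R] C}
    (s : IsSES f g) [Module.Finite R C] (hC : IsWeaklyRegular C xs) (φ : A →ₗ[R] Y) :
    ∃ ψ : B →ₗ[R] Y, ∀ a, ψ (f a) = φ a := by
  obtain ⟨n, c, hc⟩ := exists_cover (R := R) C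
  obtain ⟨l, hl⟩ := proj_lift s.2.1 c
  have sc := isSES_ker c hc
  obtain ⟨α, hα⟩ := s.lift (l ∘ₗ (LinearMap.ker c).subtype) (fun x => by
    have : c x = 0 := x.2
    simp [hl, this])
  obtain ⟨β, hβ⟩ := h _ _ _ _ _ sc inferInstance inferInstance hC (φ ∘ₗ α)
  have hsurj : Function.Surjective (f.coprod l) := by
    intro b
    obtain ⟨y, hy⟩ := hc (g b)
    obtain ⟨a, ha⟩ := s.ex (b := b - l y) (by rw [map_sub, hl, hy, sub_self])
    exact ⟨(a, y), by simp [ha]⟩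
  obtain ⟨ψ, hψ⟩ := (isSES_ker _ hsurj).desc (φ.coprod β) (by
    rintro ⟨⟨a, y⟩, hay⟩
    have hay' : f a + l y = 0 := by simpa using hay
    have hy : c y = 0 := by
      have := congrArg g hay'
      simpa [s.zero, hl] using this
    have h1 := hα ⟨y, hy⟩
    have h2 := hβ ⟨y, hy⟩
    simp at h1 h2 ⊢
    rw [h2, ← map_add]
    have : a + α ⟨y, hy⟩ = 0 := s.1 (by rw [map_add, h1, hay', map_zero])
    rw [this, map_zero])
  exact ⟨ψ, fun a => by have := hψ (a, 0); simpa using this⟩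

lemma EP.of_finpd {xs : List R} (hxs : IsWeaklyRegular R xs) (h : EP xs R) (n : ℕ) :
    ∀ (Y : Type u) [AddCommGroup Y] [Module R Y], In (SyzN n (PJ R)) Y → EP xs Y := by
  induction n with
  | zero =>
    intro Y _ _ hY
    have h1 : Module.Finite R Y := hY.1
    have h2 : Module.Projective R Y := hY.2
    exact h.of_proj
  | succ n ih =>
    intro Y _ _ hY
    obtain ⟨k, g, hg, hk⟩ := in_Syz1.1 hY
    exact EP.coker hxs (ih _ hk) (h.pi k) (isSES_ker g hg)

lemma SyzN_inter (hr : IsResolving R 𝒴) (n : ℕ) : ∀ (X : Type u) [AddCommGroup X] [Module R X],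
    In (SyzN n 𝒳) X → In 𝒴 X → In (SyzN n (𝒳 ∩ 𝒴)) X := by
  induction n with
  | zero => intro X _ _ h1 h2; exact ⟨h1, h2⟩
  | succ n ih =>
    intro X _ _ h1 h2
    obtain ⟨k, g, hg, hk⟩ := in_Syz1.1 h1
    exact in_Syz1.2 ⟨k, g, hg, ih _ hk (hr.syz (isSES_ker g hg) h2)⟩

lemma quot_list_in (ys : List R) : ∀ (𝒳 : Set (ModuleCat.{u} R)) (_ : IsResolving R 𝒳) (K : Type u) [AddCommGroup K] [Module R K],
    In 𝒳 K → IsWeaklyRegular K ys → In (SyzN ys.length 𝒳) (K ⧸ (Ideal.ofList ys • ⊤ : Submodule R K)) := by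
  induction ys with
  | nil =>
    intro 𝒳 hr K _ _ hK _
    refine hr.equiv (Submodule.quotEquivOfEqBot _ (by simp)).symm hK
  | cons y ys ih =>
    intro 𝒳 hr K _ _ hK hreg
    rw [isWeaklyRegular_cons_iff] at hreg
    have := ih _ hr.syz1 _ (quot_in_syz1 hr hreg.1 hK) hreg.2
    rw [List.length_cons, SyzN_succ']
    exact (hr.syz1.syzN _).equiv (Submodule.quotOfListConsSMulTopEquivQuotSMulTopInner K y ys).symm this
end noeth
end General

variable {S : Type u} [CommRing S] [IsLocalRing S] [IsNoetherianRing S]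
variable {A B C K P M N Y F U X Z Z' L : Type u} [AddCommGroup A] [Module S A] [AddCommGroup B] [Module S B]
  [AddCommGroup C] [Module S C] [AddCommGroup M] [Module S M] [AddCommGroup N] [Module S N]
   [AddCommGroup Y] [Module S Y] [AddCommGroup F] [Module S F] [AddCommGroup U] [Module S U]
   [AddCommGroup X] [Module S X] [AddCommGroup K] [Module S K] [AddCommGroup P] [Module S P]
   [AddCommGroup Z] [Module S Z] [AddCommGroup Z'] [Module S Z'] [AddCommGroup L] [Module S L]

lemma EP_descend {xs : List S} {x : S} (hx : x ∈ maximalIdeal S) [Module.Finite S L] (hreg : IsSMulRegular L x)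
    (h : EP xs (QuotSMulTop x L)) : EP xs L := by
  intro K P C _ _ _ _ _ _ f g s h1 h2 h3 φ
  have : Module.Finite S K := s.finite_left h1
  have hfin : Module.Finite S (K →ₗ[S] L) := by
    obtain ⟨n, c, hc⟩ := exists_cover (R := S) K
    exact Module.Finite.of_injective (LinearMap.lcomp S L c) (fun a b hab => by
      ext k; obtain ⟨y, rfl⟩ := hc k; exact LinearMap.congr_fun hab y)
  have key : (⊤ : Submodule S (K →ₗ[S] L)) ≤ LinearMap.range (LinearMap.lcomp S L f) := by
    refine Submodule.le_of_le_smul_of_le_jacobson_bot (I := maximalIdeal S) hfin.fg_top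
      (by rw [IsLocalRing.jacobson_eq_maximalIdeal _ bot_ne_top]) ?_
    intro φ _
    obtain ⟨ψ', hψ'⟩ := h K P C f g s h1 h2 h3 ((x • (⊤ : Submodule S L)).mkQ ∘ₗ φ)
    obtain ⟨ψ, hψ⟩ := proj_lift (Submodule.mkQ_surjective (x • (⊤ : Submodule S L))) ψ'
    obtain ⟨χ, hχ⟩ := (smul_ses hreg).lift (φ - ψ ∘ₗ f) (fun k => by
      have h4 := hψ' k
      rw [← hψ] at h4
      simp only [LinearMap.sub_apply, map_sub, LinearMap.comp_apply] at h4 ⊢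
      rw [h4, sub_self])
    have : φ = LinearMap.lcomp S L f ψ + x • χ := by
      ext k
      have := hχ k
      simp at this ⊢
      rw [this]; abel
    rw [this]
    exact Submodule.add_mem_sup ⟨ψ, rfl⟩ (Submodule.smul_mem_smul hx trivial)
  obtain ⟨ψ, hψ⟩ := key (show φ ∈ ⊤ from trivial)
  exact ⟨ψ, fun k => LinearMap.congr_fun hψ k⟩

lemma EP_descend_list {xs : List S} (ys : List S) : ∀ (L : Type u) [AddCommGroup L] [Module S L] [Module.Finite S L],
    (∀ y ∈ ys, y ∈ maximalIdeal S) → IsWeaklyRegular L ys →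
    EP xs (L ⧸ (Ideal.ofList ys • ⊤ : Submodule S L)) → EP xs L := by
  induction ys with
  | nil =>
    intro L _ _ _ _ _ h
    exact h.equiv (Submodule.quotEquivOfEqBot _ (by simp))
  | cons y ys ih =>
    intro L _ _ _ hm hreg h
    rw [isWeaklyRegular_cons_iff] at hreg
    refine EP_descend (hm y (by simp)) hreg.1 (ih _ (fun z hz => hm z (by simp [hz])) hreg.2 ?_)
    exact h.equiv (Submodule.quotOfListConsSMulTopEquivQuotSMulTopInner L y ys)

/-- H-data -/
structure HData (S : Type u) [CommRing S] [IsLocalRing S] (xs : List S) (t : S) (n : ℕ) : Prop where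
  reg : IsWeaklyRegular S xs
  mem : ∀ x ∈ xs, x ∈ maximalIdeal S
  gen : maximalIdeal S = Ideal.ofList xs ⊔ Ideal.span {t}
  pow : t ^ n ∈ Ideal.ofList xs
  min : ∀ i, t ^ i ∈ Ideal.ofList xs → n ≤ i

variable {xs : List S} {t : S} {n : ℕ}

lemma HData.le (H : HData S xs t n) : Ideal.ofList xs ≤ maximalIdeal S := by
  rw [H.gen]; exact le_sup_left

lemma HData.ne_top (H : HData S xs t n) : Ideal.ofList xs ≠ ⊤ :=
  fun h => (maximalIdeal.isMaximal S).ne_top (top_le_iff.1 (h ▸ H.le))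

lemma HData.ep (H : HData S xs t n) : EP xs S := by
  refine EP_descend_list xs S H.mem H.reg ?_
  have e : (S ⧸ (Ideal.ofList xs • ⊤ : Submodule S S)) ≃ₗ[S] S ⧸ Ideal.ofList xs :=
    Submodule.quotEquivOfEq _ _ (by simp)
  refine EP.equiv ?_ e.symm
  intro K P C _ _ _ _ _ _ f g s h1 h2 h3 φ
  have hle : (Ideal.ofList xs • ⊤ : Submodule S K) ≤ (Ideal.ofList xs • ⊤ : Submodule S P).comap f := by
    rw [← Submodule.map_le_iff_le_comap, Submodule.map_smul'']
    exact Submodule.smul_mono le_rfl le_top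
  have hφ : (Ideal.ofList xs • ⊤ : Submodule S K) ≤ LinearMap.ker φ := by
    rw [Submodule.smul_le]
    intro a ha k _
    rw [LinearMap.mem_ker, map_smul]
    obtain ⟨y, hy⟩ := Ideal.Quotient.mk_surjective (φ k)
    rw [← hy]
    exact Ideal.Quotient.eq_zero_iff_mem.2 ((Ideal.ofList xs).mul_mem_right _ ha)
  obtain ⟨ψ, hψ⟩ := inj_quot H.ne_top H.gen H.pow (Submodule.mapQ _ _ f hle) (by
    rw [← LinearMap.ker_eq_bot, LinearMap.ker_eq_bot']
    intro u hu
    obtain ⟨u, rfl⟩ := Submodule.mkQ_surjective _ u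
    refine (Submodule.Quotient.mk_eq_zero _).2 ?_
    exact wreg_inter xs s h3 u ((Submodule.Quotient.mk_eq_zero _).1 hu)) (by
    intro a ha v
    obtain ⟨v, rfl⟩ := Submodule.mkQ_surjective _ v
    rw [← map_smul]
    exact (Submodule.Quotient.mk_eq_zero _).2 (Submodule.smul_mem_smul ha trivial)) (Submodule.liftQ _ φ hφ)
  exact ⟨ψ ∘ₗ Submodule.mkQ _, fun k => by simpa using hψ (Submodule.mkQ _ k)⟩

end PartSix

end Chunk6

section Chunk7
open scoped Pointwise
set_option linter.unusedSectionVars false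
set_option linter.style.haveILetI false
section PartSeven

open RingTheory.Sequence IsLocalRing

variable {S : Type u} [CommRing S] [IsLocalRing S] [IsNoetherianRing S]
variable {A B C K P M N Y F U X Z Z' L : Type u} [AddCommGroup A] [Module S A] [AddCommGroup B] [Module S B]
  [AddCommGroup C] [Module S C] [AddCommGroup M] [Module S M] [AddCommGroup N] [Module S N]
   [AddCommGroup Y] [Module S Y] [AddCommGroup F] [Module S F] [AddCommGroup U] [Module S U]
   [AddCommGroup X] [Module S X] [AddCommGroup K] [Module S K] [AddCommGroup P] [Module S P]
   [AddCommGroup Z] [Module S Z] [AddCommGroup Z'] [Module S Z'] [AddCommGroup L] [Module S L]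
variable {𝒳 𝒴 : Set (ModuleCat.{u} S)}

lemma min_cover (N : Type u) [AddCommGroup N] [Module S N] [Module.Finite S N] :
    ∃ (n : ℕ) (g : (Fin n → S) →ₗ[S] N), Function.Surjective g ∧ ∀ v, g v = 0 → ∀ i, v i ∈ maximalIdeal S := by
  classical
  have hex := exists_cover (R := S) N
  obtain ⟨g, hg⟩ := Nat.find_spec hex
  refine ⟨Nat.find hex, g, hg, fun v hv i => ?_⟩
  by_contra hu
  have hu : IsUnit (v i) := by simpa using hu
  obtain ⟨u, hu⟩ := hu
  have hmin := fun m (hm : m < Nat.find hex) => Nat.find_min hex hm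
  generalize Nat.find hex = n at *
  obtain ⟨n, rfl⟩ : ∃ m, n = m + 1 := ⟨n - 1, by have := i.pos; omega⟩
  refine hmin n (by omega) ?_
  let e : (Fin n → S) →ₗ[S] (Fin (n+1) → S) :=
    { toFun := fun w => i.insertNth (α := fun _ => S) 0 w
      map_add' := fun a b => by
        ext j
        refine Fin.succAboveCases i ?_ ?_ j
        · simp
        · intro k; simp
      map_smul' := fun r a => by
        ext j
        refine Fin.succAboveCases i ?_ ?_ j
        · simp
        · intro k; simp }
  have he : ∀ w j, e w j = i.insertNth (α := fun _ => S) 0 w j := fun _ _ => rfl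
  refine ⟨g ∘ₗ e, fun y => ?_⟩
  obtain ⟨w, rfl⟩ := hg y
  refine ⟨fun k => (w - (w i * (u⁻¹ : Sˣ)) • v) (i.succAbove k), ?_⟩
  have : e (fun k => (w - (w i * (u⁻¹ : Sˣ)) • v) (i.succAbove k)) = w - (w i * (u⁻¹ : Sˣ)) • v := by
    ext j
    refine Fin.succAboveCases i ?_ ?_ j
    · rw [he]
      simp [← hu, mul_assoc]
    · intro k
      rw [he]
      simp
  rw [LinearMap.comp_apply, this, map_sub, map_smul, hv, smul_zero, sub_zero]

variable {xs : List S} {t : S} {n : ℕ}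

/-- The uniserial quotients -/
abbrev Ja (xs : List S) (t : S) (a : ℕ) : Ideal S := Ideal.ofList xs ⊔ Ideal.span {t ^ a}

lemma mem_Ja {a : ℕ} {s : S} : s ∈ Ja xs t a ↔ ∃ j ∈ Ideal.ofList xs, ∃ z, s = j + z * t ^ a := by
  rw [Submodule.mem_sup]
  constructor
  · rintro ⟨j, hj, w, hw, rfl⟩
    obtain ⟨z, rfl⟩ := Ideal.mem_span_singleton'.1 hw
    exact ⟨j, hj, z, rfl⟩
  · rintro ⟨j, hj, z, rfl⟩
    exact ⟨j, hj, _, Ideal.mem_span_singleton'.2 ⟨z, rfl⟩, rfl⟩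

lemma HData.mem_max (H : HData S xs t n) {s : S} (hs : s ∈ maximalIdeal S) :
    ∃ j ∈ Ideal.ofList xs, ∃ z, s = j + z * t := by
  rw [H.gen, ← pow_one t] at hs
  simpa using mem_Ja.1 hs

lemma HData.unif (H : HData S xs t n) (a : ℕ) (s : S) (hs : s ∉ Ja xs t a) :
    ∃ l < a, ∃ u : Sˣ, ∃ j ∈ Ideal.ofList xs, s = j + u * t ^ l := by
  induction a with
  | zero => exact absurd (mem_Ja.2 ⟨0, zero_mem _, s, by simp⟩) hs
  | succ a ih =>
    by_cases h : s ∈ Ja xs t a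
    · obtain ⟨j, hj, z, rfl⟩ := mem_Ja.1 h
      by_cases hz : IsUnit z
      · exact ⟨a, by omega, hz.unit, j, hj, rfl⟩
      · obtain ⟨j', hj', z', rfl⟩ := H.mem_max (s := z) hz
        exact absurd (mem_Ja.2 ⟨j + j' * t ^ a, add_mem hj (Ideal.mul_mem_right _ _ hj'), z', by ring⟩) hs
    · obtain ⟨l, hl, h⟩ := ih h
      exact ⟨l, by omega, h⟩

lemma Ja_mono {a b : ℕ} (h : a ≤ b) : Ja xs t b ≤ Ja xs t a :=
  sup_le_sup_left (Ideal.span_singleton_le_span_singleton.2 (pow_dvd_pow t h)) _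

lemma HData.n_pos (H : HData S xs t n) : 0 < n := by
  rcases Nat.eq_zero_or_pos n with rfl | h
  · have := H.pow
    rw [pow_zero] at this
    exact absurd ((Ideal.eq_top_iff_one _).2 this) H.ne_top
  · exact h

lemma descend_step (H : HData S xs t n) (hr : IsResolving S 𝒳) {a : ℕ} (ha : a + 1 < n)
    (h : In 𝒳 (S ⧸ Ja xs t (a+1))) : In 𝒳 (S ⧸ Ja xs t a) := by
  have ht : t ∈ maximalIdeal S := by
    rw [H.gen]; exact Submodule.mem_sup_right (Ideal.mem_span_singleton_self t)
  -- maps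
  let p1 : (S ⧸ Ja xs t (a+1)) →ₗ[S] (S ⧸ Ja xs t a) := Submodule.factor (Ja_mono (by omega))
  let p2 : (S ⧸ Ja xs t (a+2)) →ₗ[S] (S ⧸ Ja xs t (a+1)) := Submodule.factor (Ja_mono (by omega))
  have hmul : ∀ b : ℕ, Ja xs t b ≤ Submodule.comap (t • (LinearMap.id : S →ₗ[S] S)) (Ja xs t (b+1)) := by
    intro b s hs
    obtain ⟨j, hj, z, rfl⟩ := mem_Ja.1 hs
    refine mem_Ja.2 ⟨t * j, Ideal.mul_mem_left _ _ hj, z, ?_⟩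
    show t * (j + z * t ^ b) = _
    ring
  let m1 : (S ⧸ Ja xs t (a+1)) →ₗ[S] (S ⧸ Ja xs t (a+2)) := Submodule.mapQ _ _ (t • LinearMap.id) (hmul (a+1))
  let m2 : (S ⧸ Ja xs t a) →ₗ[S] (S ⧸ Ja xs t (a+1)) := Submodule.mapQ _ _ (t • LinearMap.id) (hmul a)
  have s : IsSES (p1.prod m1) (m2.coprod (-p2)) := by
    refine IsSES.mk' ?_ ?_ ?_ ?_
    · intro s hs
      obtain ⟨s, rfl⟩ := Submodule.mkQ_surjective _ s
      have h1 : p1 (Submodule.mkQ _ s) = 0 := congrArg Prod.fst hs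
      have h2 : m1 (Submodule.mkQ _ s) = 0 := congrArg Prod.snd hs
      have h1 : s ∈ Ja xs t a := (Submodule.Quotient.mk_eq_zero _).1 h1
      have h2 : t * s ∈ Ja xs t (a+2) := (Submodule.Quotient.mk_eq_zero _).1 h2
      refine (Submodule.Quotient.mk_eq_zero _).2 ?_
      by_contra hs'
      obtain ⟨l, hl, u, j, hj, rfl⟩ := H.unif _ _ hs'
      obtain ⟨j', hj', z, hz⟩ := mem_Ja.1 h2
      have h3 : t ^ (l+1) * (u - z * t ^ (a + 1 - l)) ∈ Ideal.ofList xs := by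
        have : t ^ (l+1) * (u - z * t ^ (a + 1 - l)) = j' - t * j := by
          have e : t ^ (a + 2) = t ^ (l + 1) * t ^ (a + 1 - l) := by rw [← pow_add]; congr 1; omega
          rw [e] at hz
          linear_combination hz
        rw [this]
        exact sub_mem hj' (Ideal.mul_mem_left _ _ hj)
      have hunit : IsUnit (u - z * t ^ (a + 1 - l) : S) := by
        by_contra hnu
        have h4 : z * t ^ (a + 1 - l) ∈ maximalIdeal S := by
          obtain ⟨q, hq⟩ : ∃ q, a + 1 - l = q + 1 := ⟨a - l, by omega⟩
          rw [hq, pow_succ]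
          exact Ideal.mul_mem_left _ _ (Ideal.mul_mem_left _ _ ht)
        have h5 : (u : S) ∈ maximalIdeal S := by
          have := add_mem (show (u - z * t ^ (a + 1 - l) : S) ∈ maximalIdeal S from hnu) h4
          rwa [sub_add_cancel] at this
        exact h5 u.isUnit
      have h6 : t ^ (l+1) ∈ Ideal.ofList xs := by
        rw [mul_comm] at h3
        exact (Ideal.unit_mul_mem_iff_mem _ hunit).1 h3
      have := H.min _ h6
      omega
    · intro c
      obtain ⟨c, rfl⟩ := Submodule.mkQ_surjective _ c
      refine ⟨(0, - Submodule.mkQ _ c), ?_⟩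
      simp
      rfl
    · intro x
      obtain ⟨x, rfl⟩ := Submodule.mkQ_surjective _ x
      show Submodule.mkQ (Ja xs t (a+1)) (t * x) + - Submodule.mkQ (Ja xs t (a+1)) (t * x) = 0
      simp
    · rintro ⟨x, y⟩ hxy
      obtain ⟨x, rfl⟩ := Submodule.mkQ_surjective _ x
      obtain ⟨y, rfl⟩ := Submodule.mkQ_surjective _ y
      have h1 : Submodule.mkQ (Ja xs t (a+1)) (t * x) + - Submodule.mkQ (Ja xs t (a+1)) y = 0 := hxy
      rw [← sub_eq_add_neg, ← map_sub] at h1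
      have h2 : t * x - y ∈ Ja xs t (a+1) := (Submodule.Quotient.mk_eq_zero _).1 h1
      obtain ⟨j, hj, z, hz⟩ := mem_Ja.1 h2
      refine ⟨Submodule.mkQ _ (x - z * t ^ a), Prod.ext ?_ ?_⟩
      · refine (Submodule.Quotient.eq _).2 (mem_Ja.2 ⟨0, zero_mem _, -z, by show x - z * t ^ a - x = _; ring⟩)
      · refine (Submodule.Quotient.eq _).2 (mem_Ja.2 ⟨j, hj, 0, ?_⟩)
        show t * (x - z * t ^ a) - y = _
        linear_combination hz
  exact hr.fst (hr.ext s h h)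

lemma kk_of_Ja (H : HData S xs t n) (hr : IsResolving S 𝒳) (a : ℕ) (ha : a + 1 < n)
    (h : In 𝒳 (S ⧸ Ja xs t (a+1))) : In 𝒳 (kk S) := by
  induction a with
  | zero =>
    have e : Ja xs t (0+1) = maximalIdeal S := by rw [H.gen]; simp [Ja]
    exact hr.equiv (Submodule.quotEquivOfEq _ _ e) h
  | succ a ih => exact ih (by omega) (descend_step H hr (by omega) h)

lemma case1_aux (H : HData S xs t n) (hr : IsResolving S 𝒴) [Module.Finite S N] (hN : In 𝒴 N)
    (hreg : IsWeaklyRegular N xs) (hnf : ¬ Module.Projective S N) : In (SyzN xs.length 𝒴) (kk S) := by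
  classical
  obtain ⟨r, g, hg, hmin⟩ := min_cover (S := S) N
  have s := isSES_ker g hg
  have hK : In 𝒴 (LinearMap.ker g) := hr.syz s hN
  have hKM : In (MCM xs) (LinearMap.ker g) := (MCM_resolving H.reg).syz s (show In (MCM xs) N from ⟨‹_›, hreg⟩)
  have hKf := hKM.1
  have hq := quot_list_in xs 𝒴 hr _ hK hKM.2
  set J := Ideal.ofList xs with hJ
  set Kb := (LinearMap.ker g) ⧸ (J • ⊤ : Submodule S (LinearMap.ker g)) with hKb
  have hn1 : ∀ v : Kb, t ^ (n - 1) • v = 0 := by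
    intro v
    obtain ⟨v, rfl⟩ := Submodule.mkQ_surjective _ v
    rw [← map_smul]
    refine (Submodule.Quotient.mk_eq_zero _).2 (wreg_inter xs s hreg _ ?_)
    show t ^ (n-1) • (v : Fin r → S) ∈ J • (⊤ : Submodule S (Fin r → S))
    have hv := hmin v v.2
    have h1 : ∀ i, t ^ (n-1) * (v : Fin r → S) i ∈ J := by
      intro i
      obtain ⟨j, hj, z, hz⟩ := H.mem_max (hv i)
      rw [hz, mul_add]
      refine add_mem (Ideal.mul_mem_left _ _ hj) ?_
      have : t ^ (n-1) * (z * t) = z * t ^ n := by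
        obtain ⟨q, rfl⟩ : ∃ q, n = q + 1 := ⟨n - 1, by have := H.n_pos; omega⟩
        simp; ring
      rw [this]
      exact Ideal.mul_mem_left _ _ H.pow
    rw [show t ^ (n-1) • (v : Fin r → S) = ∑ i, (t ^ (n-1) * (v : Fin r → S) i) • (Pi.single i (1 : S) : Fin r → S) by
      ext i; simp [Finset.sum_apply, Pi.single_apply]]
    exact Submodule.sum_mem _ fun i _ => Submodule.smul_mem_smul (h1 i) trivial
  have htop : ∃ a, ∀ v : Kb, t ^ a • v = 0 := ⟨n - 1, hn1⟩
  have hspec := Nat.find_spec htop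
  have hfm := fun m (hm : m < Nat.find htop) => Nat.find_min htop hm
  have hfle : Nat.find htop ≤ n - 1 := Nat.find_min' htop hn1
  generalize Nat.find htop = a at *
  have hJK : ∀ c ∈ J, ∀ v : Kb, c • v = 0 := by
    intro c hc v
    obtain ⟨v, rfl⟩ := Submodule.mkQ_surjective _ v
    rw [← map_smul]
    exact (Submodule.Quotient.mk_eq_zero _).2 (Submodule.smul_mem_smul hc trivial)
  have hnt : ¬ ∀ v : Kb, v = 0 := by
    intro h0
    apply hnf
    have h1 : (⊤ : Submodule S (LinearMap.ker g)) ≤ J • ⊤ := by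
      intro v _
      exact (Submodule.Quotient.mk_eq_zero _).1 (h0 (Submodule.mkQ _ v))
    have h2 : (⊤ : Submodule S (LinearMap.ker g)) = ⊥ :=
      Submodule.eq_bot_of_le_smul_of_le_jacobson_bot J _ hKf.fg_top h1
        (by rw [IsLocalRing.jacobson_eq_maximalIdeal _ bot_ne_top]; exact H.le)
    have h3 : Function.Injective g := by
      rw [← LinearMap.ker_eq_bot]
      rw [eq_bot_iff]
      intro v hv
      have : (⟨v, hv⟩ : LinearMap.ker g) ∈ (⊤ : Submodule S (LinearMap.ker g)) := trivial
      rw [h2] at this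
      exact congrArg Subtype.val this
    exact Module.Projective.of_equiv (LinearEquiv.ofBijective g ⟨h3, hg⟩)
  obtain ⟨a, rfl⟩ : ∃ b, a = b + 1 := by
    rcases Nat.eq_zero_or_pos a with rfl | h
    · exact absurd (by simpa using hspec) hnt
    · exact ⟨a - 1, by omega⟩
  have h1 := hfm a (by omega)
  push Not at h1
  obtain ⟨v, hv⟩ := h1
  have hkill : ∀ c ∈ Ja xs t (a+1), ∀ v : Kb, c • v = 0 := by
    intro c hc v
    obtain ⟨j, hj, z, rfl⟩ := mem_Ja.1 hc
    rw [add_smul, hJK j hj, mul_smul, hspec, smul_zero, zero_add]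
  have hker : Ja xs t (a+1) ≤ LinearMap.ker (LinearMap.toSpanSingleton S Kb v) := by
    intro c hc
    exact hkill c hc v
  let ι : (S ⧸ Ja xs t (a+1)) →ₗ[S] Kb := Submodule.liftQ _ (LinearMap.toSpanSingleton S Kb v) hker
  have hι : Function.Injective ι := by
    rw [← LinearMap.ker_eq_bot, LinearMap.ker_eq_bot']
    intro c hc
    obtain ⟨c, rfl⟩ := Submodule.mkQ_surjective _ c
    have hc : c • v = 0 := hc
    refine (Submodule.Quotient.mk_eq_zero _).2 ?_
    by_contra hcn
    obtain ⟨l, hl, u, j, hj, rfl⟩ := H.unif _ _ hcn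
    rw [add_smul, hJK j hj, zero_add, mul_smul] at hc
    have h2 : t ^ l • v = 0 := by
      have := congrArg (fun w => ((u⁻¹ : Sˣ) : S) • w) hc
      simpa [smul_smul, ← mul_assoc] using this
    apply hv
    rw [show a = (a - l) + l by omega, pow_add, mul_smul, h2, smul_zero]
  have hJane : Ja xs t (a+1) ≠ ⊤ := by
    intro h
    have : Ja xs t (a+1) ≤ maximalIdeal S := by
      rw [H.gen]; exact sup_le_sup_left (Ideal.span_singleton_le_span_singleton.2 (dvd_pow_self t (by omega))) _
    exact (maximalIdeal.isMaximal S).ne_top (top_le_iff.1 (h ▸ this))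
  obtain ⟨ρ, hρ⟩ := inj_quot (t := t) (n := a+1) hJane (by
    rw [H.gen]
    apply le_antisymm
    · exact sup_le_sup_right le_sup_left _
    · refine sup_le (sup_le_sup_left (Ideal.span_singleton_le_span_singleton.2 (dvd_pow_self t (by omega))) _) le_sup_right)
    (Submodule.mem_sup_right (Ideal.mem_span_singleton_self _)) ι hι hkill LinearMap.id
  have h2 := (hr.syzN xs.length).retract ι ρ hρ hq
  exact kk_of_Ja H (hr.syzN _) a (by omega) h2

lemma case1 (H : HData S xs t n) (hr : IsResolving S 𝒴) (hX : In 𝒴 X)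
    (hinf : ∀ i, ¬ In (SyzN i (PJ S)) X) : In (SyzN xs.length 𝒴) (kk S) := by
  by_contra hcon
  have hXf := hr.finite hX
  have h1 := SyzN_inter hr _ X (in_SyzN_MCM' H.reg (M := X)) hX
  refine hinf xs.length (SyzN_mono _ ?_ h1)
  intro N hN
  have : Module.Finite S N := hN.1.1
  refine ⟨this, ?_⟩
  by_contra hnp
  exact hcon (case1_aux H hr (N := N) hN.2 hN.1.2 hnp)

end PartSeven

end Chunk7

section Chunk8
open scoped Pointwise
set_option linter.unusedSectionVars false
set_option linter.style.haveILetI false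
section PartEight

open RingTheory.Sequence IsLocalRing

variable {R : Type u} [CommRing R] [IsNoetherianRing R]
variable {A B C K P M N Y F U X Z Z' Z₁ Z₂ L : Type u} [AddCommGroup A] [Module R A] [AddCommGroup B] [Module R B]
  [AddCommGroup C] [Module R C] [AddCommGroup M] [Module R M] [AddCommGroup N] [Module R N]
   [AddCommGroup Y] [Module R Y] [AddCommGroup F] [Module R F] [AddCommGroup U] [Module R U]
   [AddCommGroup X] [Module R X] [AddCommGroup K] [Module R K] [AddCommGroup P] [Module R P]
   [AddCommGroup Z] [Module R Z] [AddCommGroup Z'] [Module R Z'] [AddCommGroup L] [Module R L]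
   [AddCommGroup Z₁] [Module R Z₁] [AddCommGroup Z₂] [Module R Z₂]
variable {𝒳 𝒴 : Set (ModuleCat.{u} R)} {xs : List R}

def Z0 (xs : List R) (𝒴 : Set (ModuleCat.{u} R)) (Z : Type u) [AddCommGroup Z] [Module R Z] : Prop :=
  ∃ (Y C : ModuleCat.{u} R) (i : Z →ₗ[R] Y) (p : Y →ₗ[R] C), IsSES i p ∧ In 𝒴 Y ∧ In (MCM xs) C

lemma Z0.mk {i : Z →ₗ[R] Y} {p : Y →ₗ[R] C} (s : IsSES i p) (hY : In 𝒴 Y) (hC : In (MCM xs) C) : Z0 xs 𝒴 Z :=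
  ⟨ModuleCat.of R Y, ModuleCat.of R C, i, p, s, hY, hC⟩

lemma po_desc_ses {i : Z₁ →ₗ[R] Y} {p : Y →ₗ[R] C} (s : IsSES i p) (f : Z₁ →ₗ[R] Z) :
    ∃ q : Po f i →ₗ[R] C, IsSES ((LinearMap.range (f.prod (-i))).mkQ ∘ₗ LinearMap.inl R Z Y) q := by
  obtain ⟨q, hq⟩ := po_desc f i 0 p (fun a => by simp [s.zero])
  refine ⟨q, IsSES.mk' ?_ ?_ ?_ ?_⟩
  · intro z hz
    obtain ⟨a, ha⟩ := (Submodule.Quotient.mk_eq_zero _).1 hz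
    have h1 : f a = z := congrArg Prod.fst ha
    have h2 : - i a = 0 := congrArg Prod.snd ha
    have h3 : a = 0 := s.1 (by rw [map_zero]; exact neg_eq_zero.1 h2)
    rw [← h1, h3, map_zero]
  · intro c
    obtain ⟨y, rfl⟩ := s.2.1 c
    exact ⟨Submodule.mkQ _ (0, y), by rw [hq]; simp⟩
  · intro z
    rw [LinearMap.comp_apply, LinearMap.inl_apply, hq]; simp
  · intro w hw
    obtain ⟨⟨z, y⟩, rfl⟩ := Submodule.mkQ_surjective _ w
    rw [hq] at hw
    obtain ⟨a, rfl⟩ := s.ex (b := y) (by simpa using hw)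
    refine ⟨z + f a, (Submodule.Quotient.eq _).2 ⟨a, ?_⟩⟩
    ext <;> simp

lemma Z0.of_mono (hxs : IsWeaklyRegular R xs) {i : Z →ₗ[R] Z'} {p : Z' →ₗ[R] C} (s : IsSES i p)
    (hC : In (MCM xs) C) (h : Z0 xs 𝒴 Z') : Z0 xs 𝒴 Z := by
  obtain ⟨Y, D, j, q, sj, hY, hD⟩ := h
  let Q := Y ⧸ LinearMap.range (j ∘ₗ i)
  have hinj : Function.Injective (j ∘ₗ i) := sj.1.comp s.1
  have sQ : IsSES (j ∘ₗ i) (LinearMap.range (j ∘ₗ i)).mkQ :=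
    ⟨hinj, Submodule.mkQ_surjective _, by rw [Submodule.ker_mkQ]⟩
  obtain ⟨a, ha⟩ := s.desc ((LinearMap.range (j ∘ₗ i)).mkQ ∘ₗ j) (fun z => sQ.zero z)
  obtain ⟨b, hb⟩ := sQ.desc q (fun z => sj.zero _)
  have sC : IsSES a b := by
    refine IsSES.mk' ?_ ?_ ?_ ?_
    · intro c hc
      obtain ⟨z, rfl⟩ := s.2.1 c
      rw [ha] at hc
      obtain ⟨z', hz'⟩ := sQ.ex hc
      have : i z' = z := sj.1 hz'
      rw [← this, s.zero]
    · intro d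
      obtain ⟨y, rfl⟩ := sj.2.1 d
      exact ⟨_, hb y⟩
    · intro c
      obtain ⟨z, rfl⟩ := s.2.1 c
      rw [ha, LinearMap.comp_apply, hb, sj.zero]
    · intro w hw
      obtain ⟨y, rfl⟩ := Submodule.mkQ_surjective _ w
      rw [hb] at hw
      obtain ⟨z, rfl⟩ := sj.ex hw
      exact ⟨p z, ha z⟩
  exact Z0.mk sQ hY ((MCM_resolving hxs).ext sC hC hD)

lemma Z0.ext (hxs : IsWeaklyRegular R xs) (hr : IsResolving R 𝒴) (hE : ∀ Y : ModuleCat.{u} R, Y ∈ 𝒴 → EP xs Y)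
    {f : Z₁ →ₗ[R] Z} {g : Z →ₗ[R] Z₂} (s : IsSES f g) (h1 : Z0 xs 𝒴 Z₁) (h2 : Z0 xs 𝒴 Z₂) : Z0 xs 𝒴 Z := by
  obtain ⟨Y₁, C₁, i₁, p₁, s₁, hY₁, hC₁⟩ := h1
  obtain ⟨Y₂, C₂, i₂, p₂, s₂, hY₂, hC₂⟩ := h2
  obtain ⟨q, hq⟩ := po_desc_ses s₁ f
  refine Z0.of_mono hxs hq hC₁ ?_
  obtain ⟨π, hπ, sπ⟩ := po_ses s i₁
  generalize (LinearMap.range (f.prod (-i₁))).mkQ ∘ₗ LinearMap.inr R Z Y₁ = k at sπ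
  -- extension of Z₂ by Y₁
  have hY₂f := hr.finite hY₂
  obtain ⟨n, ρ, hρ⟩ := exists_cover (R := R) Y₂
  have hsurj : Function.Surjective (p₂ ∘ₗ ρ) := s₂.2.1.comp hρ
  have sQ := isSES_ker (p₂ ∘ₗ ρ) hsurj
  have hQ : In (MCM xs) (LinearMap.ker (p₂ ∘ₗ ρ)) := (MCM_resolving hxs).syz sQ hC₂
  have hQf := hQ.1
  obtain ⟨σ, hσ⟩ := s₂.lift (ρ ∘ₗ (LinearMap.ker (p₂ ∘ₗ ρ)).subtype) (fun x => x.2)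
  obtain ⟨γ, hγ⟩ := (hE Y₁ hY₁).lift sπ hQ.2 σ
  obtain ⟨w, hw, sw⟩ := po_ses sQ γ
  obtain ⟨θ, hθ⟩ := po_desc (LinearMap.ker (p₂ ∘ₗ ρ)).subtype γ ρ (i₂ ∘ₗ π) (fun a => by
    rw [LinearMap.comp_apply, hγ, hσ]; rfl)
  have sθ : IsSES (((LinearMap.range ((LinearMap.ker (p₂ ∘ₗ ρ)).subtype.prod (-γ))).mkQ ∘ₗ
      LinearMap.inr R _ _) ∘ₗ k) θ := by
    refine IsSES.mk' ?_ ?_ ?_ ?_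
    · intro a ha
      exact sπ.1 (by rw [map_zero]; exact sw.1 (by rw [map_zero]; exact ha))
    · intro y
      obtain ⟨x, rfl⟩ := hρ y
      exact ⟨Submodule.mkQ _ (x, 0), by rw [hθ]; simp⟩
    · intro a
      rw [LinearMap.comp_apply, LinearMap.comp_apply, LinearMap.inr_apply, hθ, LinearMap.comp_apply, sπ.zero]
      simp
    · intro v hv
      obtain ⟨⟨x, z⟩, rfl⟩ := Submodule.mkQ_surjective _ v
      rw [hθ] at hv
      have hx : x ∈ LinearMap.ker (p₂ ∘ₗ ρ) := by
        have := congrArg p₂ hv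
        rw [map_add, LinearMap.comp_apply, s₂.zero, add_zero, map_zero] at this
        exact this
      have hz : π (z + γ ⟨x, hx⟩) = 0 := by
        apply s₂.1
        rw [map_add, map_add, hγ, hσ, map_zero, add_comm]
        exact hv
      obtain ⟨a, ha⟩ := sπ.ex hz
      refine ⟨a, ?_⟩
      rw [LinearMap.comp_apply, ha]
      refine (Submodule.Quotient.eq _).2 ⟨-⟨x, hx⟩, ?_⟩
      ext <;> simp
  exact Z0.mk sw (hr.ext sθ hY₁ hY₂) hC₂

lemma Z0.equiv (h : Z0 xs 𝒴 Z) (e : Z ≃ₗ[R] Z') : Z0 xs 𝒴 Z' := by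
  obtain ⟨Y, C, i, p, s, hY, hC⟩ := h
  refine Z0.mk (i := i ∘ₗ e.symm.toLinearMap) (p := p) (IsSES.mk' ?_ s.2.1 (fun a => s.zero _) ?_) hY hC
  · intro a ha
    have : e.symm a = 0 := s.1 (by rw [map_zero]; exact ha)
    simpa using this
  · intro b hb
    obtain ⟨a, rfl⟩ := s.ex hb
    exact ⟨e a, by simp⟩

lemma Z0.syz (hxs : IsWeaklyRegular R xs) (hr : IsResolving R 𝒴) {f : K →ₗ[R] P} {g : P →ₗ[R] Z} (s : IsSES f g)
    [Module.Finite R P] [Module.Projective R P] (h : Z0 xs 𝒴 Z) : Z0 xs 𝒴 K := by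
  obtain ⟨Y, C, i, p, sY, hY, hC⟩ := h
  have := hC.1
  obtain ⟨n, c, hc⟩ := exists_cover (R := R) C
  obtain ⟨b, hb, i', j', s'⟩ := IsResolving.horseshoe sY g s.2.1 c hc
  have h1 : In 𝒴 (LinearMap.ker b) := hr.syz (isSES_ker b hb) hY
  have h2 : In (MCM xs) (LinearMap.ker c) := (MCM_resolving hxs).syz (isSES_ker c hc) hC
  have h3 : Z0 xs 𝒴 (LinearMap.ker g) := Z0.mk s' h1 h2
  exact h3.equiv (LinearEquiv.trans (LinearEquiv.ofEq _ _ s.2.2.symm) (LinearEquiv.ofInjective f s.1).symm)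

lemma Z0.of_mem (hxs : IsWeaklyRegular R xs) (h : In 𝒴 Z) : Z0 xs 𝒴 Z :=
  Z0.mk (i := LinearMap.id) (p := (0 : Z →ₗ[R] PUnit.{u+1})) (IsSES.mk' (by simp) (by simp) (by simp) (by simp)) h
    (MCM_resolving hxs).of_subsingleton

lemma Z0.finite (hr : IsResolving R 𝒴) (h : Z0 xs 𝒴 Z) : Module.Finite R Z := by
  obtain ⟨Y, C, i, p, sY, hY, hC⟩ := h
  exact sY.finite_left (hr.finite hY)

lemma Z0.prod (hxs : IsWeaklyRegular R xs) (hr : IsResolving R 𝒴) (h : Z0 xs 𝒴 Z) (h' : Z0 xs 𝒴 Z') : Z0 xs 𝒴 (Z × Z') := by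
  obtain ⟨Y, C, i, p, sY, hY, hC⟩ := h
  obtain ⟨Y', C', i', p', sY', hY', hC'⟩ := h'
  exact Z0.mk (IsResolving.kerProd sY sY') (hr.prod hY hY') ((MCM_resolving hxs).prod hC hC')

/-- summands of `Z0` -/
def ZZ (xs : List R) (𝒴 : Set (ModuleCat.{u} R)) : Set (ModuleCat.{u} R) :=
  {Z | ∃ Z' : ModuleCat.{u} R, Z0 xs 𝒴 (Z × Z')}

lemma ZZ_resolving (hxs : IsWeaklyRegular R xs) (hr : IsResolving R 𝒴)
    (hE : ∀ Y : ModuleCat.{u} R, Y ∈ 𝒴 → EP xs Y) : IsResolving R (ZZ xs 𝒴) where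
  fg M hM := by
    obtain ⟨Z, h⟩ := hM
    have := h.finite hr
    exact Module.Finite.of_surjective (LinearMap.fst R M Z) Prod.fst_surjective
  iso_closed M N e hM := by
    obtain ⟨Z, h⟩ := hM
    exact ⟨Z, h.equiv (LinearEquiv.prodCongr e.some (LinearEquiv.refl R Z))⟩
  proj_mem M h1 h2 := ⟨ModuleCat.of R PUnit, Z0.of_mem hxs (hr.prod (hr.proj_mem M h1 h2) hr.of_subsingleton)⟩
  summand_closed M N hMN := by
    obtain ⟨Z, h⟩ := hMN
    exact ⟨ModuleCat.of R (N × Z), h.equiv (LinearEquiv.prodAssoc R M N Z)⟩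
  ext_closed A B C f g s hA hC := by
    obtain ⟨A', hA⟩ := hA
    obtain ⟨C', hC⟩ := hC
    refine ⟨ModuleCat.of R (A' × C'), ?_⟩
    have s' : IsSES (f.prodMap (LinearMap.inl R A' C')) (g.prodMap (LinearMap.snd R A' C')) :=
      IsResolving.kerProd s (IsSES.mk' (by simp) (fun c => ⟨(0, c), rfl⟩) (by simp) (by
        rintro ⟨a, c⟩ h; exact ⟨a, by simp at h; simp [h]⟩))
    exact Z0.ext hxs hr hE s' hA hC
  syzygy_closed K P M f g s h1 h2 h3 hM := by
    obtain ⟨M', hM'⟩ := hM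
    have := hM'.finite hr
    have : Module.Finite R M' := Module.Finite.of_surjective (LinearMap.snd R M M') Prod.snd_surjective
    obtain ⟨n, c, hc⟩ := exists_cover (R := R) M'
    exact ⟨ModuleCat.of R (LinearMap.ker c), Z0.syz hxs hr (IsResolving.kerProd s (isSES_ker c hc)) hM'⟩

lemma ZZ_finpd (hr : IsResolving R 𝒴) (h : In (ZZ xs 𝒴) M) (hM : EP xs M) : In 𝒴 M := by
  obtain ⟨Z', Y, C, i, p, sY, hY, hC⟩ := h
  have : Module.Finite R C := hC.1
  obtain ⟨ψ, hψ⟩ := hM.extend sY hC.2 (LinearMap.fst R M Z')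
  exact hr.retract (i ∘ₗ LinearMap.inl R M Z') ψ (fun m => by
    rw [LinearMap.comp_apply]
    exact hψ _) hY

end PartEight

section PartEightB
open RingTheory.Sequence IsLocalRing
variable {S : Type u} [CommRing S] [IsLocalRing S] [IsNoetherianRing S]
variable {M X : Type u} [AddCommGroup M] [Module S M] [AddCommGroup X] [Module S X]
variable {𝒴 : Set (ModuleCat.{u} S)} {xs : List S} {t : S} {n : ℕ}

theorem local_main (H : HData S xs t n) (hr : IsResolving S 𝒴) (hX : In 𝒴 X)
    (hXM : ∀ j, dGE S j X → dGE S j M) (hM : In (circ (maximalIdeal S) 𝒴) M)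
    (hinf : (∀ i, ¬ In (SyzN i (PJ S)) M) → ∃ X' : ModuleCat.{u} S, X' ∈ 𝒴 ∧ ∀ i, ¬ In (SyzN i (PJ S)) X') :
    In 𝒴 M := by
  by_cases h : ∃ X' : ModuleCat.{u} S, X' ∈ 𝒴 ∧ ∀ i, ¬ In (SyzN i (PJ S)) X'
  · obtain ⟨X', h1, h2⟩ := h
    exact core hr (case1 H hr (X := X') h1 h2) hX hXM hM
  · have hMf := mt hinf h
    push Not at h hMf
    obtain ⟨i, hi⟩ := hMf
    have hE : ∀ Y : ModuleCat.{u} S, Y ∈ 𝒴 → EP xs Y := by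
      intro Y hY
      obtain ⟨i, hi⟩ := h Y hY
      exact EP.of_finpd H.reg H.ep i Y hi
    have hrZ := ZZ_resolving H.reg hr hE
    have hsub : 𝒴 ⊆ ZZ xs 𝒴 := fun Y hY => ⟨ModuleCat.of S PUnit, Z0.of_mem H.reg (hr.prod (show In 𝒴 Y from hY) hr.of_subsingleton)⟩
    have hk : In (SyzN (xs.length + 1) (ZZ xs 𝒴)) (kk S) := by
      have h1 := in_SyzN_MCM' H.reg (M := kk S)
      rw [SyzN_add]
      refine SyzN_mono _ ?_ h1
      intro C hC
      have : Module.Finite S C := hC.1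
      obtain ⟨m, c, hc⟩ := exists_cover (R := S) C
      refine (in_Syz1 (M := C)).2 ⟨m, c, hc, ModuleCat.of S PUnit, ?_⟩
      refine Z0.equiv ?_ (LinearEquiv.prodUnique (R := S) (M := LinearMap.ker c) (M₂ := PUnit.{u+1})).symm
      exact Z0.mk (isSES_ker c hc) (hr.proj) hC
    have h2 := core hrZ hk (hsub hX) hXM (circ_mono _ hsub hM)
    exact ZZ_finpd hr h2 (EP.of_finpd H.reg H.ep i M hi)
end PartEightB

end Chunk8

section Chunk9
open scoped Pointwise
set_option linter.unusedSectionVars false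
set_option linter.style.haveILetI false
section PartNine

open RingTheory.Sequence IsLocalRing

variable {R : Type u} [CommRing R] {T : Submonoid R}
variable {S : Type u} [CommRing S] [Algebra R S]
variable {M M₁ N₀ : Type u} [AddCommGroup M] [Module R M] [AddCommGroup M₁] [Module R M₁]
  [AddCommGroup N₀] [Module R N₀]
variable {A B C N N₁ N₂ : Type u} [AddCommGroup A] [Module S A] [AddCommGroup B] [Module S B]
  [AddCommGroup C] [Module S C] [AddCommGroup N] [Module S N] [AddCommGroup N₁] [Module S N₁]
  [AddCommGroup N₂] [Module S N₂]
variable {𝒳 𝒴 : Set (ModuleCat.{u} R)}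

/-- a semilinear map exhibiting `N` as the localization of `M` at `T`. -/
def IsLoc (T : Submonoid R) (φ : M →ₛₗ[algebraMap R S] N) : Prop :=
  (∀ n, ∃ s ∈ T, ∃ m, φ m = algebraMap R S s • n) ∧ ∀ m, φ m = 0 → ∃ s ∈ T, s • m = 0

lemma unit_smul_inj [IsLocalization T S] {s : R} (hs : s ∈ T) {n n' : N}
    (h : algebraMap R S s • n = algebraMap R S s • n') : n = n' := by
  have hu : IsUnit (algebraMap R S s) := IsLocalization.map_units S ⟨s, hs⟩
  exact hu.smul_left_cancel.1 h

lemma unit_smul_surj [IsLocalization T S] {s : R} (hs : s ∈ T) (n : N) :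
    ∃ n', algebraMap R S s • n' = n := by
  obtain ⟨u, hu⟩ : IsUnit (algebraMap R S s) := IsLocalization.map_units S ⟨s, hs⟩
  exact ⟨u⁻¹ • n, by rw [← hu]; exact smul_inv_smul u n⟩

lemma IsLoc.equiv {φ : M →ₛₗ[algebraMap R S] N} (h : IsLoc T φ) (e : N ≃ₗ[S] N₁) :
    IsLoc T (e.toLinearMap.comp φ : M →ₛₗ[algebraMap R S] N₁) := by
  refine ⟨fun n => ?_, fun m hm => h.2 m (e.injective (by simpa using hm))⟩
  obtain ⟨s, hs, m, hm⟩ := h.1 (e.symm n)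
  exact ⟨s, hs, m, by simp [hm]⟩

section
variable [IsLocalization T S] {f : A →ₗ[S] B} {g : B →ₗ[S] C}

lemma lattice_left (s : IsSES f g) {ι : N₀ →ₛₗ[algebraMap R S] B} (h : IsLoc T ι) :
    ∃ φ : LinearMap.ker (g.comp ι : N₀ →ₛₗ[algebraMap R S] C) →ₛₗ[algebraMap R S] A, IsLoc T φ := by
  have hex : ∀ x : LinearMap.ker (g.comp ι : N₀ →ₛₗ[algebraMap R S] C), ∃ a, f a = ι x := fun x =>
    s.ex (b := ι x) x.2
  choose φ hφ using hex
  refine ⟨⟨⟨φ, fun x y => s.1 (by simp [hφ])⟩, fun r x => s.1 (by simp [hφ])⟩, fun a => ?_, fun x hx => ?_⟩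
  · obtain ⟨t, ht, m, hm⟩ := h.1 (f a)
    refine ⟨t, ht, ⟨m, ?_⟩, s.1 ?_⟩
    · show g (ι m) = 0
      rw [hm]; simp [s.zero]
    · show f (φ _) = _
      rw [hφ]; simp [hm]
  · have hx' : φ x = 0 := hx
    obtain ⟨t, ht, h0⟩ := h.2 x (by rw [← hφ, hx', map_zero])
    exact ⟨t, ht, Subtype.ext h0⟩

lemma lattice_right (s : IsSES f g) {ι : N₀ →ₛₗ[algebraMap R S] B} (h : IsLoc T ι) :
    ∃ φ : (N₀ ⧸ LinearMap.ker (g.comp ι : N₀ →ₛₗ[algebraMap R S] C)) →ₛₗ[algebraMap R S] C, IsLoc T φ := by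
  refine ⟨(LinearMap.ker (g.comp ι : N₀ →ₛₗ[algebraMap R S] C)).liftQ (g.comp ι) le_rfl, fun c => ?_, fun x hx => ?_⟩
  · obtain ⟨b, rfl⟩ := s.2.1 c
    obtain ⟨t, ht, m, hm⟩ := h.1 b
    exact ⟨t, ht, Submodule.Quotient.mk m, by
      show g (ι m) = _
      rw [hm, map_smul]⟩
  · obtain ⟨x, rfl⟩ := Submodule.mkQ_surjective _ x
    refine ⟨1, T.one_mem, ?_⟩
    rw [one_smul]
    exact (Submodule.Quotient.mk_eq_zero _).2 hx

end

/-- the free module lattice -/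
def piLoc (n : ℕ) : (Fin n → R) →ₛₗ[algebraMap R S] (Fin n → S) where
  toFun v i := algebraMap R S (v i)
  map_add' v w := by ext; simp
  map_smul' r v := by ext; simp

lemma isLoc_pi [IsLocalization T S] (n : ℕ) : IsLoc T (piLoc (R := R) (S := S) n) := by
  constructor
  · intro v
    obtain ⟨b, hb⟩ := IsLocalization.exist_integer_multiples_of_finite T v
    choose w hw using hb
    refine ⟨b, b.2, w, ?_⟩
    ext i
    show algebraMap R S (w i) = _
    rw [hw]
    simp [Algebra.smul_def]
  · intro v hv
    have : ∀ i, ∃ s : T, (s : R) * v i = 0 := fun i =>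
      (IsLocalization.map_eq_zero_iff T S _).1 (congrFun hv i)
    choose s hs using this
    refine ⟨∏ i, (s i : R), T.prod_mem fun i _ => (s i).2, ?_⟩
    ext i
    obtain ⟨c, hc⟩ := Finset.dvd_prod_of_mem (fun i => (s i : R)) (Finset.mem_univ i)
    show (∏ i, (s i : R)) * v i = 0
    rw [hc, mul_comm _ c, mul_assoc, hs, mul_zero]

lemma exists_lattice (T : Submonoid R) [IsLocalization T S] (B : Type u) [AddCommGroup B] [Module S B]
    [Module.Finite S B] :
    ∃ (N₀ : ModuleCat.{u} R) (φ : N₀ →ₛₗ[algebraMap R S] B), Module.Finite R N₀ ∧ IsLoc T φ := by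
  obtain ⟨n, g, hg⟩ := Module.Finite.exists_fin' S B
  obtain ⟨φ, hφ⟩ := lattice_right (isSES_ker g hg) (isLoc_pi (T := T) (R := R) n)
  exact ⟨ModuleCat.of R _, φ, inferInstanceAs (Module.Finite R ((Fin n → R) ⧸ _)), hφ⟩

lemma IsLoc.lift [IsLocalization T S] [Module.FinitePresentation R M]
    {φ : M →ₛₗ[algebraMap R S] N} {φ₁ : M₁ →ₛₗ[algebraMap R S] N₁}
    (h₁ : IsLoc T φ₁) (α : N →ₗ[S] N₁) :
    ∃ (a : M →ₗ[R] M₁), ∃ s ∈ T, ∀ m, φ₁ (a m) = algebraMap R S s • α (φ m) := by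
  letI : Module R N := Module.compHom N (algebraMap R S)
  letI : Module R N₁ := Module.compHom N₁ (algebraMap R S)
  let φ' : M →ₗ[R] N := ⟨⟨φ, map_add φ⟩, fun r m => φ.map_smulₛₗ r m⟩
  let φ₁' : M₁ →ₗ[R] N₁ := ⟨⟨φ₁, map_add φ₁⟩, fun r m => φ₁.map_smulₛₗ r m⟩
  let α' : N →ₗ[R] N₁ := ⟨⟨α, map_add α⟩, fun r m => α.map_smul _ m⟩
  haveI : IsLocalizedModule T φ₁' := by
    refine ⟨fun s => ?_, fun y => ?_, fun {x y} hxy => ?_⟩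
    · rw [Module.End.isUnit_iff]
      constructor
      · intro n n' hn
        exact unit_smul_inj (S := S) s.2 hn
      · intro n
        exact unit_smul_surj (S := S) s.2 n
    · obtain ⟨s, hs, m, hm⟩ := h₁.1 y
      exact ⟨(m, ⟨s, hs⟩), hm.symm⟩
    · obtain ⟨s, hs, h0⟩ := h₁.2 (x - y) (by
        rw [map_sub]; exact sub_eq_zero.2 hxy)
      exact ⟨⟨s, hs⟩, sub_eq_zero.1 (by rw [← smul_sub]; exact h0)⟩
  obtain ⟨a, s, ha⟩ := Module.FinitePresentation.exists_lift_of_isLocalizedModule T φ₁' (α' ∘ₗ φ')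
  exact ⟨a, s, s.2, fun m => LinearMap.congr_fun ha m⟩

lemma exists_smul_zero [Module.Finite R M] (h : M →ₗ[R] M₁) (H : ∀ m, ∃ s ∈ T, s • h m = 0) :
    ∃ s ∈ T, ∀ m, s • h m = 0 := by
  obtain ⟨n, g, hg⟩ := Module.Finite.exists_fin' R M
  choose s hs h0 using fun i => H (g (Pi.single i 1))
  refine ⟨∏ i, s i, T.prod_mem fun i _ => hs i, fun m => ?_⟩
  have : (∏ i, s i) • (h ∘ₗ g) = 0 := by
    refine LinearMap.pi_ext' fun i => LinearMap.ext_ring ?_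
    obtain ⟨c, hc⟩ := Finset.dvd_prod_of_mem s (Finset.mem_univ i)
    show (∏ i, s i) • h (g (Pi.single i 1)) = 0
    rw [hc, mul_comm, mul_smul, h0, smul_zero]
  obtain ⟨v, rfl⟩ := hg m
  exact LinearMap.congr_fun this v

variable [IsNoetherianRing R]

lemma locT_retract [IsLocalization T S] [Module.Finite R M] {φ : M →ₛₗ[algebraMap R S] N}
    {φ₁ : M₁ →ₛₗ[algebraMap R S] N₁}
    (h : IsLoc T φ) (h₁ : IsLoc T φ₁) (i : N →ₗ[S] N₁) (r : N₁ →ₗ[S] N) (hir : ∀ n, r (i n) = n)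
    (hM₁ : In (locT 𝒳 T) M₁) : In (locT 𝒳 T) M := by
  haveI : Module.Finite R M₁ := (in_locT.1 hM₁).1
  haveI : Module.FinitePresentation R M := Module.finitePresentation_of_finite R M
  haveI : Module.FinitePresentation R M₁ := Module.finitePresentation_of_finite R M₁
  obtain ⟨a, s, hs, ha⟩ := h₁.lift (φ := φ) i
  obtain ⟨b, t, ht, hb⟩ := h.lift (φ := φ₁) r
  obtain ⟨w, hw, h0⟩ := exists_smul_zero (T := T) (b ∘ₗ a - (t * s) • LinearMap.id) (fun m => h.2 _ (by
    show φ (b (a m) - (t * s) • m) = 0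
    rw [map_sub, hb, ha, map_smul, hir, φ.map_smulₛₗ, map_mul, mul_smul, sub_self]))
  obtain ⟨hf, v, hv, hF⟩ := in_locT.1 hM₁
  refine in_locT.2 ⟨inferInstance, v * (w * (t * s)), T.mul_mem hv (T.mul_mem hw (T.mul_mem ht hs)),
    Fac.retract a (w • b) (fun m => ?_) hF⟩
  have := h0 m
  simp only [LinearMap.sub_apply, LinearMap.comp_apply, LinearMap.smul_apply, LinearMap.id_apply, smul_sub, sub_eq_zero] at this
  rw [LinearMap.smul_apply, this, mul_smul w]

variable (S) in
/-- the localization of a subcategory. -/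
def Yp (𝒳 : Set (ModuleCat.{u} R)) (T : Submonoid R) : Set (ModuleCat.{u} S) :=
  {N | Module.Finite S N ∧ ∃ (M : ModuleCat.{u} R) (φ : M →ₛₗ[algebraMap R S] N), IsLoc T φ ∧ M ∈ locT 𝒳 T}

lemma in_Yp : In (Yp S 𝒳 T) N ↔
    Module.Finite S N ∧ ∃ (M : ModuleCat.{u} R) (φ : M →ₛₗ[algebraMap R S] N), IsLoc T φ ∧ M ∈ locT 𝒳 T := Iff.rfl

lemma in_Yp_mk [Module.Finite S N] {φ : M →ₛₗ[algebraMap R S] N} (h : IsLoc T φ) (hM : In (locT 𝒳 T) M) :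
    In (Yp S 𝒳 T) N := ⟨inferInstance, ModuleCat.of R M, φ, h, hM⟩

lemma locT_of_Yp [IsLocalization T S] [Module.Finite R M] {φ : M →ₛₗ[algebraMap R S] N} (h : IsLoc T φ)
    (hN : In (Yp S 𝒳 T) N) : In (locT 𝒳 T) M := by
  obtain ⟨hf, M₁, φ₁, h₁, hM₁⟩ := in_Yp.1 hN
  exact locT_retract h h₁ LinearMap.id LinearMap.id (fun _ => rfl) hM₁

lemma IsResolving.Yp [IsLocalization T S] [IsLocalRing S] (hr : IsResolving R 𝒳) : IsResolving S (Yp S 𝒳 T) where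
  fg := fun N h => h.1
  iso_closed := by
    rintro N N' ⟨e⟩ hN
    obtain ⟨hf, M, φ, h, hM⟩ := hN
    exact ⟨Module.Finite.equiv e, M, _, h.equiv e, hM⟩
  proj_mem := by
    intro P hf hp
    haveI : Module.Free S P := Module.free_of_flat_of_isLocalRing
    let b := Module.finBasis S P
    exact ⟨hf, ModuleCat.of R (Fin (Module.finrank S P) → R), _, (isLoc_pi (T := T) _).equiv b.equivFun.symm,
      (hr.locT T).proj_mem _ (inferInstanceAs (Module.Finite R (_ → R))) (inferInstanceAs (Module.Projective R (_ → R)))⟩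
  summand_closed := by
    intro N N' hN
    obtain ⟨hf, M, φ, h, hM⟩ := hN
    haveI := hf
    haveI : Module.Finite S (N × N') := hf
    haveI : Module.Finite S N := Module.Finite.of_surjective (LinearMap.fst S N N') LinearMap.fst_surjective
    obtain ⟨M₀, φ₀, hf₀, h₀⟩ := exists_lattice (S := S) T N
    exact in_Yp_mk h₀ (locT_retract h₀ h (LinearMap.inl S N N') (LinearMap.fst S N N') (fun _ => rfl) hM)
  ext_closed := by
    intro A B C f g s hA hC
    haveI := hA.1
    haveI := hC.1
    haveI : Module.Finite S B := s.finite_mid hA.1 hC.1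
    obtain ⟨M₀, φ₀, hf₀, h₀⟩ := exists_lattice (S := S) T B
    obtain ⟨φ, hφ⟩ := lattice_left s h₀
    obtain ⟨ψ, hψ⟩ := lattice_right s h₀
    exact in_Yp_mk h₀ ((hr.locT T).ext (isSES_mkQ _) (locT_of_Yp hφ hA) (locT_of_Yp hψ hC))
  syzygy_closed := by
    intro K P M f g s hK hP hproj hM
    haveI : Module.Free S P := Module.free_of_flat_of_isLocalRing
    let b := Module.finBasis S P
    have h₀ := (isLoc_pi (T := T) (R := R) _).equiv b.equivFun.symm
    obtain ⟨φ, hφ⟩ := lattice_left s h₀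
    obtain ⟨ψ, hψ⟩ := lattice_right s h₀
    exact in_Yp_mk hφ ((hr.locT T).syz (isSES_mkQ _) (locT_of_Yp hψ hM))

/-- universal property -/
lemma IsLoc.desc [IsLocalization T S] {φ : M →ₛₗ[algebraMap R S] N} (h : IsLoc T φ)
    (ψ : M →ₛₗ[algebraMap R S] N₁) : ∃ β : N →ₗ[S] N₁, ∀ m, β (φ m) = ψ m := by
  have key : ∀ m m' : M, φ m = φ m' → ψ m = ψ m' := fun m m' hm => by
    obtain ⟨s, hs, h0⟩ := h.2 (m - m') (by rw [map_sub, hm, sub_self])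
    refine unit_smul_inj (S := S) hs ?_
    rw [← ψ.map_smulₛₗ, ← ψ.map_smulₛₗ, ← sub_eq_zero, ← map_sub, ← smul_sub, h0, map_zero]
  have hex : ∀ n : N, ∃ n₁ : N₁, ∃ s ∈ T, ∃ m, φ m = algebraMap R S s • n ∧ ψ m = algebraMap R S s • n₁ := fun n => by
    obtain ⟨s, hs, m, hm⟩ := h.1 n
    obtain ⟨n₁, hn⟩ := unit_smul_surj (S := S) hs (ψ m)
    exact ⟨n₁, s, hs, m, hm, hn.symm⟩
  choose β s hs m hm hβ using hex
  have char : ∀ n (t : R), t ∈ T → ∀ k, φ k = algebraMap R S t • n → ψ k = algebraMap R S t • β n := by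
    intro n t ht k hk
    refine unit_smul_inj (S := S) (hs n) ?_
    rw [smul_comm, ← hβ, ← ψ.map_smulₛₗ, ← ψ.map_smulₛₗ]
    apply key
    rw [φ.map_smulₛₗ, φ.map_smulₛₗ, hk, hm, smul_comm]
  refine ⟨⟨⟨β, fun x y => ?_⟩, fun r x => ?_⟩, fun k => ?_⟩
  · have hst := T.mul_mem (hs x) (hs y)
    refine unit_smul_inj (S := S) hst ?_
    rw [← char (x + y) _ hst (s y • m x + s x • m y)]
    · rw [map_add, ψ.map_smulₛₗ, ψ.map_smulₛₗ, hβ, hβ, map_mul, smul_add, mul_smul, mul_smul,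
        smul_comm (algebraMap R S (s y))]
    · rw [map_add, φ.map_smulₛₗ, φ.map_smulₛₗ, hm, hm, map_mul, smul_add, mul_smul, mul_smul,
        smul_comm (algebraMap R S (s y))]
  · obtain ⟨⟨a, t⟩, hat⟩ := IsLocalization.surj T r
    have hst := T.mul_mem t.2 (hs x)
    simp only [RingHom.id_apply]
    refine unit_smul_inj (S := S) hst ?_
    rw [← char (r • x) _ hst (a • m x)]
    · rw [ψ.map_smulₛₗ, hβ, ← hat, map_mul]
      simp only [← mul_smul]
      congr 1; ring
    · rw [φ.map_smulₛₗ, hm, ← hat, map_mul]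
      simp only [← mul_smul]
      congr 1; ring
  · have := char (φ k) 1 T.one_mem k (by simp)
    simpa using this.symm

lemma IsLoc.map [IsLocalization T S] {φ : M →ₛₗ[algebraMap R S] N} (h : IsLoc T φ)
    (ψ : M₁ →ₛₗ[algebraMap R S] N₁) (a : M →ₗ[R] M₁) : ∃ β : N →ₗ[S] N₁, ∀ m, β (φ m) = ψ (a m) :=
  h.desc (ψ.comp a)

lemma IsLoc.finite {φ : M →ₛₗ[algebraMap R S] N} [IsLocalization T S] (h : IsLoc T φ) [Module.Finite R M] :
    Module.Finite S N := by
  obtain ⟨n, g, hg⟩ := Module.Finite.exists_fin' R M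
  obtain ⟨β, hβ⟩ := (isLoc_pi (T := T) (S := S) n).map φ g
  refine Module.Finite.of_surjective β fun x => ?_
  obtain ⟨s, hs, m, hm⟩ := h.1 x
  obtain ⟨v, rfl⟩ := hg m
  obtain ⟨w, hw⟩ := unit_smul_surj (S := S) hs (piLoc (R := R) (S := S) n v)
  refine ⟨w, unit_smul_inj (S := S) hs ?_⟩
  rw [← map_smul, hw, hβ, hm]

/-- localization is exact -/
lemma IsLoc.ses [IsLocalization T S] {A₀ B₀ C₀ : Type u} [AddCommGroup A₀] [Module R A₀] [AddCommGroup B₀]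
    [Module R B₀] [AddCommGroup C₀] [Module R C₀] {f : A₀ →ₗ[R] B₀} {g : B₀ →ₗ[R] C₀} (s : IsSES f g)
    {φA : A₀ →ₛₗ[algebraMap R S] A} {φB : B₀ →ₛₗ[algebraMap R S] B} {φC : C₀ →ₛₗ[algebraMap R S] C}
    (hA : IsLoc T φA) (hB : IsLoc T φB) (hC : IsLoc T φC) :
    ∃ (f' : A →ₗ[S] B) (g' : B →ₗ[S] C), IsSES f' g' ∧ (∀ a, f' (φA a) = φB (f a)) ∧ ∀ b, g' (φB b) = φC (g b) := by
  obtain ⟨f', hf⟩ := hA.map φB f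
  obtain ⟨g', hg⟩ := hB.map φC g
  refine ⟨f', g', IsSES.mk' ?_ ?_ ?_ ?_, hf, hg⟩
  · intro x hx
    obtain ⟨t, ht, m, hm⟩ := hA.1 x
    have h1 : φB (f m) = 0 := by rw [← hf, hm, map_smul, hx, smul_zero]
    obtain ⟨t', ht', h0⟩ := hB.2 _ h1
    rw [← map_smul] at h0
    have h2 : t' • m = 0 := s.1 (by rw [h0, map_zero])
    refine unit_smul_inj (S := S) ht (unit_smul_inj (S := S) ht' ?_)
    rw [← hm, ← φA.map_smulₛₗ, h2]; simp
  · intro x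
    obtain ⟨t, ht, m, hm⟩ := hC.1 x
    obtain ⟨b, rfl⟩ := s.2.1 m
    obtain ⟨w, hw⟩ := unit_smul_surj (S := S) ht (φB b)
    refine ⟨w, unit_smul_inj (S := S) ht ?_⟩
    rw [← map_smul, hw, hg, hm]
  · intro x
    obtain ⟨t, ht, m, hm⟩ := hA.1 x
    refine unit_smul_inj (S := S) ht ?_
    rw [← map_smul, ← map_smul, ← hm, hf, hg, s.zero]; simp
  · intro x hx
    obtain ⟨t, ht, m, hm⟩ := hB.1 x
    have h1 : φC (g m) = 0 := by rw [← hg, hm, map_smul, hx, smul_zero]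
    obtain ⟨t', ht', h0⟩ := hC.2 _ h1
    rw [← map_smul] at h0
    obtain ⟨a, ha⟩ := s.ex h0
    obtain ⟨w, hw⟩ := unit_smul_surj (S := S) ht' (φA a)
    obtain ⟨w', hw'⟩ := unit_smul_surj (S := S) ht w
    refine ⟨w', unit_smul_inj (S := S) ht (unit_smul_inj (S := S) ht' ?_)⟩
    rw [← map_smul, ← map_smul, hw', hw, hf, ha, φB.map_smulₛₗ, hm]

variable [IsLocalization T S] [IsLocalRing S]

lemma syz1_Yp (hr : IsResolving R 𝒳) (hst : locT 𝒳 T ⊆ 𝒳) : Syz1 (Yp S 𝒳 T) = Yp S (Syz1 𝒳) T := by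
  apply Set.Subset.antisymm
  · intro N hN
    obtain ⟨n, g, hg, hK⟩ := (in_Syz1 (M := N)).1 hN
    haveI : Module.Finite S N := Module.Finite.of_surjective g hg
    obtain ⟨φ, hφ⟩ := lattice_left (isSES_ker g hg) (isLoc_pi (T := T) (R := R) n)
    obtain ⟨ψ, hψ⟩ := lattice_right (isSES_ker g hg) (isLoc_pi (T := T) (R := R) n)
    have h1 := hst (locT_of_Yp hφ hK)
    have h2 : In 𝒳 (Fin n → R) := hr.proj
    exact in_Yp_mk hψ (subset_locT hr.syz1 T (hr.coker_mem (isSES_mkQ _) h1 h2))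
  · intro N hN
    obtain ⟨hf, M, φ, h, hM⟩ := hN
    obtain ⟨n, g, hg, hK⟩ := in_Syz1.1 (locT_Syz1 hr T hM)
    haveI : Module.Finite R M := (in_locT.1 hM).1
    obtain ⟨γ, hγ⟩ := (isLoc_pi (T := T) (S := S) n).map φ g
    have hγs : Function.Surjective γ := by
      intro x
      obtain ⟨s, hs, m, hm⟩ := h.1 x
      obtain ⟨v, rfl⟩ := hg m
      obtain ⟨w, hw⟩ := unit_smul_surj (S := S) hs (piLoc (R := R) (S := S) n v)
      refine ⟨w, unit_smul_inj (S := S) hs ?_⟩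
      rw [← map_smul, hw, hγ, hm]
    refine in_Syz1.2 ⟨n, γ, hγs, ?_⟩
    obtain ⟨ψ, hψ⟩ := lattice_left (isSES_ker γ hγs) (isLoc_pi (T := T) (R := R) n)
    obtain ⟨χ, hχ⟩ := lattice_right (isSES_ker γ hγs) (isLoc_pi (T := T) (R := R) n)
    haveI : IsNoetherianRing S := IsLocalization.isNoetherianRing T S inferInstance
    refine in_Yp_mk hψ ?_
    have h1 : In (Syz1 (locT 𝒳 T)) ((Fin n → R) ⧸ LinearMap.ker (γ.comp (piLoc (R := R) (S := S) n) :
        (Fin n → R) →ₛₗ[algebraMap R S] N)) := by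
      have hM' : In (locT (Syz1 𝒳) T) M := hM
      exact locT_Syz1 hr T (locT_retract hχ h LinearMap.id LinearMap.id (fun _ => rfl) hM')
    exact (hr.locT T).syz1_ker (isSES_mkQ _) h1

lemma Yp_locT (hr : IsResolving R 𝒳) : Yp S (locT 𝒳 T) T = Yp S 𝒳 T := by
  apply Set.Subset.antisymm
  · rintro N ⟨hf, M, φ, h, hM⟩
    exact ⟨hf, M, φ, h, locT_locT hM⟩
  · rintro N ⟨hf, M, φ, h, hM⟩
    exact ⟨hf, M, φ, h, locT_mono' (subset_locT hr T) hM⟩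

lemma syzN_stable (hr : IsResolving R 𝒳) (hst : locT 𝒳 T ⊆ 𝒳) (n : ℕ) : locT (SyzN n 𝒳) T ⊆ SyzN n 𝒳 :=
  fun _ h => SyzN_mono n hst (locT_SyzN hr T n h)

lemma syzN_Yp (hr : IsResolving R 𝒳) (hst : locT 𝒳 T ⊆ 𝒳) (n : ℕ) : SyzN n (Yp S 𝒳 T) = Yp S (SyzN n 𝒳) T := by
  induction n with
  | zero => rfl
  | succ n ih =>
    show Syz1 (SyzN n _) = Yp S (Syz1 (SyzN n 𝒳)) T
    rw [ih]
    exact syz1_Yp (hr.syzN n) (syzN_stable hr hst n)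

lemma Yp_PJ : Yp S (PJ R) T = PJ S := by
  apply Set.Subset.antisymm
  · rintro N ⟨hf, M, φ, h, hM⟩
    refine in_PJ.2 ⟨hf, ?_⟩
    obtain ⟨hfM, s, hs, P, hP, α, β, hαβ⟩ := hM
    obtain ⟨hPf, hPp⟩ := (in_PJ (M := P)).1 hP
    obtain ⟨n, g, hg⟩ := Module.Finite.exists_fin' R P
    obtain ⟨j, hj⟩ := Module.projective_lifting_property g LinearMap.id hg
    obtain ⟨a, ha⟩ := h.map (piLoc (R := R) (S := S) n) (j ∘ₗ α)
    obtain ⟨b, hb⟩ := (isLoc_pi (T := T) (S := S) n).map φ (β ∘ₗ g)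
    have hba : ∀ x, b (a x) = algebraMap R S s • x := by
      intro x
      obtain ⟨t, ht, m, hm⟩ := h.1 x
      refine unit_smul_inj (S := S) ht ?_
      rw [← map_smul, ← map_smul, ← hm, ha, hb, smul_comm, ← hm, ← φ.map_smulₛₗ, ← hαβ]
      have := LinearMap.congr_fun hj (α m)
      simp only [LinearMap.comp_apply, LinearMap.id_apply] at this ⊢
      rw [this]
    obtain ⟨u, hu⟩ : IsUnit (algebraMap R S s) := IsLocalization.map_units S ⟨s, hs⟩
    refine Module.Projective.of_split a ((↑u⁻¹ : S) • b) ?_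
    ext x
    simp only [LinearMap.comp_apply, LinearMap.smul_apply, LinearMap.id_apply, hba, ← hu]
    rw [smul_smul, Units.inv_mul, one_smul]
  · exact PJ_subset (IsResolving.Yp PJ_resolving)

/-- finite projective dimension of the localization. -/
lemma syzN_PJ_loc [Module.Finite R M] {φ : M →ₛₗ[algebraMap R S] N} (h : IsLoc T φ) (n : ℕ) :
    In (SyzN n (PJ S)) N ↔ In (SyzN n (locT (PJ R) T)) M := by
  have hr : IsResolving R (locT (PJ R) T) := IsResolving.locT PJ_resolving T
  have hst : locT (locT (PJ R) T) T ⊆ locT (PJ R) T := fun _ h => locT_locT h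
  rw [← Yp_PJ (R := R) (T := T), ← Yp_locT PJ_resolving, syzN_Yp hr hst]
  constructor
  · intro hN
    exact syzN_stable hr hst n (locT_of_Yp h hN)
  · intro hM
    haveI : Module.Finite S N := h.finite
    exact in_Yp_mk h (subset_locT (hr.syzN n) T hM)

end PartNine

section PartNineB
open RingTheory.Sequence IsLocalRing

variable {R : Type u} [CommRing R]
variable {M M₁ : Type u} [AddCommGroup M] [Module R M] [AddCommGroup M₁] [Module R M₁]
variable {𝒳 𝒴 : Set (ModuleCat.{u} R)}

/-- the canonical localization map. -/
noncomputable def locMap (T : Submonoid R) (M : Type u) [AddCommGroup M] [Module R M] :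
    M →ₛₗ[algebraMap R (Localization T)] LocalizedModule T M where
  toFun := LocalizedModule.mkLinearMap T M
  map_add' := map_add _
  map_smul' r m := by
    rw [map_smul, algebraMap_smul]

lemma isLoc_locMap (T : Submonoid R) (M : Type u) [AddCommGroup M] [Module R M] : IsLoc T (locMap T M) := by
  constructor
  · intro x
    obtain ⟨⟨m, s⟩, h⟩ := IsLocalizedModule.surj T (LocalizedModule.mkLinearMap T M) x
    refine ⟨s, s.2, m, ?_⟩
    rw [algebraMap_smul]
    exact h.symm
  · intro m hm
    obtain ⟨s, hs⟩ := IsLocalizedModule.exists_of_eq (S := T) (f := LocalizedModule.mkLinearMap T M)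
      (x₁ := m) (x₂ := 0) (by rw [map_zero]; exact hm)
    exact ⟨s, s.2, hs.trans (smul_zero _)⟩

variable [IsNoetherianRing R]

/-- if `M` is, around every `s ∈ p`, in `𝒳`, the localization is in `circ`. -/
lemma circ_Yp (p : Ideal R) [p.IsPrime] (hr : IsResolving R 𝒳) [Module.Finite R M]
    (h : ∀ s ∈ p, ∃ u ∉ p, ∃ n : ℕ, Fac 𝒳 M (u * s ^ n)) :
    In (circ (maximalIdeal (Localization.AtPrime p)) (Yp (Localization.AtPrime p) 𝒳 p.primeCompl))
      (LocalizedModule p.primeCompl M) := by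
  have hM := isLoc_locMap p.primeCompl M
  refine ⟨hM.finite, fun σ hσ => ?_⟩
  refine in_locT.2 ⟨hM.finite, ?_⟩
  obtain ⟨⟨s, v⟩, hsv⟩ := IsLocalization.surj p.primeCompl σ
  have hs : s ∈ p := by
    rw [← IsLocalization.AtPrime.to_map_mem_maximal_iff (Localization.AtPrime p) p s, ← hsv]
    exact Ideal.mul_mem_right _ _ hσ
  obtain ⟨u, hu, n, X, hX, α, β, hαβ⟩ := h s hs
  have hXl := isLoc_locMap p.primeCompl X
  haveI : Module.Finite R X := hr.fg X hX
  obtain ⟨a, ha⟩ := hM.map (locMap p.primeCompl X) α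
  obtain ⟨b, hb⟩ := hXl.map (locMap p.primeCompl M) β
  haveI := hXl.finite
  have hF : Fac (Yp (Localization.AtPrime p) 𝒳 p.primeCompl) (LocalizedModule p.primeCompl M)
      (algebraMap R (Localization.AtPrime p) (u * s ^ n)) := by
    refine Fac.mk (in_Yp_mk hXl (subset_locT hr _ hX)) a b fun x => ?_
    obtain ⟨t, ht, m, hm⟩ := hM.1 x
    refine unit_smul_inj (S := Localization.AtPrime p) ht ?_
    rw [← map_smul, ← map_smul, ← hm, ha, hb, smul_comm, ← hm, ← (locMap p.primeCompl M).map_smulₛₗ, ← hαβ]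
  obtain ⟨w, hw⟩ : IsUnit (algebraMap R (Localization.AtPrime p) u) := IsLocalization.map_units _ (⟨u, hu⟩ : p.primeCompl)
  obtain ⟨z, hz⟩ : IsUnit (algebraMap R (Localization.AtPrime p) v) := IsLocalization.map_units _ v
  refine ⟨σ ^ n, ⟨n, rfl⟩, ?_⟩
  have := hF.mul (↑w⁻¹ * ↑(z⁻¹) ^ n)
  convert this using 1
  rw [map_mul, map_pow, ← hsv, ← hw, ← hz, mul_pow]
  calc σ ^ n = (↑w⁻¹ * ↑w) * σ ^ n * (↑z⁻¹ * ↑z) ^ n := by simp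
    _ = _ := by ring

end PartNineB

end Chunk9

section Chunk10
open scoped Pointwise
set_option linter.unusedSectionVars false
set_option linter.style.haveILetI false
section PartTen

open RingTheory.Sequence IsLocalRing

variable {R : Type u} [CommRing R] [IsNoetherianRing R]
variable {M M₁ : Type u} [AddCommGroup M] [Module R M] [AddCommGroup M₁] [Module R M₁]
variable {𝒳 𝒴 : Set (ModuleCat.{u} R)}

lemma mem_locT_of_fac (hr : IsResolving R 𝒳) {p : Ideal R} [p.IsPrime] (h : In (locT 𝒳 p.primeCompl) M) :
    ¬ facIdeal hr M ≤ p := by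
  obtain ⟨_, s, hs, hF⟩ := in_locT.1 h
  exact fun hle => hs (hle (mem_facIdeal.2 hF))

theorem global_main (hr : IsResolving R 𝒳) [Module.Finite R M]
    (H : ∀ (p : Ideal R) [p.IsPrime], ∃ xs t n, HData (Localization.AtPrime p) xs t n)
    (hd : ∀ (p : Ideal R) [p.IsPrime], ∃ X : ModuleCat.{u} R, X ∈ 𝒳 ∧ ∀ j,
      dGE (Localization.AtPrime p) j (LocalizedModule p.primeCompl X) →
      dGE (Localization.AtPrime p) j (LocalizedModule p.primeCompl M))
    (hinf : ∀ (p : Ideal R) [p.IsPrime],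
      (∀ i, ¬ In (SyzN i (PJ (Localization.AtPrime p))) (LocalizedModule p.primeCompl M)) →
      ∃ X : ModuleCat.{u} R, X ∈ 𝒳 ∧ ∀ i, ¬ In (SyzN i (PJ (Localization.AtPrime p))) (LocalizedModule p.primeCompl X)) :
    In 𝒳 M := by
  have key : ∀ (h : ℕ∞) (p : Ideal R) [p.IsPrime], p.height = h → In (locT 𝒳 p.primeCompl) M := by
    intro h
    induction h using (wellFounded_lt : WellFounded ((· < ·) : ℕ∞ → ℕ∞ → Prop)).induction with
    | _ h ih =>
    intro p hp hh
    obtain ⟨xs, t, n, HD⟩ := H p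
    obtain ⟨X, hX, hXM⟩ := hd p
    have hXl := isLoc_locMap p.primeCompl X
    haveI : Module.Finite R X := hr.fg X hX
    haveI := hXl.finite
    have hYr : IsResolving (Localization.AtPrime p) (Yp (Localization.AtPrime p) 𝒳 p.primeCompl) := hr.Yp
    refine locT_of_Yp (isLoc_locMap p.primeCompl M) (local_main HD hYr
      (in_Yp_mk hXl (subset_locT hr _ hX)) hXM (circ_Yp p hr fun s hs => ?_) fun hi => ?_)
    · by_contra hcon
      push Not at hcon
      let U : Submonoid R := p.primeCompl ⊔ Submonoid.powers s
      have hdis : Disjoint (facIdeal hr M : Set R) (U : Set R) := by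
        rw [Set.disjoint_left]
        intro x hx hxU
        obtain ⟨u, hu, y, ⟨k, rfl⟩, rfl⟩ := Submonoid.mem_sup.1 hxU
        exact hcon u hu k (mem_facIdeal.1 hx)
      obtain ⟨q, hq, hle, hqd⟩ := Ideal.exists_le_prime_disjoint _ U hdis
      have hqp : q < p := by
        refine lt_of_le_of_ne (fun x hx => ?_) ?_
        · by_contra hxp
          exact Set.disjoint_left.1 hqd hx (Submonoid.mem_sup_left hxp)
        · rintro rfl
          exact Set.disjoint_left.1 hqd hs (Submonoid.mem_sup_right (Submonoid.mem_powers s))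
      have hlt : q.height < h := by
        rw [← hh]
        exact Ideal.height_strict_mono_of_isPrime_of_isPrime hqp
      exact mem_locT_of_fac hr (ih _ hlt q rfl) hle
    · obtain ⟨X', hX', hi'⟩ := hinf p hi
      have hXl' := isLoc_locMap p.primeCompl X'
      haveI : Module.Finite R X' := hr.fg X' hX'
      haveI := hXl'.finite
      exact ⟨ModuleCat.of _ (LocalizedModule p.primeCompl X'), in_Yp_mk hXl' (subset_locT hr _ hX'), hi'⟩
  have htop : facIdeal hr M = ⊤ := by
    by_contra hne
    obtain ⟨m, hm, hle⟩ := Ideal.exists_le_maximal _ hne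
    haveI := hm.isPrime
    exact mem_locT_of_fac hr (key _ m rfl) hle
  exact Fac.one_mem hr (mem_facIdeal.1 (htop ▸ Submodule.mem_top : (1 : R) ∈ facIdeal hr M))

/-- local-global for membership -/
lemma in_of_locT (hr : IsResolving R 𝒳) [Module.Finite R M]
    (key : ∀ (p : Ideal R) [p.IsPrime], In (locT 𝒳 p.primeCompl) M) : In 𝒳 M := by
  have htop : facIdeal hr M = ⊤ := by
    by_contra hne
    obtain ⟨m, hm, hle⟩ := Ideal.exists_le_maximal _ hne
    haveI := hm.isPrime
    exact mem_locT_of_fac hr (key m) hle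
  exact Fac.one_mem hr (mem_facIdeal.1 (htop ▸ Submodule.mem_top : (1 : R) ∈ facIdeal hr M))

lemma pdLE_iff (n : ℕ) : ∀ (M : ModuleCat.{u} R), Module.Finite R M → (pdLE R n M ↔ M ∈ SyzN n (PJ R)) := by
  induction n with
  | zero =>
    intro M hM
    exact ⟨fun h => in_PJ.2 ⟨hM, h⟩, fun h => (in_PJ.1 h).2⟩
  | succ n ih =>
    intro M hM
    constructor
    · rintro ⟨K, P, f, g, hP, hPp, s, hK⟩
      have hKf : Module.Finite R K := s.finite_left hP
      have h1 := (ih K hKf).1 hK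
      exact (PJ_resolving.syzN n).coker_mem s h1 ((PJ_resolving.syzN n).proj (M := P))
    · intro h
      obtain ⟨k, g, hg, hK⟩ := (in_Syz1 (M := M)).1 h
      refine ⟨ModuleCat.of R (LinearMap.ker g), ModuleCat.of R (Fin k → R), (LinearMap.ker g).subtype, g,
        inferInstanceAs (Module.Finite R (_ → R)), inferInstanceAs (Module.Projective R (_ → R)), isSES_ker g hg, ?_⟩
      exact (ih _ ((isSES_ker g hg).finite_left inferInstance)).2 hK

lemma pdim_eq_top_iff (M : ModuleCat.{u} R) (hM : Module.Finite R M) :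
    pdim R M = ⊤ ↔ ∀ n, ¬ M ∈ SyzN n (PJ R) := by
  unfold pdim
  rw [sInf_eq_top]
  constructor
  · intro h n hn
    have := h ((n : ℕ∞) : WithBot ℕ∞) (Or.inr ⟨n, rfl, (pdLE_iff n M hM).2 hn⟩)
    exact absurd this (by
      intro h
      have h2 : ((n : ℕ∞) : WithBot ℕ∞) = ((⊤ : ℕ∞) : WithBot ℕ∞) := h
      rw [WithBot.coe_inj] at h2
      exact ENat.natCast_ne_top n h2)
  · rintro h x (⟨rfl, hs⟩ | ⟨n, rfl, hn⟩)
    · exact absurd (PJ_resolving.of_subsingleton (M := M)) (h 0)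
    · exact absurd ((pdLE_iff n M hM).1 hn) (h n)

lemma mem_IPD_iff (M : ModuleCat.{u} R) [Module.Finite R M] (p : PrimeSpectrum R) :
    p ∈ IPD R M ↔ ∀ n, ¬ In (SyzN n (PJ (Localization.AtPrime p.asIdeal))) (LocalizedModule p.asIdeal.primeCompl M) :=
  pdim_eq_top_iff _ (isLoc_locMap p.asIdeal.primeCompl M).finite

lemma mem_IPD_iff' (M : ModuleCat.{u} R) [Module.Finite R M] (p : PrimeSpectrum R) :
    p ∈ IPD R M ↔ ∀ n, ¬ M ∈ SyzN n (locT (PJ R) p.asIdeal.primeCompl) := by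
  rw [mem_IPD_iff]
  exact forall_congr' fun n => not_congr (syzN_PJ_loc (isLoc_locMap p.asIdeal.primeCompl M) n)

lemma IPD_specClosed (M : ModuleCat.{u} R) [Module.Finite R M] : SpecClosed R (IPD R M) := by
  intro p hp q hpq
  rw [mem_IPD_iff'] at hp ⊢
  intro n hn
  have hle : q.asIdeal.primeCompl ≤ p.asIdeal.primeCompl := fun x hx hxp => hx (hpq hxp)
  exact hp n (SyzN_mono n (locT_mono hle) hn)

lemma IPDcat_specClosed (hr : IsResolving R 𝒳) : SpecClosed R (IPDcat R 𝒳) := by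
  intro p hp q hpq
  simp only [IPDcat, Set.mem_iUnion] at hp ⊢
  obtain ⟨M, hM, hp⟩ := hp
  haveI := hr.fg M hM
  exact ⟨M, hM, IPD_specClosed M p hp q hpq⟩

end PartTen

end Chunk10

section Chunk11
open scoped Pointwise
set_option linter.unusedSectionVars false
set_option linter.style.haveILetI false
section PartEleven

open RingTheory.Sequence IsLocalRing

variable {S : Type u} [CommRing S]

lemma prime_avoid {s : Set (Ideal S)} (hs : s.Finite) (hp : ∀ P ∈ s, P.IsPrime) {I J : Ideal S}
    (hJ : ¬ I ≤ J) (h : ∀ P ∈ s, ¬ I ≤ P) : ∃ x ∈ I, x ∉ J ∧ ∀ P ∈ s, x ∉ P := by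
  by_contra hc
  push Not at hc
  have h1 : (I : Set S) ⊆ ⋃ P ∈ insert J s, ((id P : Ideal S) : Set S) := by
    intro x hx
    by_cases hxJ : x ∈ J
    · exact Set.mem_biUnion (Set.mem_insert _ _) hxJ
    · obtain ⟨P, hP, hxP⟩ := hc x hx hxJ
      exact Set.mem_biUnion (Set.mem_insert_of_mem _ hP) hxP
  obtain ⟨P, hP, hle⟩ := (Ideal.subset_union_prime_finite (hs.insert J) J J (f := id) (by
    intro P hP hne _
    exact hp P ((Set.mem_insert_iff.1 hP).resolve_left hne))).1 h1
  rcases Set.mem_insert_iff.1 hP with rfl | hP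
  · exact hJ hle
  · exact h P hP hle

lemma isWeaklyRegular_quot {x : S} {l : List S} : IsWeaklyRegular S (x :: l) ↔
    IsSMulRegular S x ∧ IsWeaklyRegular (S ⧸ Ideal.span {x}) (l.map (Ideal.Quotient.mk (Ideal.span {x}))) := by
  have e : (QuotSMulTop x S) ≃ₗ[S] (S ⧸ Ideal.span {x}) :=
    Submodule.quotEquivOfEq _ _ (by simp [← Submodule.ideal_span_singleton_smul])
  rw [isWeaklyRegular_cons_iff, e.isWeaklyRegular_congr]
  exact and_congr_right' (isWeaklyRegular_map_algebraMap_iff (S ⧸ Ideal.span {x}) _ l).symm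

lemma exists_lift_list (I : Ideal S) (xs : List (S ⧸ I)) : ∃ l : List S, l.map (Ideal.Quotient.mk I) = xs := by
  have := List.map_surjective_iff.2 (Ideal.Quotient.mk_surjective (I := I))
  exact this xs

lemma comap_ofList {x : S} (l : List S) :
    (Ideal.ofList (l.map (Ideal.Quotient.mk (Ideal.span {x})))).comap (Ideal.Quotient.mk (Ideal.span {x}))
      = Ideal.ofList (x :: l) := by
  rw [← Ideal.map_ofList, Ideal.comap_map_of_surjective _ Ideal.Quotient.mk_surjective, ← RingHom.ker_eq_comap_bot,
    Ideal.mk_ker, Ideal.ofList_cons, sup_comm]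

variable [IsLocalRing S]

lemma quot_local {x : S} (hx : x ∈ maximalIdeal S) : IsLocalRing (S ⧸ Ideal.span {x}) := by
  have : Nontrivial (S ⧸ Ideal.span {x}) := Ideal.Quotient.nontrivial_iff.2
    (fun h => (Ideal.ne_top_iff_exists_maximal.2 ⟨maximalIdeal S, inferInstance, (Ideal.span_singleton_le_iff_mem _).2 hx⟩) h)
  exact IsLocalRing.of_surjective' _ Ideal.Quotient.mk_surjective

lemma comap_max {x : S} [IsLocalRing (S ⧸ Ideal.span {x})] :
    (maximalIdeal (S ⧸ Ideal.span {x})).comap (Ideal.Quotient.mk (Ideal.span {x})) = maximalIdeal S := by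
  have : IsLocalHom (Ideal.Quotient.mk (Ideal.span {x})) :=
    IsLocalHom.of_surjective _ Ideal.Quotient.mk_surjective
  exact IsLocalRing.maximalIdeal_comap _

lemma map_max {x : S} [IsLocalRing (S ⧸ Ideal.span {x})] :
    maximalIdeal (S ⧸ Ideal.span {x}) = (maximalIdeal S).map (Ideal.Quotient.mk (Ideal.span {x})) := by
  rw [← comap_max (x := x), Ideal.map_comap_of_surjective _ Ideal.Quotient.mk_surjective]

lemma exchange {d : ℕ} {v : Fin (d+1) → S} (hv : maximalIdeal S = Ideal.span (Set.range v)) {x : S}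
    (hx : x ∈ maximalIdeal S) (hx2 : x ∉ maximalIdeal S ^ 2) :
    ∃ w : Fin d → S, maximalIdeal S = Ideal.span {x} ⊔ Ideal.span (Set.range w) := by
  have h1 := hx
  rw [hv] at h1
  obtain ⟨c, hc⟩ := (Submodule.mem_span_range_iff_exists_fun S).1 h1
  have hvm : ∀ i, v i ∈ maximalIdeal S := fun i => hv ▸ Ideal.subset_span ⟨i, rfl⟩
  obtain ⟨i, hi⟩ : ∃ i, c i ∉ maximalIdeal S := by
    by_contra hcon
    push Not at hcon
    apply hx2
    rw [← hc, pow_two]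
    exact Ideal.sum_mem _ fun i _ => Ideal.mul_mem_mul (hcon i) (hvm i)
  have hu : IsUnit (c i) := by simpa [mem_maximalIdeal] using hi
  refine ⟨v ∘ i.succAbove, le_antisymm ?_ ?_⟩
  · rw [hv, Ideal.span_le]
    have hsub : ∀ j, j ≠ i → v j ∈ Ideal.span {x} ⊔ Ideal.span (Set.range (v ∘ i.succAbove)) := by
      intro j hj
      obtain ⟨k, rfl⟩ := Fin.exists_succAbove_eq hj
      exact Ideal.mem_sup_right (Ideal.subset_span ⟨k, rfl⟩)
    rintro _ ⟨j, rfl⟩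
    by_cases hj : j = i
    · subst hj
      rw [SetLike.mem_coe, ← Ideal.unit_mul_mem_iff_mem _ hu]
      rw [Fin.sum_univ_succAbove _ j] at hc
      have : c j * v j = x - ∑ k, c (j.succAbove k) • v (j.succAbove k) := by
        rw [← hc]; simp [smul_eq_mul]
      rw [this]
      refine Ideal.sub_mem _ (Ideal.mem_sup_left (Ideal.mem_span_singleton_self x)) (Ideal.sum_mem _ fun k _ => ?_)
      exact Ideal.mul_mem_left _ _ (hsub _ (Fin.succAbove_ne _ _))
    · exact hsub j hj
  · refine sup_le ((Ideal.span_singleton_le_iff_mem _).2 hx) (Ideal.span_le.2 ?_)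
    rintro _ ⟨j, rfl⟩
    exact hvm _

lemma exchange_quot {d : ℕ} {v : Fin (d+1) → S} (hv : maximalIdeal S = Ideal.span (Set.range v)) {x : S}
    (hx : x ∈ maximalIdeal S) (hx2 : x ∉ maximalIdeal S ^ 2) [IsLocalRing (S ⧸ Ideal.span {x})] :
    ∃ w : Fin d → S ⧸ Ideal.span {x}, maximalIdeal (S ⧸ Ideal.span {x}) = Ideal.span (Set.range w) := by
  obtain ⟨w, hw⟩ := exchange hv hx hx2
  refine ⟨Ideal.Quotient.mk _ ∘ w, ?_⟩
  rw [map_max, hw, Ideal.map_sup, Set.range_comp, ← Ideal.map_span (Ideal.Quotient.mk (Ideal.span {x})) (Set.range w)]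
  rw [sup_eq_right]
  simp

theorem reg_main (d : ℕ) : ∀ (S : Type u) [CommRing S] [IsLocalRing S] [IsNoetherianRing S] (v : Fin d → S),
    maximalIdeal S = Ideal.span (Set.range v) → (d : WithBot ℕ∞) ≤ ringKrullDim S →
    IsDomain S ∧ ∃ xs : List S, xs.length = d ∧ IsWeaklyRegular S xs ∧ maximalIdeal S = Ideal.ofList xs := by
  induction d with
  | zero =>
    intro S _ _ _ v hv _
    have hm : maximalIdeal S = ⊥ := by rw [hv]; simp
    have : IsField S := by
      rw [IsLocalRing.isField_iff_maximalIdeal_eq]; exact hm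
    exact ⟨this.isDomain, [], rfl, IsWeaklyRegular.nil _ _, by simpa using hm⟩
  | succ d ih =>
    intro S _ _ _ v hv hd
    have hnm : maximalIdeal S ∉ minimalPrimes S := by
      intro h
      have h0 := Ideal.height_eq_zero_iff.2 h
      rw [← IsLocalRing.maximalIdeal_height_eq_ringKrullDim, h0] at hd
      have : ((d+1 : ℕ) : ℕ∞) ≤ 0 := by exact_mod_cast hd
      simp at this
    have hJ : ∀ P ∈ minimalPrimes S, ¬ maximalIdeal S ≤ P := by
      intro P hP hle
      have := hP.1.1
      have : P = maximalIdeal S := le_antisymm (IsLocalRing.le_maximalIdeal this.ne_top) hle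
      exact hnm (this ▸ hP)
    have h2 : ¬ maximalIdeal S ≤ maximalIdeal S ^ 2 := by
      intro hle
      rw [pow_two] at hle
      have hb : maximalIdeal S = ⊥ := Submodule.eq_bot_of_le_smul_of_le_jacobson_bot (maximalIdeal S) _ (IsNoetherian.noetherian _)
        hle (IsLocalRing.jacobson_eq_maximalIdeal _ bot_ne_top).ge
      obtain ⟨P, hP, -⟩ := Ideal.exists_minimalPrimes_le (I := (⊥ : Ideal S)) (J := maximalIdeal S) bot_le
      exact hJ P hP (hb ▸ bot_le)
    obtain ⟨x, hx, hx2, hxP⟩ := prime_avoid (minimalPrimes.finite_of_isNoetherianRing S) (fun P hP => hP.1.1) h2 hJ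
    haveI := quot_local hx
    obtain ⟨w, hw⟩ := exchange_quot hv hx hx2
    have hd' : (d : WithBot ℕ∞) ≤ ringKrullDim (S ⧸ Ideal.span {x}) := by
      have h1 := Ideal.height_le_ringKrullDim_quotient_add_one (p := maximalIdeal S) hx
      rw [IsLocalRing.maximalIdeal_height_eq_ringKrullDim] at h1
      have h3 := hd.trans h1
      rw [← IsLocalRing.maximalIdeal_height_eq_ringKrullDim] at h3 ⊢
      have h4 : ((d+1 : ℕ) : ℕ∞) ≤ (maximalIdeal (S ⧸ Ideal.span {x})).height + 1 := by exact_mod_cast h3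
      have h5 : ((d : ℕ) : ℕ∞) ≤ (maximalIdeal (S ⧸ Ideal.span {x})).height := by
        rw [Nat.cast_add, Nat.cast_one] at h4
        exact (ENat.add_le_add_iff_right (by simp)).1 h4
      exact_mod_cast h5
    obtain ⟨hdom, xs, hl, hreg, hm⟩ := ih _ w hw hd'
    have hpr : (Ideal.span {x}).IsPrime := (Ideal.Quotient.isDomain_iff_prime _).1 hdom
    obtain ⟨P, hP, hPx⟩ := Ideal.exists_minimalPrimes_le (I := (⊥ : Ideal S)) (J := Ideal.span {x}) bot_le
    have hxP := hxP P hP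
    have hPp := hP.1.1
    have hb : P = ⊥ := by
      refine Submodule.eq_bot_of_le_smul_of_le_jacobson_bot (maximalIdeal S) _ (IsNoetherian.noetherian _)
        ?_ (IsLocalRing.jacobson_eq_maximalIdeal _ bot_ne_top).ge
      intro y hy
      obtain ⟨a, rfl⟩ := Ideal.mem_span_singleton'.1 (hPx hy)
      have ha : a ∈ P := (hPp.mem_or_mem hy).resolve_right hxP
      rw [mul_comm]
      exact Ideal.mul_mem_mul hx ha
    subst hb
    have hD : IsDomain S := by
      haveI : NoZeroDivisors S := ⟨fun {a b} hab => by
        simpa using hPp.mem_or_mem (show a * b ∈ (⊥ : Ideal S) by simpa using hab)⟩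
      exact NoZeroDivisors.to_isDomain S
    refine ⟨hD, ?_⟩
    obtain ⟨l, rfl⟩ := exists_lift_list _ xs
    refine ⟨x :: l, by simpa using hl, isWeaklyRegular_quot.2 ⟨?_, hreg⟩, ?_⟩
    · intro a b hab
      exact mul_left_cancel₀ (by simpa using hxP) hab
    · rw [← comap_max (x := x), hm, comap_ofList]

end PartEleven

end Chunk11

section Chunk12
open scoped Pointwise
set_option linter.unusedSectionVars false
set_option linter.style.haveILetI false
section PartTwelve

open RingTheory.Sequence IsLocalRing

variable {S : Type u} [CommRing S]

section red
variable {x : S} {M N : Type u} [AddCommGroup M] [Module S M] [AddCommGroup N] [Module S N]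

/-- extension of scalars along `S → S / x` -/
def exq (x : S) [Module (S ⧸ Ideal.span {x}) M] [Module (S ⧸ Ideal.span {x}) N]
    [IsScalarTower S (S ⧸ Ideal.span {x}) M] [IsScalarTower S (S ⧸ Ideal.span {x}) N]
    (f : M →ₗ[S] N) : M →ₗ[S ⧸ Ideal.span {x}] N :=
  { f with
    map_smul' := by
      intro a m
      obtain ⟨a, rfl⟩ := Ideal.Quotient.mk_surjective a
      have h1 : ∀ m : M, (Ideal.Quotient.mk (Ideal.span {x}) a) • m = a • m := fun m =>
        algebraMap_smul (S ⧸ Ideal.span {x}) a m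
      have h2 : ∀ m : N, (Ideal.Quotient.mk (Ideal.span {x}) a) • m = a • m := fun m =>
        algebraMap_smul (S ⧸ Ideal.span {x}) a m
      simp only [RingHom.id_apply, AddHom.toFun_eq_coe, LinearMap.coe_toAddHom]
      rw [h1, h2, map_smul] }

lemma exq_apply (x : S) [Module (S ⧸ Ideal.span {x}) M] [Module (S ⧸ Ideal.span {x}) N]
    [IsScalarTower S (S ⧸ Ideal.span {x}) M] [IsScalarTower S (S ⧸ Ideal.span {x}) N]
    (f : M →ₗ[S] N) (m : M) : exq x f m = f m := rfl

def piq (x : S) (n : ℕ) : (Fin n → S) →ₗ[S] (Fin n → S ⧸ Ideal.span {x}) :=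
  LinearMap.pi fun i => (Submodule.mkQ (Ideal.span {x})).comp (LinearMap.proj i)

noncomputable def piqEquiv (x : S) (n : ℕ) : QuotSMulTop x (Fin n → S) ≃ₗ[S] (Fin n → S ⧸ Ideal.span {x}) :=
  LinearEquiv.ofBijective (Submodule.liftQ _ (piq x n) (by
    intro v hv
    obtain ⟨w, rfl⟩ := mem_smul_top.1 hv
    rw [LinearMap.mem_ker]
    funext i
    exact Ideal.Quotient.eq_zero_iff_mem.2 (Ideal.mem_span_singleton'.2 ⟨w i, mul_comm _ _⟩))) (by
    constructor
    · rw [injective_iff_map_eq_zero]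
      intro v hv
      obtain ⟨v, rfl⟩ := Submodule.mkQ_surjective _ v
      refine (Submodule.Quotient.mk_eq_zero _).2 (mem_smul_top.2 ?_)
      have : ∀ i, ∃ a, a * x = v i := fun i =>
        Ideal.mem_span_singleton'.1 (Ideal.Quotient.eq_zero_iff_mem.1 (congrFun hv i))
      choose a ha using this
      exact ⟨a, funext fun i => (mul_comm _ _).trans (ha i)⟩
    · intro w
      have : ∀ i, ∃ a, Ideal.Quotient.mk (Ideal.span {x}) a = w i := fun i => Ideal.Quotient.mk_surjective _
      choose a ha using this
      exact ⟨Submodule.Quotient.mk a, funext ha⟩)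

lemma IsSES.exq {A B C : Type u} [AddCommGroup A] [Module S A] [AddCommGroup B] [Module S B] [AddCommGroup C] [Module S C]
    [Module (S ⧸ Ideal.span {x}) A] [Module (S ⧸ Ideal.span {x}) B] [Module (S ⧸ Ideal.span {x}) C]
    [IsScalarTower S (S ⧸ Ideal.span {x}) A] [IsScalarTower S (S ⧸ Ideal.span {x}) B] [IsScalarTower S (S ⧸ Ideal.span {x}) C]
    {f : A →ₗ[S] B} {g : B →ₗ[S] C} (s : IsSES f g) : IsSES (ResolvPaper.exq x f) (ResolvPaper.exq x g) :=
  IsSES.mk' (fun _ ha => s.1 (ha.trans (map_zero f).symm)) (fun c => s.2.1 c) (fun a => s.zero a)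
    (fun _ hb => s.ex hb)

lemma PJ_pi (n : ℕ) : In (PJ (S ⧸ Ideal.span {x})) (QuotSMulTop x (Fin n → S)) := by
  let e : (Fin n → S ⧸ Ideal.span {x}) →ₗ[S ⧸ Ideal.span {x}] QuotSMulTop x (Fin n → S) :=
    exq x (piqEquiv x n).symm.toLinearMap
  have he : Function.Bijective e := (piqEquiv x n).symm.bijective
  let E := LinearEquiv.ofBijective e he
  exact in_PJ.2 ⟨Module.Finite.equiv E, Module.Projective.of_equiv E⟩

lemma red [IsNoetherianRing S] (hx : IsSMulRegular S x) (i : ℕ) : ∀ (N : Type u) [AddCommGroup N] [Module S N],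
    IsSMulRegular N x → In (SyzN i (PJ S)) N → In (SyzN i (PJ (S ⧸ Ideal.span {x}))) (QuotSMulTop x N) := by
  induction i with
  | zero =>
    intro N _ _ _ hN
    obtain ⟨hf, hp⟩ := in_PJ.1 hN
    obtain ⟨n, g, hg⟩ := exists_cover (R := S) N
    obtain ⟨σ, hσ⟩ := Module.projective_lifting_property g LinearMap.id hg
    refine (PJ_resolving).retract (exq x (QuotSMulTop.map x σ)) (exq x (QuotSMulTop.map x g)) ?_ (PJ_pi n)
    intro m
    obtain ⟨m, rfl⟩ := Submodule.mkQ_surjective _ m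
    show Submodule.Quotient.mk (g (σ m)) = Submodule.Quotient.mk m
    exact congrArg _ (LinearMap.congr_fun hσ m)
  | succ i ih =>
    intro N _ _ hN hS
    obtain ⟨n, g, hg, hK⟩ := (in_Syz1 (M := N)).1 hS
    have hreg : IsSMulRegular (LinearMap.ker g) x := by
      apply IsSMulRegular.submodule
      intro a b hab
      funext i
      exact hx (congrFun hab i)
    have s := ((isSES_ker g hg).quot hN).exq (x := x)
    exact (PJ_resolving.syzN i).coker_mem s (ih _ hreg hK) (PJ_subset (PJ_resolving.syzN i) (PJ_pi n))
end red

variable [IsLocalRing S]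

lemma dGE_quotI [IsNoetherianRing S] (I : Ideal S) [IsLocalRing (S ⧸ I)] {j : ℕ} (h : dGE S j (S ⧸ I)) :
    dGE (S ⧸ I) j (S ⧸ I) := by
  obtain ⟨rs, hl, hm, hr⟩ := (dGE_iff_exists j).1 h
  refine (dGE_iff_exists j).2 ⟨rs.map (algebraMap S (S ⧸ I)), by simpa using hl, ?_,
    (isWeaklyRegular_map_algebraMap_iff (S ⧸ I) _ rs).2 hr⟩
  intro r hr
  obtain ⟨a, ha, rfl⟩ := List.mem_map.1 hr
  have : IsLocalHom (Ideal.Quotient.mk I) := IsLocalHom.of_surjective _ Ideal.Quotient.mk_surjective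
  rw [mem_maximalIdeal, mem_nonunits_iff]
  intro hu
  exact (mem_maximalIdeal a).1 (hm a ha) (this.map_nonunit a hu)

lemma dGE_quot_ring [IsNoetherianRing S] {x : S} (hx : x ∈ maximalIdeal S) (hreg : IsSMulRegular S x)
    [IsLocalRing (S ⧸ Ideal.span {x})] {j : ℕ} (h : dGE S (j+1) S) :
    dGE (S ⧸ Ideal.span {x}) j (S ⧸ Ideal.span {x}) := by
  have e : (QuotSMulTop x S) ≃ₗ[S] (S ⧸ Ideal.span {x}) :=
    Submodule.quotEquivOfEq _ _ (by simp [← Submodule.ideal_span_singleton_smul])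
  exact dGE_quotI _ (dGE_equiv e ((dGE_quot_iff hx hreg j).1 h))

lemma proj_of_socle [IsNoetherianRing S] {y : S} (hy : y ≠ 0) (hs : ∀ a ∈ maximalIdeal S, a * y = 0) (i : ℕ) :
    ∀ (N : Type u) [AddCommGroup N] [Module S N], In (SyzN i (PJ S)) N → In (PJ S) N := by
  induction i with
  | zero => exact fun N _ _ h => h
  | succ i ih =>
    intro N _ _ h
    have hf := (PJ_resolving.syzN (i+1)).finite h
    obtain ⟨n, g, hg, hmin⟩ := min_cover (S := S) N
    have hK := ih _ ((PJ_resolving.syzN i).syz1_ker (isSES_ker g hg) h)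
    obtain ⟨h1, h2⟩ := in_PJ.1 hK
    have hfree : Module.Free S (LinearMap.ker g) := Module.free_of_flat_of_isLocalRing
    have hsub : Subsingleton (LinearMap.ker g) := by
      by_contra hns
      rw [not_subsingleton_iff_nontrivial] at hns
      let b := Module.Free.chooseBasis S (LinearMap.ker g)
      obtain ⟨k⟩ : Nonempty (Module.Free.ChooseBasisIndex S (LinearMap.ker g)) := b.index_nonempty
      have h0 : y • b k = 0 := by
        apply Subtype.ext
        funext j
        have := hs _ (hmin _ (b k).2 j)
        rw [mul_comm] at this
        exact this
      have h3 := congrArg (fun v => b.repr v k) h0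
      simp at h3
      exact hy h3
    have hinj : Function.Injective g := by
      rw [← LinearMap.ker_eq_bot]
      exact Submodule.subsingleton_iff_eq_bot.1 hsub
    exact PJ_resolving.equiv (LinearEquiv.ofBijective g ⟨hinj, hg⟩) PJ_resolving.proj

lemma max_eq_bot_of_proj (h : In (PJ S) (kk S)) : maximalIdeal S = ⊥ := by
  obtain ⟨h1, h2⟩ := in_PJ.1 h
  have hfree : Module.Free S (kk S) := Module.free_of_flat_of_isLocalRing
  rw [eq_bot_iff]
  intro a ha
  have : Nontrivial (kk S) := Ideal.Quotient.nontrivial_iff.2 (Ideal.IsPrime.ne_top inferInstance)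
  let b := Module.Free.chooseBasis S (kk S)
  obtain ⟨k⟩ : Nonempty (Module.Free.ChooseBasisIndex S (kk S)) := b.index_nonempty
  have h0 : a • b k = 0 := by
    obtain ⟨v, hv⟩ := Submodule.mkQ_surjective _ (b k)
    rw [← hv, ← map_smul]
    exact (Submodule.Quotient.mk_eq_zero _).2 (Ideal.mul_mem_right _ _ ha)
  have h3 := congrArg (fun v => b.repr v k) h0
  simpa using h3

lemma serre_red [IsNoetherianRing S] {x : S} (hx : x ∈ maximalIdeal S) (hx2 : x ∉ maximalIdeal S ^ 2) (hreg : IsSMulRegular S x)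
    [IsLocalRing (S ⧸ Ideal.span {x})] {i : ℕ} (h : In (SyzN i (PJ S)) (kk S)) :
    In (SyzN i (PJ (S ⧸ Ideal.span {x}))) (kk (S ⧸ Ideal.span {x})) := by
  have hm : In (SyzN i (PJ S)) (maximalIdeal S) :=
    (PJ_resolving.syzN i).syz (isSES_mkQ (maximalIdeal S)) h
  have hm' := red hreg i _ (IsSMulRegular.submodule _ _ hreg) hm
  -- the functional
  let V := (maximalIdeal S) ⧸ (maximalIdeal S • ⊤ : Submodule S (maximalIdeal S))
  let x' : maximalIdeal S := ⟨x, hx⟩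
  let ι : kk S →ₗ[S] V := Submodule.liftQ _ (LinearMap.toSpanSingleton S V (Submodule.Quotient.mk x')) (by
    intro a ha
    rw [LinearMap.mem_ker, LinearMap.toSpanSingleton_apply, ← Submodule.Quotient.mk_smul]
    exact (Submodule.Quotient.mk_eq_zero _).2 (Submodule.smul_mem_smul ha trivial))
  have hι : Function.Injective ι := by
    rw [injective_iff_map_eq_zero]
    intro v hv
    obtain ⟨a, rfl⟩ := Submodule.mkQ_surjective _ v
    by_contra hne
    have ha : IsUnit a := by
      by_contra hu
      exact hne ((Submodule.Quotient.mk_eq_zero _).2 ((mem_maximalIdeal a).2 hu))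
    have h1 : a • x' ∈ (maximalIdeal S • ⊤ : Submodule S (maximalIdeal S)) := (Submodule.Quotient.mk_eq_zero _).1 hv
    have h2 := Submodule.mem_map_of_mem (f := (maximalIdeal S).subtype) h1
    rw [Submodule.map_smul'', Submodule.map_top, Submodule.range_subtype] at h2
    apply hx2
    rw [pow_two, ← Ideal.unit_mul_mem_iff_mem _ ha]
    exact h2
  obtain ⟨ψ, hψ⟩ := inj_quot (J := maximalIdeal S) (t := 0) (n := 1) (Ideal.IsPrime.ne_top inferInstance) (by simp) (by simp) ι hι (by
    intro a ha v
    obtain ⟨v, rfl⟩ := Submodule.mkQ_surjective _ v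
    rw [← map_smul]
    exact (Submodule.Quotient.mk_eq_zero _).2 (Submodule.smul_mem_smul ha trivial)) LinearMap.id
  have hψ1 : ψ (Submodule.Quotient.mk x') = Submodule.Quotient.mk 1 := by
    have := hψ (Submodule.Quotient.mk 1)
    rw [LinearMap.id_apply] at this
    rw [← this]
    congr 1
    show _ = (1 : S) • (Submodule.Quotient.mk x' : V)
    rw [one_smul]
  let Q := QuotSMulTop x (maximalIdeal S)
  let c : kk S →ₗ[S] kk (S ⧸ Ideal.span {x}) := Submodule.liftQ _
    (((maximalIdeal (S ⧸ Ideal.span {x})).mkQ.restrictScalars S).comp (Submodule.mkQ (Ideal.span {x}))) (by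
      intro a ha
      refine (Submodule.Quotient.mk_eq_zero _).2 ?_
      rw [← comap_max (x := x)] at ha
      exact ha)
  let r0 : Q →ₗ[S] kk (S ⧸ Ideal.span {x}) := Submodule.liftQ _ (c.comp (ψ.comp (Submodule.mkQ _))) (by
    intro m hm
    obtain ⟨w, rfl⟩ := mem_smul_top.1 hm
    rw [LinearMap.mem_ker, LinearMap.comp_apply, LinearMap.comp_apply]
    have : (Submodule.mkQ (maximalIdeal S • ⊤ : Submodule S (maximalIdeal S))) (x • w) = 0 :=
      (Submodule.Quotient.mk_eq_zero _).2 (Submodule.smul_mem_smul hx trivial)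
    rw [this, map_zero, map_zero])
  let i0 : kk (S ⧸ Ideal.span {x}) →ₗ[S ⧸ Ideal.span {x}] Q := Submodule.liftQ _
    (LinearMap.toSpanSingleton _ Q (Submodule.Quotient.mk x')) (by
      intro a ha
      obtain ⟨a, rfl⟩ := Ideal.Quotient.mk_surjective a
      have ha' : a ∈ maximalIdeal S := by rw [← comap_max (x := x)]; exact ha
      rw [LinearMap.mem_ker, LinearMap.toSpanSingleton_apply]
      refine (algebraMap_smul (S ⧸ Ideal.span {x}) a _).trans ?_
      rw [← Submodule.Quotient.mk_smul]
      refine (Submodule.Quotient.mk_eq_zero _).2 (mem_smul_top.2 ⟨⟨a, ha'⟩, ?_⟩)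
      exact Subtype.ext (mul_comm _ _))
  refine (PJ_resolving.syzN i).retract i0 (exq x r0) ?_ hm'
  intro v
  obtain ⟨v, rfl⟩ := Submodule.mkQ_surjective _ v
  have h1 : i0 (Submodule.mkQ _ v) = v • (Submodule.Quotient.mk x' : Q) := rfl
  rw [h1, map_smul, exq_apply]
  have h2 : r0 (Submodule.Quotient.mk x') = Submodule.mkQ _ 1 := by
    show c (ψ (Submodule.Quotient.mk x')) = _
    rw [hψ1]
    rfl
  rw [h2, ← map_smul, smul_eq_mul, mul_one]

end PartTwelve

end Chunk12

section Chunk13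
open scoped Pointwise
set_option linter.unusedSectionVars false
set_option linter.style.haveILetI false
section PartThirteen

open RingTheory.Sequence IsLocalRing

lemma nilp_of_socle {S : Type u} [CommRing S] [IsLocalRing S] [IsNoetherianRing S] {t y : S} (ht : maximalIdeal S = Ideal.span {t})
    (hy : y ≠ 0) (hs : ∀ a ∈ maximalIdeal S, a * y = 0) : ∃ n, t ^ n = 0 := by
  classical
  have hex : ∃ k, y ∉ maximalIdeal S ^ k := by
    by_contra hc
    push Not at hc
    have h1 := Ideal.iInf_pow_eq_bot_of_isLocalRing (maximalIdeal S) (Ideal.IsPrime.ne_top inferInstance)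
    exact hy ((Submodule.mem_bot S).1 (h1 ▸ (Submodule.mem_iInf _).2 hc))
  obtain ⟨k, hk, hmin⟩ : ∃ k, y ∉ maximalIdeal S ^ k ∧ ∀ j < k, y ∈ maximalIdeal S ^ j :=
    ⟨Nat.find hex, Nat.find_spec hex, fun j hj => not_not.1 (Nat.find_min hex hj)⟩
  rcases k with _ | k
  · simp at hk
  have h1 := hmin k (Nat.lt_succ_self k)
  rw [ht, Ideal.span_singleton_pow] at h1 hk
  obtain ⟨a, rfl⟩ := Ideal.mem_span_singleton'.1 h1
  have ha : IsUnit a := by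
    by_contra hu
    have : a ∈ Ideal.span {t} := ht ▸ (mem_maximalIdeal a).2 hu
    obtain ⟨b, rfl⟩ := Ideal.mem_span_singleton'.1 this
    exact hk (Ideal.mem_span_singleton'.2 ⟨b, by ring⟩)
  refine ⟨k + 1, ?_⟩
  have h2 := hs t (ht ▸ Ideal.mem_span_singleton_self t)
  have h3 : a * t ^ (k+1) = 0 := by rw [← h2]; ring
  exact (ha.mul_right_eq_zero).1 h3

theorem Qmain (d : ℕ) : ∀ (S : Type u) [CommRing S] [IsLocalRing S] [IsNoetherianRing S] (v : Fin d → S),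
    maximalIdeal S = Ideal.span (Set.range v) → dGE S (d - 1) S →
    ∃ xs t n, HData S xs t n ∧ ((∃ i, In (SyzN i (PJ S)) (kk S)) → maximalIdeal S = Ideal.ofList xs) := by
  classical
  induction d with
  | zero =>
    intro S _ _ _ v hv _
    have hm : maximalIdeal S = ⊥ := by rw [hv]; simp
    refine ⟨[], 0, 1, ⟨IsWeaklyRegular.nil _ _, by simp, by simpa using hm, by simp, ?_⟩, fun _ => by simpa using hm⟩
    intro i hi
    rcases i with _ | i
    · simp at hi
    · omega
  | succ d ih =>
    intro S _ _ _ v hv hd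
    by_cases h1 : dGE S 1 S
    · have hne : maximalIdeal S ≠ ⊥ := by
        intro hb
        obtain ⟨x, hx, hr⟩ := dGE_one_iff.1 h1
        rw [hb, Submodule.mem_bot] at hx
        subst hx
        exact one_ne_zero (hr (show (0 : S) • (1 : S) = (0 : S) • (0 : S) by simp))
      have h2 : ¬ maximalIdeal S ≤ maximalIdeal S ^ 2 := by
        intro hle
        rw [pow_two] at hle
        exact hne (Submodule.eq_bot_of_le_smul_of_le_jacobson_bot (maximalIdeal S) _ (IsNoetherian.noetherian _)
          hle (IsLocalRing.jacobson_eq_maximalIdeal _ bot_ne_top).ge)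
      have hJ : ∀ P ∈ associatedPrimes S S, ¬ maximalIdeal S ≤ P := by
        intro P hP hle
        obtain ⟨y, hy⟩ := (isAssociatedPrime_iff_exists_injective_linearMap P S).1 hP |> fun h => h.2
        have hz : y 1 = 0 := by
          refine socle_zero_of_dGE_one h1 (fun a ha => ?_)
          rw [← map_smul]
          have : a • (1 : S ⧸ P) = 0 := by
            rw [Algebra.smul_def, mul_one]; exact Ideal.Quotient.eq_zero_iff_mem.2 (hle ha)
          rw [this, map_zero]
        have h0 := hy (hz.trans (map_zero y).symm)
        have hP1 := hP.1
        exact hP1.ne_top ((Ideal.eq_top_iff_one _).2 (Ideal.Quotient.eq_zero_iff_mem.1 h0))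
      obtain ⟨x, hx, hx2, hxP⟩ := prime_avoid (associatedPrimes.finite S S) (fun P hP => hP.1) h2 hJ
      have hreg : IsSMulRegular S x := by
        have := biUnion_associatedPrimes_eq_compl_regular (R := S) (M := S)
        have hx' : x ∉ ⋃ p ∈ associatedPrimes S S, (p : Set S) := by
          simpa using hxP
        rw [this] at hx'
        simpa using hx'
      haveI := quot_local hx
      obtain ⟨w, hw⟩ := exchange_quot hv hx hx2
      have hd' : dGE (S ⧸ Ideal.span {x}) (d - 1) (S ⧸ Ideal.span {x}) := by
        rcases d with _ | d
        · exact dGE_zero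
        · exact dGE_quot_ring hx hreg hd
      obtain ⟨xs, t, n, H, hS⟩ := ih _ w hw hd'
      obtain ⟨l, rfl⟩ := exists_lift_list _ xs
      obtain ⟨t, rfl⟩ := Ideal.Quotient.mk_surjective t
      refine ⟨x :: l, t, n, ⟨isWeaklyRegular_quot.2 ⟨hreg, H.reg⟩, ?_, ?_, ?_, ?_⟩, ?_⟩
      · intro a ha
        rcases List.mem_cons.1 ha with rfl | ha
        · exact hx
        · rw [← comap_max (x := x)]
          exact H.mem _ (List.mem_map_of_mem ha)
      · have hg := H.gen
        rw [← comap_max (x := x), hg, ← Ideal.map_ofList, ← Set.image_singleton, ← Ideal.map_span, ← Ideal.map_sup,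
          Ideal.comap_map_of_surjective _ Ideal.Quotient.mk_surjective, ← RingHom.ker_eq_comap_bot, Ideal.mk_ker, Ideal.ofList_cons]
        rw [sup_comm, sup_assoc]
      · rw [← comap_ofList, Ideal.mem_comap, map_pow]
        exact H.pow
      · intro i hi
        rw [← comap_ofList, Ideal.mem_comap, map_pow] at hi
        exact H.min i hi
      · rintro ⟨i, hi⟩
        rw [← comap_max (x := x), hS ⟨i, serre_red hx hx2 hreg hi⟩, comap_ofList]
    · have hd0 : d = 0 := by
        by_contra hne
        exact h1 (hd.mono (by omega))
      subst hd0
      have ht : maximalIdeal S = Ideal.span {v 0} := by rw [hv]; congr 1; ext; simp [eq_comm]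
      obtain ⟨y, hs, hy⟩ : ∃ y : S, (∀ a ∈ maximalIdeal S, a • y = 0) ∧ y ≠ 0 := by
        by_contra hc
        push Not at hc
        exact h1 (dGE_one_iff.2 (exists_regular_of_socle hc))
      have hex := nilp_of_socle ht hy hs
      refine ⟨[], v 0, Nat.find hex, ⟨IsWeaklyRegular.nil _ _, by simp, by simpa using ht, by simpa using Nat.find_spec hex, ?_⟩, ?_⟩
      · intro i hi
        exact Nat.find_min' hex (by simpa using hi)
      · rintro ⟨i, hi⟩
        rw [Ideal.ofList_nil]
        exact max_eq_bot_of_proj (proj_of_socle hy hs i _ hi)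

end PartThirteen

end Chunk13

section Chunk14
open scoped Pointwise
set_option linter.unusedSectionVars false
set_option linter.style.haveILetI false
section PartFourteen
open RingTheory.Sequence IsLocalRing

lemma dGE_list {S : Type u} [CommRing S] [IsLocalRing S] [IsNoetherianRing S] (xs : List S)
    {M : Type u} [AddCommGroup M] [Module S M] [Module.Finite S M]
    (hxs : ∀ x ∈ xs, x ∈ maximalIdeal S) (hreg : IsWeaklyRegular M xs) (j : ℕ) :
    dGE S (j + xs.length) M ↔ dGE S j (M ⧸ (Ideal.ofList xs • ⊤ : Submodule S M)) := by
  induction xs generalizing M with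
  | nil =>
    have e : (M ⧸ (Ideal.ofList ([] : List S) • ⊤ : Submodule S M)) ≃ₗ[S] M :=
      Submodule.quotEquivOfEqBot _ (by rw [Ideal.ofList_nil, Submodule.bot_smul])
    exact ⟨fun h => dGE_equiv e.symm h, fun h => dGE_equiv e h⟩
  | cons x xs ih =>
    rw [isWeaklyRegular_cons_iff] at hreg
    have hx := hxs x (by simp)
    have := ih (M := QuotSMulTop x M) (fun y hy => hxs y (by simp [hy])) hreg.2
    rw [List.length_cons, ← add_assoc, dGE_quot_iff hx hreg.1, this]
    have e := Submodule.quotOfListConsSMulTopEquivQuotSMulTopInner M x xs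
    exact ⟨fun h => dGE_equiv e.symm h, fun h => dGE_equiv e h⟩

lemma dGE_ringEquiv {A B : Type u} [CommRing A] [CommRing B] [IsLocalRing A] [IsLocalRing B]
    [IsNoetherianRing A] [IsNoetherianRing B] (e : A ≃+* B) {j : ℕ} (h : dGE A j A) :
    dGE B j B := by
  obtain ⟨rs, h1, h2, h3⟩ := (dGE_iff_exists j).1 h
  refine (dGE_iff_exists j).2 ⟨rs.map e, by simpa using h1, ?_, ?_⟩
  · intro r hr
    obtain ⟨a, ha, rfl⟩ := List.mem_map.1 hr
    have := h2 a ha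
    rw [mem_maximalIdeal, mem_nonunits_iff] at this ⊢
    intro hu
    exact this ((MulEquiv.isUnit_map e).1 hu)
  · refine (AddEquiv.isWeaklyRegular_congr (e := e.toAddEquiv) ?_).1 h3
    refine List.forall₂_map_right_iff.mpr <| List.forall₂_same.mpr fun r _ x => ?_
    show e (r * x) = e r * e x
    simp

/-- generators of the maximal ideal descend from the regular ring -/
lemma gens_descend {S T : Type u} [CommRing S] [CommRing T] [IsLocalRing S] [IsLocalRing T]
    [IsNoetherianRing S] {d : ℕ} (v : Fin d → T) (hv : maximalIdeal T = Ideal.span (Set.range v))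
    (φ : T →+* S ⧸ (maximalIdeal S ^ 2)) (hφ : Function.Surjective φ) :
    ∃ w : Fin d → S, maximalIdeal S = Ideal.span (Set.range w) := by
  have hle : maximalIdeal S ^ 2 ≤ maximalIdeal S := Ideal.pow_le_self (by norm_num)
  choose w hw using fun i => Ideal.Quotient.mk_surjective (φ (v i))
  refine ⟨w, ?_⟩
  let ψ : T →+* S ⧸ maximalIdeal S := (Ideal.Quotient.factor hle).comp φ
  have hψ : Function.Surjective ψ := (Ideal.Quotient.factor_surjective hle).comp hφ
  have hk : RingHom.ker ψ = maximalIdeal T := by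
    have : (RingHom.ker ψ).IsMaximal := by
      letI := Ideal.Quotient.field (maximalIdeal S)
      exact RingHom.ker_isMaximal_of_surjective ψ hψ
    exact IsLocalRing.eq_maximalIdeal this
  have key : ∀ a : S, ∀ t : T, φ t = Ideal.Quotient.mk _ a → (a ∈ maximalIdeal S ↔ t ∈ maximalIdeal T) := by
    intro a t h
    rw [← hk, RingHom.mem_ker]
    show _ ↔ (Ideal.Quotient.factor hle) (φ t) = 0
    rw [h, Ideal.Quotient.factor_mk, Ideal.Quotient.eq_zero_iff_mem]
  apply le_antisymm
  · have : maximalIdeal S ≤ Ideal.span (Set.range w) ⊔ maximalIdeal S • maximalIdeal S := by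
      intro a ha
      obtain ⟨t, ht⟩ := hφ (Ideal.Quotient.mk _ a)
      have htm := (key a t ht).1 ha
      rw [hv] at htm
      have h2 := Ideal.mem_map_of_mem φ htm
      rw [Ideal.map_span, ← Set.range_comp, ht] at h2
      have h3 : Ideal.span (Set.range (φ ∘ v)) =
          Ideal.map (Ideal.Quotient.mk (maximalIdeal S ^ 2)) (Ideal.span (Set.range w)) := by
        rw [Ideal.map_span, ← Set.range_comp]
        congr 2
        funext i
        exact (hw i).symm
      rw [h3] at h2
      have h4 := Ideal.mem_comap.2 h2
      rw [Ideal.comap_map_of_surjective _ Ideal.Quotient.mk_surjective] at h4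
      have h5 : Ideal.comap (Ideal.Quotient.mk (maximalIdeal S ^ 2)) ⊥ = maximalIdeal S ^ 2 := by
        rw [← RingHom.ker_eq_comap_bot, Ideal.mk_ker]
      rw [h5, pow_two] at h4
      exact h4
    exact Submodule.le_of_le_smul_of_le_jacobson_bot (IsNoetherian.noetherian _)
      (by rw [IsLocalRing.jacobson_eq_maximalIdeal _ bot_ne_top]) this
  · rw [Ideal.span_le]
    rintro _ ⟨i, rfl⟩
    refine (key _ (v i) (hw i).symm).2 ?_
    rw [hv]
    exact Ideal.subset_span ⟨i, rfl⟩

/-- depth descends from the completion -/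
lemma depth_descend {S : Type u} [CommRing S] [IsLocalRing S] [IsNoetherianRing S]
    [IsNoetherianRing (AdicCompletion (maximalIdeal S) S)] (k : ℕ)
    (h : dGE (AdicCompletion (maximalIdeal S) S) k (AdicCompletion (maximalIdeal S) S)) :
    dGE S k S := by
  classical
  by_contra hk
  let j := Nat.findGreatest (fun j => dGE S j S) k
  have hj : dGE S j S := Nat.findGreatest_spec (P := fun j => dGE S j S) (Nat.zero_le k) dGE_zero
  have hjk : j < k := lt_of_le_of_ne (Nat.findGreatest_le k) (fun e => hk (e ▸ hj))
  have hj1 : ¬ dGE S (j + 1) S :=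
    Nat.findGreatest_is_greatest (P := fun j => dGE S j S) (Nat.lt_succ_self j) hjk
  obtain ⟨xs, hl, hm, hreg⟩ := (dGE_iff_exists j).1 hj
  have h1 := (dGE_list xs hm hreg 1).not.1 (by rwa [hl, add_comm])
  obtain ⟨v, hs, hv⟩ : ∃ v : S ⧸ (Ideal.ofList xs • ⊤ : Submodule S S),
      (∀ a ∈ maximalIdeal S, a • v = 0) ∧ v ≠ 0 := by
    by_contra hc
    push Not at hc
    exact h1 (dGE_one_iff.2 (exists_regular_of_socle hc))
  obtain ⟨y, rfl⟩ := Submodule.mkQ_surjective _ v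
  have hI : (Ideal.ofList xs • ⊤ : Submodule S S) = Ideal.ofList xs := by simp
  apply hv
  rw [Submodule.mkQ_apply, Submodule.Quotient.mk_eq_zero, hI]
  have hs' : ∀ a ∈ maximalIdeal S, a * y ∈ Ideal.ofList xs := by
    intro a ha
    have := hs a ha
    rw [← map_smul, Submodule.mkQ_apply, Submodule.Quotient.mk_eq_zero, hI] at this
    exact this
  let C := AdicCompletion (maximalIdeal S) S
  let ys : List C := xs.map (algebraMap S C)
  have hys : IsWeaklyRegular C ys := IsWeaklyRegular.of_flat hreg
  have hysm : ∀ c ∈ ys, c ∈ maximalIdeal C := by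
    intro c hc
    obtain ⟨x, hx, rfl⟩ := List.mem_map.1 hc
    rw [AdicCompletion.maximalIdeal_eq_map]
    exact Ideal.mem_map_of_mem _ (hm x hx)
  have hC1 : dGE C 1 (C ⧸ (Ideal.ofList ys • ⊤ : Submodule C C)) := by
    refine (dGE_list ys hysm hys 1).1 (h.mono ?_)
    simp only [ys, List.length_map, hl]; omega
  have hyC : (Submodule.mkQ (Ideal.ofList ys • ⊤ : Submodule C C)) (algebraMap S C y) = 0 := by
    refine socle_zero_of_dGE_one hC1 ?_
    intro a ha
    rw [← map_smul, Submodule.mkQ_apply, Submodule.Quotient.mk_eq_zero]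
    have hI' : (Ideal.ofList ys • ⊤ : Submodule C C) = Ideal.ofList ys := by simp
    rw [hI', smul_eq_mul]
    rw [AdicCompletion.maximalIdeal_eq_map] at ha
    have : Ideal.map (algebraMap S C) (maximalIdeal S) ≤
        Submodule.colon (Ideal.ofList ys) {algebraMap S C y} := by
      rw [Ideal.map_le_iff_le_comap]
      intro b hb
      rw [Ideal.mem_comap, Submodule.mem_colon_singleton, smul_eq_mul, ← map_mul]
      have := Ideal.mem_map_of_mem (algebraMap S C) (hs' b hb)
      rwa [Ideal.map_ofList] at this
    have := this ha
    rwa [Submodule.mem_colon_singleton, smul_eq_mul] at this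
  have hyC' : algebraMap S C y ∈ Ideal.map (algebraMap S C) (Ideal.ofList xs) := by
    rw [Ideal.map_ofList]
    rw [Submodule.mkQ_apply, Submodule.Quotient.mk_eq_zero] at hyC
    simpa using hyC
  have hn : ∀ n, y ∈ Ideal.ofList xs ⊔ maximalIdeal S ^ n := by
    intro n
    have h2 := Ideal.mem_map_of_mem (AdicCompletion.evalₐ (maximalIdeal S) n).toRingHom hyC'
    rw [Ideal.map_map] at h2
    have e : ((AdicCompletion.evalₐ (maximalIdeal S) n).toRingHom.comp (algebraMap S C)) =
        Ideal.Quotient.mk (maximalIdeal S ^ n) := by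
      ext a
      exact AdicCompletion.evalₐ_of _ n a
    rw [e] at h2
    have e2 : (AdicCompletion.evalₐ (maximalIdeal S) n).toRingHom (algebraMap S C y) =
      Ideal.Quotient.mk (maximalIdeal S ^ n) y := AdicCompletion.evalₐ_of _ n y
    rw [e2] at h2
    have h4 := Ideal.mem_comap.2 h2
    rw [Ideal.comap_map_of_surjective _ Ideal.Quotient.mk_surjective,
      ← RingHom.ker_eq_comap_bot, Ideal.mk_ker] at h4
    exact h4
  have hkr := Ideal.iInf_pow_smul_eq_bot_of_isLocalRing (M := S ⧸ Ideal.ofList xs) (maximalIdeal S)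
    (Ideal.IsPrime.ne_top inferInstance)
  have : (Submodule.mkQ (Ideal.ofList xs)) y ∈ (⨅ i, maximalIdeal S ^ i • ⊤ : Submodule S (S ⧸ Ideal.ofList xs)) := by
    rw [Submodule.mem_iInf]
    intro n
    obtain ⟨a, ha, b, hb, e⟩ := Submodule.mem_sup.1 (hn n)
    rw [← e, map_add]
    have : (Submodule.mkQ (Ideal.ofList xs)) a = 0 := (Submodule.Quotient.mk_eq_zero _).2 ha
    rw [this, zero_add]
    have : (Submodule.mkQ (Ideal.ofList xs)) b = b • (Submodule.mkQ (Ideal.ofList xs)) 1 := by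
      rw [← map_smul]; simp
    rw [this]
    exact Submodule.smul_mem_smul hb trivial
  rw [hkr, Submodule.mem_bot, Submodule.mkQ_apply, Submodule.Quotient.mk_eq_zero] at this
  exact this

lemma hyp_data {S : Type u} [CommRing S] [IsLocalRing S] [IsNoetherianRing S]
    (h : IsHypersurfaceLocalRing S) : ∃ xs t n, HData S xs t n ∧
      ((∃ i, In (SyzN i (PJ S)) (kk S)) → maximalIdeal S = Ideal.ofList xs) := by
  obtain ⟨T, i1, i2, f, ⟨hN, s, hs, hdim⟩, ⟨e⟩⟩ := h
  let d := s.card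
  let v : Fin d → T := fun i => (s.equivFin.symm i : T)
  have hr : Set.range v = (s : Set T) := by
    ext x
    constructor
    · rintro ⟨i, rfl⟩; exact (s.equivFin.symm i).2
    · intro hx; exact ⟨s.equivFin ⟨x, hx⟩, by simp [v]⟩
  have hv : maximalIdeal T = Ideal.span (Set.range v) := by rw [hr, hs]
  obtain ⟨hdom, xs, hxl, hxr, hxm⟩ := reg_main d T v hv hdim.ge
  have hT : dGE T d T := (dGE_iff_exists d).2 ⟨xs, hxl, fun r hr => hxm ▸ Ideal.subset_span hr, hxr⟩
  haveI : IsNoetherianRing (AdicCompletion (maximalIdeal S) S) :=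
    isNoetherianRing_of_ringEquiv _ e.symm
  haveI : Nontrivial (T ⧸ Ideal.span {f}) := e.symm.toEquiv.nontrivial
  haveI : IsLocalRing (T ⧸ Ideal.span {f}) :=
    IsLocalRing.of_surjective' (R := AdicCompletion (maximalIdeal S) S) e.toRingHom e.surjective
  have hT1 : dGE T (d - 1) (T ⧸ Ideal.span {f}) := by
    rcases Nat.eq_zero_or_pos d with h0 | hpos
    · rw [h0]; exact dGE_zero
    · obtain ⟨d', hd'⟩ : ∃ d', d = d' + 1 := ⟨d - 1, by omega⟩
      rw [hd'] at hT ⊢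
      by_cases hf : f = 0
      · have e : (T ⧸ Ideal.span {f}) ≃ₗ[T] T := Submodule.quotEquivOfEqBot _ (by simp [hf])
        exact dGE_equiv e.symm (hT.mono (by omega))
      · have ses : IsSES (LinearMap.lsmul T T f) (Submodule.mkQ (Ideal.span {f})) := by
          refine IsSES.mk' ?_ (Submodule.mkQ_surjective _) ?_ ?_
          · intro a ha
            have ha' : f * a = 0 := ha
            exact (mul_eq_zero.1 ha').resolve_left hf
          · intro a
            exact (Submodule.Quotient.mk_eq_zero _).2 (Ideal.mul_mem_right _ _ (Ideal.mem_span_singleton_self f))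
          · intro b hb
            obtain ⟨a, ha⟩ := Ideal.mem_span_singleton.1 ((Submodule.Quotient.mk_eq_zero _).1 hb)
            exact ⟨a, ha.symm⟩
        exact dGE.right ses hT (hT.mono (by omega))
  have hT2 := dGE_quotI _ hT1
  have hC := dGE_ringEquiv e.symm hT2
  have hS := depth_descend _ hC
  let φ : T →+* S ⧸ (maximalIdeal S ^ 2) :=
    ((AdicCompletion.evalₐ (maximalIdeal S) 2).toRingHom.comp e.symm.toRingHom).comp
      (Ideal.Quotient.mk _)
  have hφ : Function.Surjective φ :=
    ((AdicCompletion.surjective_evalₐ (maximalIdeal S) 2).comp e.symm.surjective).comp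
      Ideal.Quotient.mk_surjective
  obtain ⟨w, hw⟩ := gens_descend v hv φ hφ
  exact Qmain d S w hw hS

/-- item 6 -/
lemma reg_of_gen {S : Type u} [CommRing S] [IsLocalRing S] [IsNoetherianRing S] {xs : List S}
    (hreg : IsWeaklyRegular S xs) (hm : maximalIdeal S = Ideal.ofList xs) : IsRegLocalRing S := by
  classical
  have hr : IsRegular S xs := IsRegular.of_isWeaklyRegular_of_mem_maximalIdeal S
    (fun r hr => hm ▸ Ideal.subset_span hr) hreg
  have hspan : Ideal.span ((xs.toFinset : Finset S) : Set S) = maximalIdeal S := by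
    rw [hm, Ideal.ofList]; congr 1; ext; simp
  refine ⟨inferInstance, xs.toFinset, hspan, ?_⟩
  have h1 := ringKrullDim_add_length_eq_ringKrullDim_of_isRegular xs hr
  have h2 : ringKrullDim (S ⧸ Ideal.ofList xs) = 0 := by
    letI : Field (S ⧸ maximalIdeal S) := Ideal.Quotient.field _
    rw [← hm]
    exact ringKrullDim_eq_zero_of_field (S ⧸ maximalIdeal S)
  rw [h2, zero_add] at h1
  have h3 : (maximalIdeal S).height ≤ xs.toFinset.card := by
    refine (Ideal.height_le_spanFinrank _ (Ideal.IsPrime.ne_top inferInstance)).trans ?_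
    have := Submodule.spanFinrank_span_le_ncard_of_finite (R := S) (s := ((xs.toFinset : Finset S) : Set S)) (Finset.finite_toSet _)
    rw [Set.ncard_coe_finset] at this
    have h4 : (maximalIdeal S).spanFinrank ≤ xs.toFinset.card := by
      rw [← hspan]; exact this
    exact_mod_cast h4
  have h5 : ringKrullDim S ≤ xs.toFinset.card := by
    rw [← IsLocalRing.maximalIdeal_height_eq_ringKrullDim]
    exact_mod_cast h3
  apply le_antisymm h5
  rw [← h1]
  exact_mod_cast List.toFinset_card_le xs

/-- item 7 -/
lemma finpd_of_reg {S : Type u} [CommRing S] [IsLocalRing S] (h : IsRegLocalRing S) :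
    ∃ d, ∀ (M : Type u) [AddCommGroup M] [Module S M] [Module.Finite S M],
      In (SyzN d (PJ S)) M := by
  obtain ⟨hN, s, hs, hdim⟩ := h
  let d := s.card
  let v : Fin d → S := fun i => (s.equivFin.symm i : S)
  have hr : Set.range v = (s : Set S) := by
    ext x
    constructor
    · rintro ⟨i, rfl⟩; exact (s.equivFin.symm i).2
    · intro hx; exact ⟨s.equivFin ⟨x, hx⟩, by simp [v]⟩
  have hv : maximalIdeal S = Ideal.span (Set.range v) := by rw [hr, hs]
  obtain ⟨hdom, xs, hxl, hxr, hxm⟩ := reg_main d S v hv hdim.ge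
  refine ⟨xs.length, fun M _ _ _ => ?_⟩
  refine SyzN_mono _ ?_ (in_SyzN_MCM' hxr)
  intro N hN
  obtain ⟨hf, hreg⟩ := in_MCM.1 (show In (MCM xs) N from hN)
  obtain ⟨n, g, hg, hgm⟩ := min_cover (S := S) N
  have ses := isSES_ker g hg
  have hle : ∀ a : LinearMap.ker g, a ∈ Ideal.ofList xs • (⊤ : Submodule S (LinearMap.ker g)) := by
    intro a
    refine wreg_inter xs ses hreg a ?_
    have h1 := hgm a.1 a.2
    have e : ((LinearMap.ker g).subtype a : Fin n → S) = ∑ i, (a.1 i) • (Pi.single i 1 : Fin n → S) := by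
      ext k
      simp [Finset.sum_apply, Pi.single_apply]
    rw [e]
    exact Submodule.sum_mem _ fun i _ => Submodule.smul_mem_smul (hxm ▸ h1 i) trivial
  have hbot : (⊤ : Submodule S (LinearMap.ker g)) = ⊥ := by
    refine Submodule.eq_bot_of_le_smul_of_le_jacobson_bot (maximalIdeal S) _
      (IsNoetherian.noetherian _) (fun a _ => hxm ▸ hle a) ?_
    rw [IsLocalRing.jacobson_eq_maximalIdeal _ bot_ne_top]
  have hinj : Function.Injective g := by
    rw [← LinearMap.ker_eq_bot, eq_bot_iff]
    intro a ha
    have : (⟨a, ha⟩ : LinearMap.ker g) ∈ (⊤ : Submodule S (LinearMap.ker g)) := trivial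
    rw [hbot, Submodule.mem_bot] at this
    exact congrArg Subtype.val this
  exact in_PJ.2 ⟨hf, Module.Projective.of_equiv (LinearEquiv.ofBijective g ⟨hinj, hg⟩)⟩

end PartFourteen

end Chunk14

section Chunk15
open scoped Pointwise
set_option linter.unusedSectionVars false
set_option linter.style.haveILetI false
section PartFifteenA
variable {R : Type u} [CommRing R] [IsNoetherianRing R] {T : Submonoid R}
variable {S : Type u} [CommRing S] [Algebra R S]
variable {M : Type u} [AddCommGroup M] [Module R M]
variable {N N₁ : Type u} [AddCommGroup N] [Module S N] [AddCommGroup N₁] [Module S N₁]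

lemma IsLoc.ext [IsLocalization T S] {φ : M →ₛₗ[algebraMap R S] N} (h : IsLoc T φ)
    {f g : N →ₗ[S] N₁} (hfg : ∀ m, f (φ m) = g (φ m)) : f = g := by
  ext n
  obtain ⟨s, hs, m, hm⟩ := h.1 n
  refine unit_smul_inj (S := S) hs ?_
  rw [← map_smul, ← map_smul, ← hm, hfg]

lemma IsLoc.unique [IsLocalization T S] {φ : M →ₛₗ[algebraMap R S] N} {ψ : M →ₛₗ[algebraMap R S] N₁}
    (h : IsLoc T φ) (h' : IsLoc T ψ) : ∃ e : N ≃ₗ[S] N₁, ∀ m, e (φ m) = ψ m := by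
  obtain ⟨α, hα⟩ := h.desc ψ
  obtain ⟨β, hβ⟩ := h'.desc φ
  refine ⟨LinearEquiv.ofLinearMap α β ?_ ?_, hα⟩
  · exact h'.ext fun m => by simp [hα, hβ]
  · exact h.ext fun m => by simp [hα, hβ]

end PartFifteenA

section PartFifteen
open RingTheory.Sequence IsLocalRing
variable {R : Type u} [CommRing R] [IsNoetherianRing R]
variable {A B C M N : Type u} [AddCommGroup A] [Module R A] [AddCommGroup B] [Module R B]
  [AddCommGroup C] [Module R C] [AddCommGroup M] [Module R M] [AddCommGroup N] [Module R N]

/-- localized module at `p` -/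
abbrev Lo (p : PrimeSpectrum R) (M : Type u) [AddCommGroup M] [Module R M] : Type u :=
  LocalizedModule p.asIdeal.primeCompl M

/-- local ring at `p` -/
abbrev Rp (p : PrimeSpectrum R) : Type u := Localization.AtPrime p.asIdeal

/-- local depth at least `j` -/
def dL (p : PrimeSpectrum R) (j : ℕ) (M : Type u) [AddCommGroup M] [Module R M] : Prop :=
  dGE (Rp p) j (Lo p M)

lemma lo_ses (p : PrimeSpectrum R) {f : A →ₗ[R] B} {g : B →ₗ[R] C} (s : IsSES f g) :
    ∃ (f' : Lo p A →ₗ[Rp p] Lo p B) (g' : Lo p B →ₗ[Rp p] Lo p C), IsSES f' g' := by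
  obtain ⟨f', g', h, -⟩ := IsLoc.ses s (isLoc_locMap p.asIdeal.primeCompl A)
    (isLoc_locMap p.asIdeal.primeCompl B) (isLoc_locMap p.asIdeal.primeCompl C)
  exact ⟨f', g', h⟩

lemma dL.mono {p : PrimeSpectrum R} {j j' : ℕ} (h : dL p j M) (hj : j' ≤ j) : dL p j' M :=
  dGE.mono h hj

lemma dL_zero {p : PrimeSpectrum R} : dL p 0 M := dGE_zero

lemma dL.mid {p : PrimeSpectrum R} {f : A →ₗ[R] B} {g : B →ₗ[R] C} (s : IsSES f g) {j : ℕ}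
    (hA : dL p j A) (hC : dL p j C) : dL p j B := by
  obtain ⟨f', g', h⟩ := lo_ses p s
  exact dGE.mid h hA hC

lemma dL.left {p : PrimeSpectrum R} {f : A →ₗ[R] B} {g : B →ₗ[R] C} (s : IsSES f g) {j : ℕ}
    (hB : dL p (j+1) B) (hC : dL p j C) : dL p (j+1) A := by
  obtain ⟨f', g', h⟩ := lo_ses p s
  exact dGE.left h hB hC

lemma dL.right {p : PrimeSpectrum R} {f : A →ₗ[R] B} {g : B →ₗ[R] C} (s : IsSES f g) {j : ℕ}
    (hA : dL p (j+1) A) (hB : dL p j B) : dL p j C := by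
  obtain ⟨f', g', h⟩ := lo_ses p s
  exact dGE.right h hA hB

lemma dL_retract {p : PrimeSpectrum R} {j : ℕ} (i : M →ₗ[R] N) (r : N →ₗ[R] M)
    (hri : ∀ m, r (i m) = m) (h : dL p j N) : dL p j M := by
  have hM := isLoc_locMap p.asIdeal.primeCompl M
  have hN := isLoc_locMap p.asIdeal.primeCompl N
  obtain ⟨i', hi⟩ := hM.map (locMap p.asIdeal.primeCompl N) i
  obtain ⟨r', hr⟩ := hN.map (locMap p.asIdeal.primeCompl M) r
  refine dGE_of_retract i' r' ?_ h
  have : r' ∘ₗ i' = LinearMap.id := hM.ext fun m => by simp [hi, hr, hri]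
  exact fun m => DFunLike.congr_fun this m

lemma dL_equiv {p : PrimeSpectrum R} {j : ℕ} (e : M ≃ₗ[R] N) (h : dL p j M) : dL p j N :=
  dL_retract e.symm.toLinearMap e.toLinearMap (by simp) h

lemma lo_subsingleton {p : PrimeSpectrum R} (h : ∀ m : M, ∃ s ∉ p.asIdeal, s • m = 0) :
    Subsingleton (Lo p M) := by
  refine subsingleton_of_forall_eq 0 fun n => ?_
  obtain ⟨s, hs, m, hm⟩ := (isLoc_locMap p.asIdeal.primeCompl M).1 n
  obtain ⟨t, ht, h0⟩ := h m
  refine unit_smul_inj (S := Rp p) (T := p.asIdeal.primeCompl) hs ?_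
  rw [smul_zero, ← hm]
  refine unit_smul_inj (S := Rp p) (T := p.asIdeal.primeCompl) (s := t) ht ?_
  rw [← (locMap p.asIdeal.primeCompl M).map_smulₛₗ, h0]
  simp

lemma of_lo_subsingleton {p : PrimeSpectrum R} [h : Subsingleton (Lo p M)] (m : M) :
    ∃ s ∉ p.asIdeal, s • m = 0 :=
  (isLoc_locMap p.asIdeal.primeCompl M).2 m (Subsingleton.elim _ _)

lemma dL_of_zero {p : PrimeSpectrum R} (h : ∀ m : M, ∃ s ∉ p.asIdeal, s • m = 0) (j : ℕ) :
    dL p j M := by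
  haveI := lo_subsingleton h
  exact dGE_of_subsingleton j

instance lo_finite (p : PrimeSpectrum R) [Module.Finite R M] : Module.Finite (Rp p) (Lo p M) :=
  (isLoc_locMap p.asIdeal.primeCompl M).finite

lemma le_localDepth_iff (p : PrimeSpectrum R) (M : ModuleCat.{u} R) [Module.Finite R M] (j : ℕ) :
    (j : ℕ∞) ≤ localDepth R p M ↔ dL p j M :=
  le_depthE_iff_dGE (S := Rp p) (M := Lo p M) j

/-- quotient by a locally regular element -/
lemma dL_quot {p : PrimeSpectrum R} [Module.Finite R M] {x : R} (hx : x ∈ p.asIdeal)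
    (hreg : IsSMulRegular (Lo p M) (algebraMap R (Rp p) x)) (j : ℕ) :
    dL p (j+1) M ↔ dL p j (QuotSMulTop x M) := by
  have hxm : algebraMap R (Rp p) x ∈ maximalIdeal (Rp p) :=
    (IsLocalization.AtPrime.to_map_mem_maximal_iff (Rp p) p.asIdeal x).2 hx
  unfold dL
  rw [dGE_quot_iff hxm hreg]
  let π := Submodule.mkQ (algebraMap R (Rp p) x • (⊤ : Submodule (Rp p) (Lo p M)))
  have hM := isLoc_locMap p.asIdeal.primeCompl M
  let ψ₀ : M →ₛₗ[algebraMap R (Rp p)] QuotSMulTop (algebraMap R (Rp p) x) (Lo p M) :=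
    π.comp (locMap p.asIdeal.primeCompl M)
  have hψ₀ : (x • (⊤ : Submodule R M)) ≤ LinearMap.ker ψ₀ := by
    intro m hm
    obtain ⟨m', -, rfl⟩ := (Submodule.mem_smul_pointwise_iff_exists _ _ _).1 hm
    rw [LinearMap.mem_ker]
    show π (locMap p.asIdeal.primeCompl M (x • m')) = 0
    rw [LinearMap.map_smulₛₗ]
    exact (Submodule.Quotient.mk_eq_zero _).2 (Submodule.smul_mem_pointwise_smul _ _ _ trivial)
  let ψ : QuotSMulTop x M →ₛₗ[algebraMap R (Rp p)] QuotSMulTop (algebraMap R (Rp p) x) (Lo p M) :=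
    Submodule.liftQ _ ψ₀ hψ₀
  have hψ : IsLoc p.asIdeal.primeCompl ψ := by
    constructor
    · intro n
      obtain ⟨n, rfl⟩ := Submodule.mkQ_surjective _ n
      obtain ⟨s, hs, m, hm⟩ := hM.1 n
      refine ⟨s, hs, Submodule.Quotient.mk m, ?_⟩
      show π (locMap p.asIdeal.primeCompl M m) = _
      rw [hm, map_smul]
    · intro m hm
      obtain ⟨m, rfl⟩ := Submodule.mkQ_surjective _ m
      have hm' : π (locMap p.asIdeal.primeCompl M m) = 0 := hm
      obtain ⟨n, -, hn⟩ := (Submodule.mem_smul_pointwise_iff_exists _ _ _).1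
        ((Submodule.Quotient.mk_eq_zero _).1 hm')
      obtain ⟨s, hs, m', hm2⟩ := hM.1 n
      have : locMap p.asIdeal.primeCompl M (s • m - x • m') = 0 := by
        rw [map_sub, LinearMap.map_smulₛₗ, LinearMap.map_smulₛₗ, hm2, ← hn, smul_comm, sub_self]
      obtain ⟨t, ht, h0⟩ := hM.2 _ this
      refine ⟨t * s, mul_mem ht hs, ?_⟩
      rw [← map_smul]
      refine (Submodule.Quotient.mk_eq_zero _).2 ?_
      rw [smul_sub, sub_eq_zero] at h0
      rw [mul_smul, h0, smul_comm]
      exact Submodule.smul_mem_pointwise_smul _ _ _ trivial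
  obtain ⟨e, -⟩ := hψ.unique (isLoc_locMap p.asIdeal.primeCompl (QuotSMulTop x M))
  exact ⟨fun h => dGE_equiv e h, fun h => dGE_equiv e.symm h⟩

/-- regular stays regular locally -/
lemma lo_regular {p : PrimeSpectrum R} {x : R} (hreg : IsSMulRegular M x) :
    IsSMulRegular (Lo p M) (algebraMap R (Rp p) x) := by
  have hM := isLoc_locMap p.asIdeal.primeCompl M
  rw [isSMulRegular_iff_right_eq_zero_of_smul]
  intro n hn
  obtain ⟨s, hs, m, hm⟩ := hM.1 n
  have : locMap p.asIdeal.primeCompl M (x • m) = 0 := by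
    rw [LinearMap.map_smulₛₗ, hm, smul_comm, hn, smul_zero]
  obtain ⟨t, ht, h0⟩ := hM.2 _ this
  rw [smul_comm] at h0
  have h1 := (isSMulRegular_iff_right_eq_zero_of_smul).1 hreg _ h0
  refine unit_smul_inj (S := Rp p) (T := p.asIdeal.primeCompl) hs ?_
  rw [smul_zero, ← hm]
  refine unit_smul_inj (S := Rp p) (T := p.asIdeal.primeCompl) (s := t) ht ?_
  rw [← (locMap p.asIdeal.primeCompl M).map_smulₛₗ, h1]
  simp

lemma dL_list {p : PrimeSpectrum R} (xs : List R) {M : Type u} [AddCommGroup M] [Module R M] [Module.Finite R M]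
    (hxs : ∀ x ∈ xs, x ∈ p.asIdeal) (hreg : IsWeaklyRegular M xs) (j : ℕ) :
    dL p (j + xs.length) M ↔ dL p j (M ⧸ (Ideal.ofList xs • ⊤ : Submodule R M)) := by
  induction xs generalizing M with
  | nil =>
    have e : (M ⧸ (Ideal.ofList ([] : List R) • ⊤ : Submodule R M)) ≃ₗ[R] M :=
      Submodule.quotEquivOfEqBot _ (by rw [Ideal.ofList_nil, Submodule.bot_smul])
    exact ⟨fun h => dL_equiv e.symm h, fun h => dL_equiv e h⟩
  | cons x xs ih =>
    rw [isWeaklyRegular_cons_iff] at hreg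
    have hx := hxs x (by simp)
    have := ih (M := QuotSMulTop x M) (fun y hy => hxs y (by simp [hy])) hreg.2
    rw [List.length_cons, ← add_assoc, dL_quot hx (lo_regular hreg.1), this]
    have e := Submodule.quotOfListConsSMulTopEquivQuotSMulTopInner M x xs
    exact ⟨fun h => dL_equiv e.symm h, fun h => dL_equiv e h⟩

/-- an element killed by `p` obstructs -/
lemma not_dL_one {p : PrimeSpectrum R} [Module.Finite R M] (y : M) (hy : ∀ a ∈ p.asIdeal, a • y = 0)
    (hs : ∀ s ∉ p.asIdeal, s • y ≠ 0) : ¬ dL p 1 M := by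
  intro h
  have h0 : locMap p.asIdeal.primeCompl M y = 0 := by
    refine socle_zero_of_dGE_one h ?_
    intro a ha
    obtain ⟨r, s, rfl⟩ := IsLocalization.exists_mk'_eq p.asIdeal.primeCompl a
    have hr : r ∈ p.asIdeal := by
      rwa [IsLocalization.AtPrime.mk'_mem_maximal_iff (Rp p) p.asIdeal] at ha
    refine unit_smul_inj (S := Rp p) (T := p.asIdeal.primeCompl) s.2 ?_
    rw [smul_zero, ← mul_smul, mul_comm, IsLocalization.mk'_spec,
      ← (locMap p.asIdeal.primeCompl M).map_smulₛₗ, hy r hr, map_zero]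
  obtain ⟨t, ht, h1⟩ := (isLoc_locMap p.asIdeal.primeCompl M).2 _ h0
  exact hs t ht h1

/-- H-data everywhere -/
def HR (R : Type u) [CommRing R] : Prop :=
  ∀ (p : Ideal R) [p.IsPrime], ∃ xs t n, HData (Localization.AtPrime p) xs t n

/-- natural height -/
noncomputable def hgt (p : PrimeSpectrum R) : ℕ := (heightE R p).toNat

lemma ringKrullDim_rp (p : PrimeSpectrum R) : ringKrullDim (Rp p) = (heightE R p : WithBot ℕ∞) := by
  rw [IsLocalization.AtPrime.ringKrullDim_eq_height p.asIdeal (Rp p),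
    PrimeSpectrum.height_eq_orderHeight]
  rfl

lemma heightE_eq (p : PrimeSpectrum R) : heightE R p = hgt p := by
  have h := ringKrullDim_rp p
  have : heightE R p ≠ ⊤ := by
    intro h0
    rw [h0] at h
    exact ringKrullDim_ne_top h
  exact (ENat.natCast_toNat this).symm

lemma le_hgt_of_dL {p : PrimeSpectrum R} [Module.Finite R M] [Nontrivial (Lo p M)] {j : ℕ}
    (h : dL p j M) : j ≤ hgt p := by
  obtain ⟨rs, h1, h2, h3⟩ := (dGE_iff_exists (S := Rp p) (M := Lo p M) j).1 h
  have h4 := Module.supportDim_add_length_eq_supportDim_of_isRegular rs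
    (IsRegular.of_isWeaklyRegular_of_mem_maximalIdeal (Lo p M) h2 h3)
  have h5 := Module.supportDim_le_ringKrullDim (Rp p) (Lo p M)
  rw [ringKrullDim_rp, heightE_eq, ← h4, h1] at h5
  have h6 : 0 ≤ Module.supportDim (Rp p) (Lo p M ⧸ (Ideal.ofList rs • ⊤ : Submodule (Rp p) (Lo p M))) := by
    haveI := Submodule.Quotient.nontrivial_iff.2 (IsRegular.of_isWeaklyRegular_of_mem_maximalIdeal (Lo p M) h2 h3).2.symm
    have := Module.supportDim_ne_bot_of_nontrivial (Rp p) (Lo p M ⧸ (Ideal.ofList rs • ⊤ : Submodule (Rp p) (Lo p M)))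
    obtain ⟨a, ha⟩ := WithBot.ne_bot_iff_exists.1 this
    rw [← ha]
    exact_mod_cast (bot_le : (0:ℕ∞) ≤ a)
  have h7 : (j : WithBot ℕ∞) ≤ ((hgt p : ℕ∞) : WithBot ℕ∞) :=
    le_trans (by simpa using add_le_add_left h6 (j : WithBot ℕ∞)) h5
  exact_mod_cast h7

lemma dL_self (H : HR R) (p : PrimeSpectrum R) : dL p (hgt p) R := by
  obtain ⟨xs, t, n, hd⟩ := H p.asIdeal
  have hr : IsRegular (Rp p) xs := IsRegular.of_isWeaklyRegular_of_mem_maximalIdeal _ hd.mem hd.reg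
  have h1 := ringKrullDim_add_length_eq_ringKrullDim_of_isRegular xs hr
  have h2 : ringKrullDim (Rp p ⧸ Ideal.ofList xs) ≤ 0 := by
    have : Ring.KrullDimLE 0 (Rp p ⧸ Ideal.ofList xs) := by
      refine Ring.KrullDimLE.mk₀ ?_
      intro I hI
      have hc : (Ideal.comap (Ideal.Quotient.mk (Ideal.ofList xs)) I).IsPrime := inferInstance
      have hle : Ideal.ofList xs ≤ Ideal.comap (Ideal.Quotient.mk (Ideal.ofList xs)) I := by
        intro a ha
        rw [Ideal.mem_comap, Ideal.Quotient.eq_zero_iff_mem.2 ha]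
        exact zero_mem _
      have ht := hc.mem_of_pow_mem n (hle hd.pow)
      have hm : maximalIdeal (Rp p) ≤ Ideal.comap (Ideal.Quotient.mk (Ideal.ofList xs)) I := by
        rw [hd.gen]
        exact sup_le hle ((Ideal.span_singleton_le_iff_mem _).2 ht)
      have hmax : (Ideal.comap (Ideal.Quotient.mk (Ideal.ofList xs)) I).IsMaximal := by
        rw [← (maximalIdeal.isMaximal (Rp p)).eq_of_le hc.ne_top hm]
        exact maximalIdeal.isMaximal (Rp p)
      have := Ideal.map_comap_of_surjective _ (Ideal.Quotient.mk_surjective (I := Ideal.ofList xs)) I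
      rw [← this]
      refine (Ideal.map_eq_top_or_isMaximal_of_surjective _ Ideal.Quotient.mk_surjective hmax).resolve_left ?_
      rw [this]
      exact hI.ne_top
    exact (Order.krullDimLE_iff 0 _).1 this
  rw [ringKrullDim_rp, heightE_eq] at h1
  have h3 : ((hgt p : ℕ∞) : WithBot ℕ∞) ≤ (xs.length : WithBot ℕ∞) := by
    rw [← h1]
    simpa using add_le_add_left h2 (xs.length : WithBot ℕ∞)
  have h4 : hgt p ≤ xs.length := by exact_mod_cast h3
  have h5 : dGE (Rp p) xs.length (Rp p) := (dGE_iff_exists _).2 ⟨xs, rfl, hd.mem, hd.reg⟩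
  have hloc : IsLoc p.asIdeal.primeCompl (⟨⟨algebraMap R (Rp p), map_add _⟩, fun a b => by simp⟩ : R →ₛₗ[algebraMap R (Rp p)] Rp p) := by
    constructor
    · intro a
      obtain ⟨r, s, rfl⟩ := IsLocalization.exists_mk'_eq p.asIdeal.primeCompl a
      refine ⟨s, s.2, r, ?_⟩
      show algebraMap R (Rp p) r = _
      rw [smul_eq_mul, mul_comm, IsLocalization.mk'_spec]
    · intro a ha
      have ha' : algebraMap R (Rp p) a = 0 := ha
      obtain ⟨c, hc⟩ := (IsLocalization.map_eq_zero_iff p.asIdeal.primeCompl (Rp p) a).1 ha'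
      exact ⟨c, c.2, hc⟩
  obtain ⟨e, -⟩ := hloc.unique (isLoc_locMap p.asIdeal.primeCompl R)
  exact dGE.mono (dGE_equiv e h5) h4

instance lo_ring_nontrivial (p : PrimeSpectrum R) : Nontrivial (Lo p R) := by
  by_contra hc
  rw [not_nontrivial_iff_subsingleton] at hc
  obtain ⟨s, hs, h⟩ := of_lo_subsingleton (p := p) (M := R) 1
  refine hs ?_
  have : s = 0 := by simpa using h
  rw [this]; exact zero_mem _

lemma hgt_mono {p q : PrimeSpectrum R} (h : p ≤ q) : hgt p ≤ hgt q := by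
  have := Order.height_mono h
  have h2 : heightE R p ≤ heightE R q := this
  rw [heightE_eq, heightE_eq] at h2
  exact_mod_cast h2

lemma hgt_strictMono {p q : PrimeSpectrum R} (h : p < q) : hgt p < hgt q := by
  have h2 : heightE R p < heightE R q := Order.height_strictMono h (by
    have := heightE_eq p
    unfold heightE at this
    rw [this]; exact ENat.natCast_lt_top _)
  rw [heightE_eq, heightE_eq] at h2
  exact_mod_cast h2

/-- regular sequences of length up to the height exist -/
lemma exists_regular_seq (H : HR R) (p : PrimeSpectrum R) (j : ℕ) (hj : j ≤ hgt p) :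
    ∃ xs : List R, xs.length = j ∧ (∀ x ∈ xs, x ∈ p.asIdeal) ∧ IsWeaklyRegular R xs := by
  induction j with
  | zero => exact ⟨[], rfl, by simp, IsWeaklyRegular.nil _ _⟩
  | succ j ih =>
    obtain ⟨xs, hl, hm, hreg⟩ := ih (by omega)
    obtain ⟨x, hx, hxr⟩ : ∃ x ∈ p.asIdeal, IsSMulRegular (R ⧸ (Ideal.ofList xs • ⊤ : Submodule R R)) x := by
      by_contra hc
      push Not at hc
      have hsub : (p.asIdeal : Set R) ⊆ ⋃ P ∈ associatedPrimes R (R ⧸ (Ideal.ofList xs • ⊤ : Submodule R R)), P := by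
        rw [biUnion_associatedPrimes_eq_compl_regular]
        exact fun x hx => hc x hx
      obtain ⟨P, hP, hle⟩ := (Ideal.subset_union_prime_finite (associatedPrimes.finite _ _) (f := id) 0 0
        (fun _ h _ _ => h.isPrime)).1 hsub
      have hPp : P.IsPrime := hP.isPrime
      let q : PrimeSpectrum R := ⟨P, hPp⟩
      have hpq : p ≤ q := hle
      obtain ⟨y, hy⟩ := ((isAssociatedPrime_iff).1 hP).2
      have hq : ¬ dL q 1 (R ⧸ (Ideal.ofList xs • ⊤ : Submodule R R)) := by
        refine not_dL_one y ?_ ?_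
        · intro a ha
          have ha' : a ∈ P := ha
          rw [hy] at ha'
          simpa using ha'
        · intro s hs h0
          refine hs ?_
          show s ∈ P
          rw [hy]
          simpa using h0
      rw [← dL_list xs (fun x hx => hpq (hm x hx)) hreg, hl] at hq
      exact hq ((dL_self H q).mono (by have := hgt_mono hpq; omega))
    refine ⟨xs ++ [x], by simp [hl], ?_, ?_⟩
    · intro a ha
      rcases List.mem_append.1 ha with h | h
      · exact hm a h
      · rw [List.mem_singleton.1 h]; exact hx
    · rw [isWeaklyRegular_append_iff]
      exact ⟨hreg, by simpa using hxr⟩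

lemma length_le_hgt {p : PrimeSpectrum R} {xs : List R} (hm : ∀ x ∈ xs, x ∈ p.asIdeal)
    (hreg : IsWeaklyRegular R xs) : xs.length ≤ hgt p := by
  refine le_hgt_of_dL (p := p) (M := R) ?_
  have := (dL_list (p := p) xs hm hreg 0).2 dL_zero
  simpa using this

lemma le_gradeE_iff (H : HR R) (p : PrimeSpectrum R) (j : ℕ) :
    (j : ℕ∞) ≤ gradeE R p.asIdeal ↔ j ≤ hgt p := by
  unfold gradeE
  rw [le_depthE_iff]
  constructor
  · rintro ⟨xs, rfl, hm, hreg⟩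
    exact length_le_hgt hm hreg
  · exact exists_regular_seq H p j

end PartFifteen

end Chunk15

section Chunk16
open scoped Pointwise
set_option linter.unusedSectionVars false
set_option linter.style.haveILetI false
section PartSixteen
open RingTheory.Sequence IsLocalRing

lemma not_dGE_two {S : Type u} [CommRing S] [IsLocalRing S] [IsNoetherianRing S]
    {M : Type u} [AddCommGroup M] [Module S M] [Module.Finite S M] {P : Ideal S}
    (hP : IsAssociatedPrime P M) (hadj : ∀ Q : Ideal S, Q.IsPrime → P < Q → Q = maximalIdeal S) :
    ¬ dGE S 2 M := by
  intro h2
  obtain ⟨x, hxm, hx⟩ := dGE_one_iff.1 (h2.mono one_le_two)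
  obtain ⟨y, hy⟩ := (isAssociatedPrime_iff.1 hP).2
  have hyP : ∀ a, a ∈ P ↔ a • y = 0 := by
    intro a; rw [hy]; simp
  have hy0 : y ≠ 0 := by
    rintro rfl
    exact hP.isPrime.ne_top ((Ideal.eq_top_iff_one _).2 ((hyP 1).2 (by simp)))
  have hxP : x ∉ P := by
    intro hx'
    exact hy0 ((isSMulRegular_iff_right_eq_zero_of_smul).1 hx _ ((hyP x).1 hx'))
  let U : Submodule S M :=
    { carrier := {u | ∀ a ∈ P, a • u = 0}
      add_mem' := fun ha hb c hc => by rw [smul_add, ha c hc, hb c hc, add_zero]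
      zero_mem' := fun c _ => smul_zero c
      smul_mem' := fun r u hu c hc => by rw [smul_comm, hu c hc, smul_zero] }
  obtain ⟨u, hu, hux⟩ : ∃ u ∈ U, ∀ w, u ≠ x • w := by
    by_contra hc
    push Not at hc
    have hle : U ≤ maximalIdeal S • U := by
      intro u hu
      obtain ⟨w, rfl⟩ := hc u hu
      refine Submodule.smul_mem_smul hxm ?_
      intro a ha
      have := hu a ha
      rw [smul_comm] at this
      exact (isSMulRegular_iff_right_eq_zero_of_smul).1 hx _ this
    have hb := Submodule.eq_bot_of_le_smul_of_le_jacobson_bot (maximalIdeal S) U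
      (IsNoetherian.noetherian _) hle (by rw [IsLocalRing.jacobson_eq_maximalIdeal _ bot_ne_top])
    have : y ∈ U := fun a ha => (hyP a).1 ha
    rw [hb] at this
    exact hy0 this
  have hub : (Submodule.mkQ (x • (⊤ : Submodule S M))) u ≠ 0 := by
    intro h0
    obtain ⟨w, -, hw⟩ := (Submodule.mem_smul_pointwise_iff_exists _ _ _).1
      ((Submodule.Quotient.mk_eq_zero _).1 h0)
    exact hux w hw.symm
  obtain ⟨Q, hQ, hle⟩ := exists_le_isAssociatedPrime_of_isNoetherianRing S _ hub
  have hPQ : P < Q := by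
    refine lt_of_le_of_ne ?_ ?_
    · intro a ha
      apply hle
      simp only [Submodule.mem_colon_singleton, Submodule.mem_bot]
      rw [← map_smul, hu a ha, map_zero]
    · rintro rfl
      apply hxP
      apply hle
      simp only [Submodule.mem_colon_singleton, Submodule.mem_bot]
      rw [← map_smul]
      exact (Submodule.Quotient.mk_eq_zero _).2 (Submodule.smul_mem_pointwise_smul _ _ _ trivial)
  have hQm := hadj Q hQ.isPrime hPQ
  obtain ⟨z, hz⟩ := (isAssociatedPrime_iff.1 hQ).2
  have hz0 : z = 0 := by
    refine socle_zero_of_dGE_one ((dGE_quot_iff hxm hx 1).1 h2) ?_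
    intro a ha
    rw [← hQm, hz] at ha
    simpa using ha
  rw [hz0] at hz
  refine hQ.isPrime.ne_top ((Ideal.eq_top_iff_one _).2 ?_)
  rw [hz]; simp

variable {R : Type u} [CommRing R] [IsNoetherianRing R]

lemma lo_regular_of_le {M : Type u} [AddCommGroup M] [Module R M] {p q : PrimeSpectrum R} (hpq : p ≤ q) {x : R}
    (h : IsSMulRegular (Lo q M) (algebraMap R (Rp q) x)) :
    IsSMulRegular (Lo p M) (algebraMap R (Rp p) x) := by
  have hMp := isLoc_locMap p.asIdeal.primeCompl M
  have hMq := isLoc_locMap q.asIdeal.primeCompl M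
  rw [isSMulRegular_iff_right_eq_zero_of_smul] at h ⊢
  intro n hn
  obtain ⟨s, hs, m, hm⟩ := hMp.1 n
  have : locMap p.asIdeal.primeCompl M (x • m) = 0 := by
    rw [LinearMap.map_smulₛₗ, hm, smul_comm, hn, smul_zero]
  obtain ⟨t, ht, h0⟩ := hMp.2 _ this
  have h1 := h (locMap q.asIdeal.primeCompl M (t • m)) (by
    rw [← LinearMap.map_smulₛₗ, smul_comm, h0, map_zero])
  obtain ⟨r, hr, h2⟩ := hMq.2 _ h1
  have hr' : r ∈ p.asIdeal.primeCompl := fun hh => hr (hpq hh)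
  refine unit_smul_inj (S := Rp p) (T := p.asIdeal.primeCompl) hs ?_
  rw [smul_zero, ← hm]
  refine unit_smul_inj (S := Rp p) (T := p.asIdeal.primeCompl) (s := r * t) (mul_mem hr' ht) ?_
  rw [← (locMap p.asIdeal.primeCompl M).map_smulₛₗ, mul_smul, h2]
  simp

lemma dL_adj {p q : PrimeSpectrum R} (hpq : p < q) (hadj : ∀ r, p ≤ r → r ≤ q → r = p ∨ r = q) (j : ℕ) :
    ∀ (M : Type u) [AddCommGroup M] [Module R M] [Module.Finite R M], dL q (j+1) M → dL p j M := by
  induction j with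
  | zero => intro M _ _ _ _; exact dL_zero
  | succ j ih =>
    intro M _ _ _ h
    by_cases hex : ∃ x ∈ p.asIdeal, IsSMulRegular (Lo q M) (algebraMap R (Rp q) x)
    · obtain ⟨x, hx, hreg⟩ := hex
      rw [dL_quot hx (lo_regular_of_le hpq.le hreg)]
      exact ih _ ((dL_quot (hpq.le hx) hreg _).1 h)
    · exfalso
      push Not at hex
      let p' : Ideal (Rp q) := p.asIdeal.map (algebraMap R (Rp q))
      have hsub : (p' : Set (Rp q)) ⊆ ⋃ P ∈ associatedPrimes (Rp q) (Lo q M), P := by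
        rw [biUnion_associatedPrimes_eq_compl_regular]
        intro y hy
        obtain ⟨⟨⟨x, hx⟩, s⟩, e⟩ := (IsLocalization.mem_map_algebraMap_iff q.asIdeal.primeCompl (Rp q)).1 hy
        intro hreg
        refine hex x hx ?_
        have e' : y * algebraMap R (Rp q) s = algebraMap R (Rp q) x := e
        rw [← e']
        have hu : IsUnit (algebraMap R (Rp q) s) := IsLocalization.map_units (Rp q) s
        exact IsSMulRegular.mul hreg (hu.isSMulRegular _)
      obtain ⟨P, hP, hle⟩ := (Ideal.subset_union_prime_finite (associatedPrimes.finite _ _) (f := id) 0 0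
        (fun _ h _ _ => h.isPrime)).1 hsub
      have hPp : P.IsPrime := hP.isPrime
      have hcm : ∀ (Q : Ideal (Rp q)), Q.IsPrime → Q.comap (algebraMap R (Rp q)) = q.asIdeal → Q = maximalIdeal (Rp q) := by
        intro Q hQ h
        refine (IsLocalization.map_under q.asIdeal.primeCompl (Rp q) Q).symm.trans ?_
        exact (congrArg (Ideal.map (algebraMap R (Rp q))) h).trans Localization.AtPrime.map_eq_maximalIdeal
      have hPle : ∀ (Q : Ideal (Rp q)), Q.IsPrime → Q.comap (algebraMap R (Rp q)) ≤ q.asIdeal := by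
        intro Q hQ
        exact (Ideal.comap_mono (le_maximalIdeal hQ.ne_top)).trans
          (IsLocalization.AtPrime.under_maximalIdeal (Rp q) q.asIdeal).le
      have hPm : P ≠ maximalIdeal (Rp q) := by
        rintro rfl
        obtain ⟨z, hz⟩ := (isAssociatedPrime_iff.1 hP).2
        have hz0 : z = 0 := by
          refine socle_zero_of_dGE_one (dGE.mono h (by omega)) ?_
          intro a ha
          rw [hz] at ha
          simpa using ha
        rw [hz0] at hz
        refine hP.isPrime.ne_top ((Ideal.eq_top_iff_one _).2 ?_)
        rw [hz]; simp
      have hmain : ∀ (Q : Ideal (Rp q)), Q.IsPrime → p' ≤ Q → Q.comap (algebraMap R (Rp q)) = p.asIdeal ∨ Q = maximalIdeal (Rp q) := by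
        intro Q hQ hpQ
        have hc : (Q.comap (algebraMap R (Rp q))).IsPrime := inferInstance
        rcases hadj ⟨_, hc⟩ (Ideal.map_le_iff_le_comap.1 hpQ) (hPle Q hQ) with h | h
        · left; exact congrArg PrimeSpectrum.asIdeal h
        · right; exact hcm Q hQ (congrArg PrimeSpectrum.asIdeal h)
      have hPc := (hmain P hPp hle).resolve_right hPm
      refine not_dGE_two hP ?_ (dGE.mono h (by omega))
      intro Q hQ hPQ
      refine (hmain Q hQ (le_trans hle hPQ.le)).resolve_left ?_
      intro hc
      refine hPQ.ne ?_
      refine (IsLocalization.map_under q.asIdeal.primeCompl (Rp q) P).symm.trans ?_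
      refine Eq.trans ?_ (IsLocalization.map_under q.asIdeal.primeCompl (Rp q) Q)
      exact congrArg (Ideal.map (algebraMap R (Rp q))) (hPc.trans hc.symm)

lemma dL_gen (k : ℕ) : ∀ {p q : PrimeSpectrum R}, p ≤ q → hgt q - hgt p ≤ k → ∀ (j : ℕ)
    (M : Type u) [AddCommGroup M] [Module R M] [Module.Finite R M], dL q (j + (hgt q - hgt p)) M → dL p j M := by
  induction k with
  | zero =>
    intro p q hpq hk j M _ _ _ h
    rcases hpq.eq_or_lt with rfl | hlt
    · exact h.mono (by omega)
    · have := hgt_strictMono hlt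
      omega
  | succ k ih =>
    intro p q hpq hk j M _ _ _ h
    rcases hpq.eq_or_lt with rfl | hlt
    · exact h.mono (by omega)
    · have h1 := hgt_strictMono hlt
      by_cases hadj : ∀ r, p ≤ r → r ≤ q → r = p ∨ r = q
      · exact dL_adj hlt hadj j M (h.mono (by omega))
      · push Not at hadj
        obtain ⟨r, hpr, hrq, hne, hne'⟩ := hadj
        have h2 := hgt_strictMono (lt_of_le_of_ne hpr hne.symm)
        have h3 := hgt_strictMono (lt_of_le_of_ne hrq hne')
        exact ih hpr (by omega) j M (ih hrq (by omega) _ M (h.mono (by omega)))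

lemma IPD_sub_sing (M : ModuleCat.{u} R) [Module.Finite R M] : IPD R M ⊆ SingLocus R := by
  intro p hp hreg
  rw [mem_IPD_iff] at hp
  obtain ⟨d, hd⟩ := finpd_of_reg (S := Rp p) hreg
  exact hp d (hd (Lo p M))

lemma psi_sub (H : HR R) {𝒳 : Set (ModuleCat.{u} R)} (hr : IsResolving R 𝒳)
    (d : PrimeSpectrum R → ℕ) (hd : ∀ p, ∃ X ∈ 𝒳, ¬ dL p (d p + 1) X)
    (M : ModuleCat.{u} R) [Module.Finite R M] (hdL : ∀ p, dL p (d p) M)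
    (hipd : IPD R M ⊆ IPDcat R 𝒳) : M ∈ 𝒳 := by
  have key : In 𝒳 M := by
    refine global_main (M := M) hr H ?_ ?_
    · intro p hp
      obtain ⟨X, hX, hn⟩ := hd ⟨p, hp⟩
      refine ⟨X, hX, fun j hj => ?_⟩
      have hj' : dL ⟨p, hp⟩ j X := hj
      have : dL ⟨p, hp⟩ j M := by
        refine dL.mono (hdL ⟨p, hp⟩) ?_
        by_contra hc
        exact hn (hj'.mono (by omega))
      exact this
    · intro p hp hM
      have : (⟨p, hp⟩ : PrimeSpectrum R) ∈ IPD R M := (mem_IPD_iff M ⟨p, hp⟩).2 hM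
      obtain ⟨X, hX, hpX⟩ := Set.mem_iUnion₂.1 (hipd this)
      haveI := hr.fg X hX
      exact ⟨X, hX, (mem_IPD_iff X ⟨p, hp⟩).1 hpX⟩
  exact key

lemma psi_cond (p : PrimeSpectrum R) (n : ℕ) (M : ModuleCat.{u} R) [Module.Finite R M] :
    heightE R p - (n : ℕ∞) ≤ localDepth R p M ↔ dL p (hgt p - n) M := by
  rw [heightE_eq, ← ENat.natCast_sub, le_localDepth_iff]

theorem first_half (H : HR R) {𝒳 : Set (ModuleCat.{u} R)} (hr : IsResolving R 𝒳) :
    SpecClosed R (IPDcat R 𝒳) ∧ IPDcat R 𝒳 ⊆ SingLocus R ∧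
      ∃ f : PrimeSpectrum R → ℕ, GradeConsistent R f ∧
        (∀ p, (f p : ℕ∞) = heightE R p - ⨅ X ∈ 𝒳, localDepth R p X) ∧
        PsiHyp R (IPDcat R 𝒳) f = 𝒳 := by
  classical
  refine ⟨IPDcat_specClosed hr, ?_, ?_⟩
  · intro p hp
    obtain ⟨M, hM, hp⟩ := Set.mem_iUnion₂.1 hp
    haveI := hr.fg M hM
    exact IPD_sub_sing M hp
  have hR : In 𝒳 R := hr.proj
  obtain ⟨d, hd, hdle, hDle⟩ : ∃ d : PrimeSpectrum R → ℕ, (∀ p, ∀ X ∈ 𝒳, dL p (d p) X) ∧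
      (∀ p, d p ≤ hgt p) ∧ ∀ p j, (∀ X ∈ 𝒳, dL p j X) → j ≤ d p := by
    refine ⟨fun p => Nat.findGreatest (fun j => ∀ X ∈ 𝒳, dL p j X) (hgt p), ?_, ?_, ?_⟩
    · exact fun p => Nat.findGreatest_spec (P := fun j => ∀ X ∈ 𝒳, dL p j X) (Nat.zero_le _)
        (fun X _ => dL_zero)
    · exact fun p => Nat.findGreatest_le _
    · intro p j h
      refine Nat.le_findGreatest ?_ h
      exact le_hgt_of_dL (M := R) (h _ hR)
  have hinf : ∀ p, ⨅ X ∈ 𝒳, localDepth R p X = d p := by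
    intro p
    refine le_antisymm ?_ ?_
    · refine ENat.forall_natCast_le_iff_le.1 ?_
      intro j hj
      have : ∀ X ∈ 𝒳, dL p j X := by
        intro X hX
        haveI := hr.fg X hX
        exact (le_localDepth_iff p X j).1 (hj.trans (iInf₂_le X hX))
      exact_mod_cast hDle p j this
    · refine le_iInf₂ fun X hX => ?_
      haveI := hr.fg X hX
      exact (le_localDepth_iff p X _).2 (hd p X hX)
  refine ⟨fun p => hgt p - d p, ⟨?_, ?_⟩, ?_, ?_⟩
  · intro p
    exact (le_gradeE_iff H p _).2 (Nat.sub_le _ _)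
  · intro p q hpq
    have hpq' : p ≤ q := hpq
    have hh := hgt_mono hpq'
    have : d q ≤ d p + (hgt q - hgt p) := by
      by_contra hc
      have : ∀ X ∈ 𝒳, dL p (d p + 1) X := by
        intro X hX
        haveI := hr.fg X hX
        exact dL_gen _ hpq' le_rfl _ X ((hd q X hX).mono (by omega))
      have := hDle _ _ this
      omega
    have := hdle p
    have := hdle q
    show hgt p - d p ≤ hgt q - d q
    omega
  · intro p
    rw [hinf, heightE_eq]
    exact ENat.natCast_sub _ _
  · ext M
    constructor
    · rintro ⟨hfin, hipd, hdep⟩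
      haveI : Module.Finite R M := hfin
      refine psi_sub H hr d ?_ M ?_ hipd
      · intro p
        by_contra hc
        push Not at hc
        have := hDle p _ hc
        omega
      · intro p
        have h1 := (psi_cond p _ M).1 (hdep p)
        have h2 := hdle p
        exact h1.mono (by dsimp only; omega)
    · intro hM
      haveI := hr.fg M hM
      refine ⟨inferInstance, Set.subset_iUnion₂ (s := fun M _ => IPD R M) M hM, fun p => ?_⟩
      refine (psi_cond p _ M).2 ((hd p M hM).mono ?_)
      have := hdle p
      dsimp only
      omega

end PartSixteen

end Chunk16

section Chunk17
open scoped Pointwise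
set_option linter.unusedSectionVars false
set_option linter.style.haveILetI false
section PartSeventeen
open RingTheory.Sequence IsLocalRing
variable {R : Type u} [CommRing R] [IsNoetherianRing R]
variable {A B C F Y M N : Type u} [AddCommGroup A] [Module R A] [AddCommGroup B] [Module R B]
variable [AddCommGroup C] [Module R C] [AddCommGroup F] [Module R F] [AddCommGroup Y] [Module R Y]
variable [AddCommGroup M] [Module R M] [AddCommGroup N] [Module R N]

lemma dL_prod {p : PrimeSpectrum R} {j : ℕ} (hA : dL p j A) (hB : dL p j B) : dL p j (A × B) := by
  refine dL.mid (f := LinearMap.inl R A B) (g := LinearMap.snd R A B) ?_ hA hB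
  refine IsSES.mk' (fun a h => ?_) (fun c => ⟨(0, c), rfl⟩) (fun a => rfl) (fun b h => ⟨b.1, ?_⟩)
  · simpa using h
  · have h' : b.2 = 0 := h
    exact Prod.ext rfl h'.symm

lemma dL_pi {p : PrimeSpectrum R} {j : ℕ} (h : dL p j R) (n : ℕ) : dL p j (Fin n → R) := by
  induction n with
  | zero => exact dL_of_zero (fun m => ⟨1, fun h => p.2.ne_top ((Ideal.eq_top_iff_one _).2 h), Subsingleton.elim _ _⟩) j
  | succ n ih => exact dL_equiv (Fin.consLinearEquiv R (fun _ : Fin (n+1) => R)) (dL_prod h ih)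

lemma dL_proj (H : HR R) (p : PrimeSpectrum R) [Module.Finite R N] [Module.Projective R N] :
    dL p (hgt p) N := by
  obtain ⟨n, g, hg⟩ := exists_cover (R := R) N
  obtain ⟨σ, hσ⟩ := proj_lift hg (LinearMap.id : N →ₗ[R] N)
  exact dL_retract σ g hσ (dL_pi (dL_self H p) n)

/-- syzygy step for depth -/
lemma dL_syz (H : HR R) {p : PrimeSpectrum R} {f : A →ₗ[R] B} {g : B →ₗ[R] C} (s : IsSES f g)
    [Module.Finite R B] [Module.Projective R B] {j : ℕ} (hj : j + 1 ≤ hgt p) (hC : dL p j C) :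
    dL p (j + 1) A :=
  dL.left s ((dL_proj H p).mono hj) hC

lemma dL_syz' (H : HR R) {p : PrimeSpectrum R} {f : A →ₗ[R] B} {g : B →ₗ[R] C} (s : IsSES f g)
    [Module.Finite R B] [Module.Projective R B] {j : ℕ} (hj : j ≤ hgt p) (hC : dL p j C) :
    dL p j A := by
  cases j with
  | zero => exact dL_zero
  | succ j => exact dL_syz H s hj (hC.mono (Nat.le_succ j))

theorem psi_resolving (H : HR R) (W : Set (PrimeSpectrum R)) (f : PrimeSpectrum R → ℕ) :
    IsResolving R (PsiHyp R W f) := by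
  have key : ∀ M : ModuleCat.{u} R, M ∈ PsiHyp R W f ↔ Module.Finite R M ∧
      (∀ p ∉ W, ∃ n, M ∈ SyzN n (locT (PJ R) p.asIdeal.primeCompl)) ∧
      ∀ p, dL p (hgt p - f p) M := by
    intro M
    constructor
    · rintro ⟨h1, h2, h3⟩
      haveI := h1
      refine ⟨h1, fun p hp => ?_, fun p => (psi_cond p _ M).1 (h3 p)⟩
      by_contra hc
      push Not at hc
      exact hp (h2 ((mem_IPD_iff' M p).2 hc))
    · rintro ⟨h1, h2, h3⟩
      haveI := h1
      refine ⟨h1, fun p hp => ?_, fun p => (psi_cond p _ M).2 (h3 p)⟩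
      by_contra hc
      obtain ⟨n, hn⟩ := h2 p hc
      exact (mem_IPD_iff' M p).1 hp n hn
  have hL : ∀ (p : PrimeSpectrum R) n, IsResolving R (SyzN n (locT (PJ R) p.asIdeal.primeCompl)) :=
    fun p n => ((PJ_resolving (R := R)).locT _).syzN n
  constructor
  · intro M hM
    exact hM.1
  · intro M N ⟨e⟩ hM
    rw [key] at hM ⊢
    obtain ⟨h1, h2, h3⟩ := hM
    refine ⟨Module.Finite.equiv e, fun p hp => ?_, fun p => dL_equiv e (h3 p)⟩
    obtain ⟨n, hn⟩ := h2 p hp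
    exact ⟨n, (hL p n).iso_closed M N ⟨e⟩ hn⟩
  · intro M h1 h2
    rw [key]
    refine ⟨h1, fun p _ => ⟨0, (hL p 0).proj_mem M h1 h2⟩, fun p => ?_⟩
    exact (dL_proj H p).mono (Nat.sub_le _ _)
  · intro M N hM
    rw [key] at hM ⊢
    obtain ⟨h1, h2, h3⟩ := hM
    haveI : Module.Finite R (M × N) := h1
    refine ⟨Module.Finite.of_surjective (LinearMap.fst R M N) LinearMap.fst_surjective,
      fun p hp => ?_, fun p => ?_⟩
    · obtain ⟨n, hn⟩ := h2 p hp
      exact ⟨n, (hL p n).summand_closed M N hn⟩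
    · exact dL_retract (LinearMap.inl R M N) (LinearMap.fst R M N) (fun _ => rfl) (h3 p)
  · intro A B C f g s hA hC
    rw [key] at hA hC ⊢
    obtain ⟨h1, h2, h3⟩ := hA
    obtain ⟨h1', h2', h3'⟩ := hC
    refine ⟨s.finite_mid h1 h1', fun p hp => ?_, fun p => dL.mid s (h3 p) (h3' p)⟩
    obtain ⟨n, hn⟩ := h2 p hp
    obtain ⟨n', hn'⟩ := h2' p hp
    have hl : IsResolving R (locT (PJ R) p.asIdeal.primeCompl) := (PJ_resolving (R := R)).locT _
    exact ⟨max n n', (hL p _).ext_closed A B C f g s (hl.syzN_le (le_max_left _ _) hn)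
      (hl.syzN_le (le_max_right _ _) hn')⟩
  · intro K P M f g s hK hP hP' hM
    rw [key] at hM ⊢
    obtain ⟨h1, h2, h3⟩ := hM
    refine ⟨hK, fun p hp => ?_, fun p => dL_syz' H s (Nat.sub_le _ _) (h3 p)⟩
    obtain ⟨n, hn⟩ := h2 p hp
    exact ⟨n, (hL p n).syzygy_closed K P M f g s hK hP hP' hn⟩

lemma dL_locT (H : HR R) {q : PrimeSpectrum R} (h : In (locT (PJ R) q.asIdeal.primeCompl) M) :
    dL q (hgt q) M := by
  obtain ⟨hfin, s, hs, X, hX, α, β, hαβ⟩ := in_locT.1 h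
  obtain ⟨h1, h2⟩ := in_PJ.1 hX
  haveI := h1
  haveI := h2
  have hP : dL q (hgt q) X := dL_proj H q
  obtain ⟨α', hα'⟩ := IsLoc.map (isLoc_locMap q.asIdeal.primeCompl M)
    (locMap q.asIdeal.primeCompl X) α
  obtain ⟨β', hβ'⟩ := IsLoc.map (isLoc_locMap q.asIdeal.primeCompl X)
    (locMap q.asIdeal.primeCompl M) β
  obtain ⟨v, hv⟩ := IsLocalization.map_units (Rp q) (⟨s, hs⟩ : q.asIdeal.primeCompl)
  have hcomp : β' ∘ₗ α' = algebraMap R (Rp q) s • LinearMap.id := by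
    refine IsLoc.ext (isLoc_locMap q.asIdeal.primeCompl M) fun m => ?_
    simp only [LinearMap.comp_apply, hα', hβ', LinearMap.smul_apply, LinearMap.id_apply, hαβ]
    exact (locMap q.asIdeal.primeCompl M).map_smulₛₗ _ _
  refine dGE_of_retract α' (((v⁻¹ : (Rp q)ˣ) : Rp q) • β') ?_ hP
  intro m
  have := LinearMap.congr_fun hcomp m
  simp only [LinearMap.comp_apply, LinearMap.smul_apply, LinearMap.id_apply] at this ⊢
  rw [this, ← hv, smul_smul, Units.inv_mul, one_smul]

lemma dL_of_Ex {p : PrimeSpectrum R} {π : F →ₗ[R] Y} (hπ : Function.Surjective π) {a : R}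
    (ha : a ∈ p.asIdeal) {j : ℕ} (h : dL p j (Ex π a)) : dL p j Y := by
  set T := p.asIdeal.primeCompl with hT
  obtain ⟨f', π', s', -, hπ'⟩ := IsLoc.ses (isSES_ker π hπ)
    (isLoc_locMap T (LinearMap.ker π)) (isLoc_locMap T F) (isLoc_locMap T Y)
  let ψ : Ex π a →ₛₗ[algebraMap R (Rp p)] Ex π' (algebraMap R (Rp p) a) :=
    { toFun := fun x => ⟨(locMap T F x.1.1, locMap T Y x.1.2), by
        have hx : π x.1.1 = a • x.1.2 := mem_pb.1 x.2
        refine mem_pb.2 ?_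
        show π' (locMap T F x.1.1) = algebraMap R (Rp p) a • locMap T Y x.1.2
        rw [hπ', hx]
        exact (locMap T Y).map_smulₛₗ _ _⟩
      map_add' := fun x y => by
        apply Subtype.ext
        exact Prod.ext (map_add _ _ _) (map_add _ _ _)
      map_smul' := fun r x => by
        apply Subtype.ext
        exact Prod.ext ((locMap T F).map_smulₛₗ _ _) ((locMap T Y).map_smulₛₗ _ _) }
  have hψ : IsLoc T ψ := by
    constructor
    · rintro ⟨⟨v, w⟩, hvw⟩
      have hvw' : π' v = algebraMap R (Rp p) a • w := mem_pb.1 hvw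
      obtain ⟨s1, hs1, f, hf⟩ := (isLoc_locMap T F).1 v
      obtain ⟨s2, hs2, y, hy⟩ := (isLoc_locMap T Y).1 w
      have h0 : locMap T Y (π (s2 • f) - a • (s1 • y)) = 0 := by
        rw [map_sub, ← hπ', (locMap T F).map_smulₛₗ, (locMap T Y).map_smulₛₗ,
          (locMap T Y).map_smulₛₗ, hf, hy, map_smul, map_smul, hvw']
        simp only [smul_smul]
        rw [sub_eq_zero]
        congr 1
        ring
      obtain ⟨s3, hs3, h3⟩ := (isLoc_locMap T Y).2 _ h0
      refine ⟨s3 * s2 * s1, T.mul_mem (T.mul_mem hs3 hs2) hs1,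
        ⟨((s3 * s2) • f, (s3 * s1) • y), mem_pb.2 ?_⟩, ?_⟩
      · show π ((s3 * s2) • f) = a • ((s3 * s1) • y)
        rw [smul_sub, sub_eq_zero, map_smul] at h3
        rw [map_smul, mul_smul, h3, smul_smul, smul_smul, smul_smul]
        congr 1
        ring
      · apply Subtype.ext
        refine Prod.ext ?_ ?_
        · show locMap T F ((s3 * s2) • f) = algebraMap R (Rp p) (s3 * s2 * s1) • v
          rw [(locMap T F).map_smulₛₗ, hf, smul_smul, ← map_mul]
        · show locMap T Y ((s3 * s1) • y) = algebraMap R (Rp p) (s3 * s2 * s1) • w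
          rw [(locMap T Y).map_smulₛₗ, hy, smul_smul, ← map_mul]
          congr 2
          ring
    · rintro ⟨⟨f, y⟩, hfy⟩ h0
      have h1 : locMap T F f = 0 := congrArg (fun z => z.1.1) h0
      have h2 : locMap T Y y = 0 := congrArg (fun z => z.1.2) h0
      obtain ⟨s, hs, h1⟩ := (isLoc_locMap T F).2 _ h1
      obtain ⟨t, ht, h2⟩ := (isLoc_locMap T Y).2 _ h2
      refine ⟨s * t, T.mul_mem hs ht, Subtype.ext (Prod.ext ?_ ?_)⟩
      · show (s * t) • f = 0
        rw [mul_comm, mul_smul, h1, smul_zero]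
      · show (s * t) • y = 0
        rw [mul_smul, h2, smul_zero]
  obtain ⟨e, -⟩ := (isLoc_locMap T (Ex π a)).unique hψ
  have h' : dGE (Rp p) j (Ex π' (algebraMap R (Rp p) a)) := dGE_equiv e h
  exact dGE_of_Ex s'.2.1 ((IsLocalization.AtPrime.to_map_mem_maximal_iff (Rp p) p.asIdeal a).2 ha) h'

end PartSeventeen

end Chunk17

section Chunk18
open scoped Pointwise
set_option linter.unusedSectionVars false
set_option linter.style.haveILetI false
section PartEighteen
open RingTheory.Sequence IsLocalRing
variable {R : Type u} [CommRing R] [IsNoetherianRing R]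

lemma dL_SyzN (H : HR R) (q : PrimeSpectrum R) (n : ℕ) : ∀ (Z : Type u) [AddCommGroup Z] [Module R Z],
    In (SyzN n (PJ R)) Z → dL q (hgt q - n) Z := by
  induction n with
  | zero =>
    intro Z _ _ hZ
    obtain ⟨h1, h2⟩ := in_PJ.1 hZ
    exact dL_proj H q
  | succ n ih =>
    intro Z _ _ hZ
    obtain ⟨m, g, hg, hK⟩ := (in_Syz1 (M := Z)).1 hZ
    have h1 := ih _ hK
    by_cases hc : hgt q - n = 0
    · have : hgt q - (n+1) = 0 := by omega
      rw [this]
      exact dL_zero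
    · have h2 : hgt q - n = (hgt q - (n+1)) + 1 := by omega
      rw [h2] at h1
      exact dL.right (isSES_ker g hg) h1 ((dL_proj H q).mono (Nat.sub_le _ _))

lemma attain_list {p : PrimeSpectrum R} {n j : ℕ} (as : List R) (has : ∀ a ∈ as, a ∈ p.asIdeal)
    (Y : ModuleCat.{u} R) (hY : Y ∈ SyzN n (PJ R)) (hd : ¬ dL p j Y) :
    ∃ X : ModuleCat.{u} R, X ∈ SyzN n (PJ R) ∧ ¬ dL p j X ∧
      ∀ q : PrimeSpectrum R, (∃ a ∈ as, a ∉ q.asIdeal) → X ∈ locT (PJ R) q.asIdeal.primeCompl := by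
  have hP : IsResolving R (PJ R) := PJ_resolving
  induction as with
  | nil => exact ⟨Y, hY, hd, by simp⟩
  | cons a as ih =>
    obtain ⟨X, hX, hdX, hloc⟩ := ih (fun b hb => has b (List.mem_cons_of_mem _ hb))
    haveI := (hP.syzN n).fg X hX
    obtain ⟨m, π, hπ⟩ := exists_cover (R := R) X
    have s := isSES_ker π hπ
    have key : ∀ 𝒳 : Set (ModuleCat.{u} R), IsResolving R 𝒳 → X ∈ 𝒳 → In 𝒳 (Ex π a) := by
      intro 𝒳 hr hX
      exact hr.ext (Ex_ses_snd s a) (hr.syz s hX) hX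
    have hE := key _ (hP.syzN n) hX
    refine ⟨ModuleCat.of R (Ex π a), hE, ?_, ?_⟩
    · exact fun h => hdX (dL_of_Ex hπ (has a List.mem_cons_self) h)
    · rintro q ⟨b, hb, hbq⟩
      rcases List.mem_cons.1 hb with rfl | hb
      · exact in_locT.2 ⟨(hP.syzN n).finite hE, b, hbq, Ex_fac hP π b⟩
      · exact key _ (hP.locT _) (hloc q ⟨b, hb, hbq⟩)

/-- a module in `Ψ(W, f)` whose depth at `p` is exactly `ht p - f p`. -/
lemma attain (H : HR R) (W : Set (PrimeSpectrum R)) {f : PrimeSpectrum R → ℕ}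
    (hf : GradeConsistent R f) (p : PrimeSpectrum R) :
    ∃ X ∈ PsiHyp R W f, ¬ dL p (hgt p - f p + 1) X := by
  have hP : IsResolving R (PJ R) := PJ_resolving
  have hfp : f p ≤ hgt p := (le_gradeE_iff H p _).1 (hf.1 p)
  obtain ⟨xs, hlen, hxs, hreg⟩ := exists_regular_seq H p (f p) hfp
  have hR : In (PJ R) R := hP.proj
  have hY := quot_list_in xs (PJ R) hP R hR hreg
  rw [hlen] at hY
  have hd : ¬ dL p (hgt p - f p + 1) (R ⧸ (Ideal.ofList xs • ⊤ : Submodule R R)) := by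
    intro h
    have := (dL_list xs hxs hreg _).2 h
    have := le_hgt_of_dL (M := R) this
    omega
  obtain ⟨S, hS⟩ := (IsNoetherian.noetherian p.asIdeal : p.asIdeal.FG)
  have hmem : ∀ a ∈ S.toList, a ∈ p.asIdeal := fun a ha =>
    hS ▸ Submodule.subset_span (Finset.mem_toList.1 ha)
  obtain ⟨X, hX, hdX, hloc⟩ := attain_list S.toList hmem (ModuleCat.of R _) hY hd
  haveI : Module.Finite R X := (hP.syzN _).fg X hX
  refine ⟨X, ⟨inferInstance, ?_, ?_⟩, hdX⟩
  · intro q hq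
    exact absurd (SyzN_mono _ (subset_locT hP _) hX) ((mem_IPD_iff' X q).1 hq (f p))
  · intro q
    refine (psi_cond q _ X).2 ?_
    by_cases hpq : p.asIdeal ≤ q.asIdeal
    · have := hf.2 p q hpq
      exact (dL_SyzN H q _ X hX).mono (by omega)
    · have : ∃ a ∈ S.toList, a ∉ q.asIdeal := by
        by_contra hc
        push Not at hc
        refine hpq ?_
        rw [← hS]
        exact Submodule.span_le.2 fun a ha => hc a (Finset.mem_toList.2 ha)
      exact (dL_locT H (hloc q this)).mono (Nat.sub_le _ _)

lemma psi_inf (H : HR R) (W : Set (PrimeSpectrum R)) {f : PrimeSpectrum R → ℕ}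
    (hf : GradeConsistent R f) (p : PrimeSpectrum R) :
    (f p : ℕ∞) = heightE R p - ⨅ X ∈ PsiHyp R W f, localDepth R p X := by
  have hfp : f p ≤ hgt p := (le_gradeE_iff H p _).1 (hf.1 p)
  have hinf : ⨅ X ∈ PsiHyp R W f, localDepth R p X = ((hgt p - f p : ℕ) : ℕ∞) := by
    refine le_antisymm ?_ ?_
    · obtain ⟨X, hX, hd⟩ := attain H W hf p
      haveI : Module.Finite R X := hX.1
      refine (iInf₂_le X hX).trans ?_
      refine ENat.forall_natCast_le_iff_le.1 ?_
      intro j hj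
      have := (le_localDepth_iff p X j).1 hj
      by_contra hc
      refine hd (this.mono ?_)
      have : ¬ j ≤ hgt p - f p := fun h => hc (by exact_mod_cast h)
      omega
    · refine le_iInf₂ fun X hX => ?_
      haveI : Module.Finite R X := hX.1
      exact (le_localDepth_iff p X _).2 ((psi_cond p _ X).1 (hX.2.2 p))
  rw [hinf, heightE_eq, ← ENat.natCast_sub]
  congr 1
  omega

end PartEighteen

end Chunk18

section Chunk19
open scoped Pointwise
set_option linter.unusedSectionVars false
set_option linter.style.haveILetI false
section PartNineteen
open RingTheory.Sequence IsLocalRing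
variable {R : Type u} [CommRing R] [IsNoetherianRing R]

lemma one_notMem (p : PrimeSpectrum R) : (1 : R) ∉ p.asIdeal :=
  fun h => p.2.ne_top ((Ideal.eq_top_iff_one _).2 h)

lemma mul_notMem {p : PrimeSpectrum R} {a b : R} (ha : a ∉ p.asIdeal) (hb : b ∉ p.asIdeal) :
    a * b ∉ p.asIdeal := fun h => (p.2.mem_or_mem h).elim ha hb

/-- comparison of depths along a generic filtration at a prime minimal in the support. -/
lemma depth_compare (q : PrimeSpectrum R) (N : Type u) [AddCommGroup N] [Module R N]
    [hN : Module.Finite R N] (h0 : ∀ P : PrimeSpectrum R, P < q → ∀ m : N, ∃ s ∉ P.asIdeal, s • m = 0) :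
    ∃ s ∉ q.asIdeal, ∀ Q : PrimeSpectrum R, q ≤ Q → s ∉ Q.asIdeal → ∀ j,
      (dL Q j (R ⧸ q.asIdeal) → dL Q j N) ∧
      ((∃ m : N, ∀ t ∉ q.asIdeal, t • m ≠ 0) → dL Q j N → dL Q j (R ⧸ q.asIdeal)) := by
  revert h0
  induction hN using IsNoetherianRing.induction_on_isQuotientEquivQuotientPrime R with
  | subsingleton N =>
    intro h0
    refine ⟨1, one_notMem q, fun Q _ _ j => ⟨fun _ => ?_, ?_⟩⟩
    · exact dL_of_zero (fun m => ⟨1, one_notMem Q, Subsingleton.elim _ _⟩) j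
    · rintro ⟨m, hm⟩
      exact absurd (Subsingleton.elim _ _) (hm 1 (one_notMem q))
  | quotient N p e =>
    intro h0
    by_cases hpq : p.asIdeal ≤ q.asIdeal
    · by_cases heq : p = q
      · subst heq
        exact ⟨1, one_notMem p, fun Q _ _ j => ⟨dL_equiv e.symm, fun _ => dL_equiv e⟩⟩
      · exfalso
        obtain ⟨s, hs, h⟩ := h0 p (lt_of_le_of_ne hpq heq) (e.symm 1)
        refine hs ?_
        rw [← map_smul, LinearEquiv.map_eq_zero_iff] at h
        have : (Ideal.Quotient.mk p.asIdeal s) = 0 := by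
          simpa [Algebra.smul_def] using h
        exact Ideal.Quotient.eq_zero_iff_mem.1 this
    · obtain ⟨s, hsp, hsq⟩ := Set.not_subset.1 hpq
      have hk : ∀ m : N, s • m = 0 := by
        intro m
        refine e.injective ?_
        rw [map_smul, map_zero]
        obtain ⟨r, hr⟩ := Ideal.Quotient.mk_surjective (e m)
        rw [← hr, Algebra.smul_def]
        show Ideal.Quotient.mk p.asIdeal s * _ = 0
        rw [Ideal.Quotient.eq_zero_iff_mem.2 hsp, zero_mul]
      refine ⟨s, hsq, fun Q _ hsQ j => ⟨fun _ => dL_of_zero (fun m => ⟨s, hsQ, hk m⟩) j, ?_⟩⟩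
      rintro ⟨m, hm⟩
      exact absurd (hk m) (hm s hsq)
  | exact N₁ N₂ N₃ f g hf hg hfg h1 h3 =>
    intro h0
    have S : IsSES f g := by
      refine IsSES.mk' (fun a ha => hf (by rw [ha, map_zero])) hg
        (fun a => (hfg _).2 ⟨a, rfl⟩) (fun b hb => (hfg b).1 hb)
    have hz1 : ∀ P : PrimeSpectrum R, P < q → ∀ m : N₁, ∃ s ∉ P.asIdeal, s • m = 0 := by
      intro P hP m
      obtain ⟨s, hs, h⟩ := h0 P hP (f m)
      exact ⟨s, hs, hf (by rw [map_smul, h, map_zero])⟩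
    have hz3 : ∀ P : PrimeSpectrum R, P < q → ∀ m : N₃, ∃ s ∉ P.asIdeal, s • m = 0 := by
      intro P hP m
      obtain ⟨b, rfl⟩ := hg m
      obtain ⟨s, hs, h⟩ := h0 P hP b
      exact ⟨s, hs, by rw [← map_smul, h, map_zero]⟩
    obtain ⟨s1, hs1, H1⟩ := h1 hz1
    obtain ⟨s3, hs3, H3⟩ := h3 hz3
    by_cases hc : ∃ m : N₁, ∀ t ∉ q.asIdeal, t • m ≠ 0
    · refine ⟨s1 * s3, mul_notMem hs1 hs3, fun Q hQ hsQ => ?_⟩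
      have hsQ1 : s1 ∉ Q.asIdeal := fun h => hsQ (Ideal.mul_mem_right _ _ h)
      have hsQ3 : s3 ∉ Q.asIdeal := fun h => hsQ (Ideal.mul_mem_left _ _ h)
      intro j
      refine ⟨fun h => dL.mid S ((H1 Q hQ hsQ1 j).1 h) ((H3 Q hQ hsQ3 j).1 h), fun _ => ?_⟩
      induction j with
      | zero => exact fun _ => dL_zero
      | succ j ih =>
        intro h
        have := ih (h.mono (Nat.le_succ j))
        exact (H1 Q hQ hsQ1 (j+1)).2 hc (dL.left S h ((H3 Q hQ hsQ3 j).1 this))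
    · push Not at hc
      haveI : Module.Finite R N₁ := S.finite_left inferInstance
      obtain ⟨t, ht, htm⟩ := exists_smul_zero (T := q.asIdeal.primeCompl)
        (LinearMap.id : N₁ →ₗ[R] N₁) hc
      refine ⟨s1 * s3 * t, mul_notMem (mul_notMem hs1 hs3) ht, fun Q hQ hsQ j => ?_⟩
      have htQ : t ∉ Q.asIdeal := fun h => hsQ (Ideal.mul_mem_left _ _ h)
      have hsQ1 : s1 ∉ Q.asIdeal := fun h => hsQ (by
        rw [mul_assoc]; exact Ideal.mul_mem_right _ _ h)
      have hsQ3 : s3 ∉ Q.asIdeal := fun h => hsQ (Ideal.mul_mem_right _ _ (Ideal.mul_mem_left _ _ h))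
      refine ⟨fun h => dL.mid S ((H1 Q hQ hsQ1 j).1 h) ((H3 Q hQ hsQ3 j).1 h), ?_⟩
      rintro ⟨m, hm⟩ h
      refine (H3 Q hQ hsQ3 j).2 ⟨g m, fun r hr h' => ?_⟩
        (dL.right S (dL_of_zero (fun m => ⟨t, htQ, htm m⟩) (j+1)) h)
      rw [← map_smul] at h'
      obtain ⟨a, ha⟩ := S.ex (b := r • m) h'
      refine hm (t * r) (mul_notMem ht hr) ?_
      have := htm a
      simp only [LinearMap.id_apply] at this
      rw [mul_smul, ← ha, ← map_smul, this, map_zero]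

def Bd (N : Type u) [AddCommGroup N] [Module R N] : Prop :=
  ∃ n, ∀ Q : PrimeSpectrum R, dL Q (hgt Q - n) N

lemma bd_of_primes (I : Ideal R) (hI : ∀ p : PrimeSpectrum R, I ≤ p.asIdeal → Bd (R := R) (R ⧸ p.asIdeal))
    (N : Type u) [AddCommGroup N] [Module R N] [hN : Module.Finite R N]
    (hk : ∀ a ∈ I, ∀ m : N, a • m = 0) : Bd (R := R) N := by
  revert hk
  induction hN using IsNoetherianRing.induction_on_isQuotientEquivQuotientPrime R with
  | subsingleton N =>
    intro _
    exact ⟨0, fun Q => dL_of_zero (fun m => ⟨1, one_notMem Q, Subsingleton.elim _ _⟩) _⟩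
  | quotient N p e =>
    intro hk
    have : I ≤ p.asIdeal := by
      intro a ha
      have h := congrArg e (hk a ha (e.symm 1))
      rw [map_smul, LinearEquiv.apply_symm_apply, map_zero] at h
      have : (Ideal.Quotient.mk p.asIdeal a) = 0 := by
        simpa [Algebra.smul_def] using h
      exact Ideal.Quotient.eq_zero_iff_mem.1 this
    obtain ⟨n, hn⟩ := hI p this
    exact ⟨n, fun Q => dL_equiv e.symm (hn Q)⟩
  | exact N₁ N₂ N₃ f g hf hg hfg h1 h3 =>
    intro hk
    have S : IsSES f g := by
      refine IsSES.mk' (fun a ha => hf (by rw [ha, map_zero])) hg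
        (fun a => (hfg _).2 ⟨a, rfl⟩) (fun b hb => (hfg b).1 hb)
    obtain ⟨n1, hn1⟩ := h1 (fun a ha m => hf (by rw [map_smul, hk a ha, map_zero]))
    obtain ⟨n3, hn3⟩ := h3 (fun a ha m => by
      obtain ⟨b, rfl⟩ := hg m
      rw [← map_smul, hk a ha, map_zero])
    refine ⟨max n1 n3, fun Q => dL.mid S ((hn1 Q).mono ?_) ((hn3 Q).mono ?_)⟩
    · have := le_max_left n1 n3; omega
    · have := le_max_right n1 n3; omega

lemma bd_prime (H : HR R) (q : PrimeSpectrum R) : Bd (R := R) (R ⧸ q.asIdeal) := by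
  induction q using (InvImage.wf (fun p : PrimeSpectrum R => p.asIdeal)
    (wellFounded_gt (α := Ideal R))).induction with
  | _ q ih =>
  obtain ⟨xs, hlen, hxs, hreg⟩ := exists_regular_seq H q (hgt q) le_rfl
  have hle : (Ideal.ofList xs • ⊤ : Submodule R R) ≤ q.asIdeal := by
    rw [smul_eq_mul, Ideal.mul_top]
    exact Ideal.span_le.2 fun x hx => hxs x hx
  have hkill : ∀ x ∈ xs, ∀ m : R ⧸ (Ideal.ofList xs • ⊤ : Submodule R R), x • m = 0 := by
    intro x hx m
    obtain ⟨m, rfl⟩ := Submodule.mkQ_surjective _ m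
    rw [← map_smul]
    exact (Submodule.Quotient.mk_eq_zero _).2
      (Submodule.smul_mem_smul (Ideal.subset_span hx) Submodule.mem_top)
  obtain ⟨s, hs, hcmp⟩ := depth_compare q (R ⧸ (Ideal.ofList xs • ⊤ : Submodule R R)) (by
    intro P hP m
    have : ∃ x ∈ xs, x ∉ P.asIdeal := by
      by_contra hc
      push Not at hc
      have h1 := length_le_hgt hc hreg
      have h2 := hgt_strictMono hP
      omega
    obtain ⟨x, hx, hxP⟩ := this
    exact ⟨x, hxP, hkill x hx m⟩)
  have hne : ∃ m : R ⧸ (Ideal.ofList xs • ⊤ : Submodule R R), ∀ t ∉ q.asIdeal, t • m ≠ 0 := by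
    refine ⟨(Ideal.ofList xs • ⊤ : Submodule R R).mkQ 1, fun t ht h => ht (hle ?_)⟩
    rw [← map_smul] at h
    have h' := (Submodule.Quotient.mk_eq_zero _).1 h
    rwa [smul_eq_mul (a := t), mul_one] at h'
  obtain ⟨n', hn'⟩ : Bd (R := R) (QuotSMulTop s (R ⧸ q.asIdeal)) := by
    refine bd_of_primes (q.asIdeal ⊔ Ideal.span {s}) ?_ _ ?_
    · intro p hp
      have hlt : q.asIdeal < p.asIdeal := by
        refine lt_of_le_of_ne (le_sup_left.trans hp) fun heq => ?_
        rw [← heq] at hp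
        exact hs (hp (Ideal.mem_sup_right (Ideal.mem_span_singleton_self s)))
      exact ih p hlt
    · intro a ha m
      obtain ⟨m, rfl⟩ := Submodule.mkQ_surjective _ m
      obtain ⟨m, rfl⟩ := Ideal.Quotient.mk_surjective m
      obtain ⟨b, hb, c, hc, rfl⟩ := Submodule.mem_sup.1 ha
      obtain ⟨r, rfl⟩ := Ideal.mem_span_singleton'.1 hc
      rw [← map_smul]
      refine (Submodule.Quotient.mk_eq_zero _).2 ?_
      have : (b + r * s) • (Ideal.Quotient.mk q.asIdeal m) = s • (Ideal.Quotient.mk q.asIdeal (r * m)) := by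
        rw [Algebra.smul_def, Algebra.smul_def]
        show Ideal.Quotient.mk q.asIdeal (b + r * s) * Ideal.Quotient.mk q.asIdeal m = Ideal.Quotient.mk q.asIdeal s * Ideal.Quotient.mk q.asIdeal (r * m)
        rw [map_add, Ideal.Quotient.eq_zero_iff_mem.2 hb, zero_add, ← map_mul, ← map_mul]
        congr 1
        ring
      rw [this]
      exact Submodule.smul_mem_pointwise_smul _ _ _ Submodule.mem_top
  have hsreg : IsSMulRegular (R ⧸ q.asIdeal) s := by
    rw [isSMulRegular_iff_right_eq_zero_of_smul]
    intro m hm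
    obtain ⟨m, rfl⟩ := Ideal.Quotient.mk_surjective m
    have : Ideal.Quotient.mk q.asIdeal (s * m) = 0 := by
      rw [map_mul]; simpa [Algebra.smul_def] using hm
    exact Ideal.Quotient.eq_zero_iff_mem.2
      ((q.2.mem_or_mem (Ideal.Quotient.eq_zero_iff_mem.1 this)).resolve_left hs)
  refine ⟨max (hgt q) n', fun Q => ?_⟩
  have hm1 := le_max_left (hgt q) n'
  have hm2 := le_max_right (hgt q) n'
  by_cases hqQ : q ≤ Q
  · have hh := hgt_mono hqQ
    by_cases hsQ : s ∈ Q.asIdeal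
    · exact ((dL_quot hsQ (lo_regular hsreg) _).2 (hn' Q)).mono (by omega)
    · have h1 : dL Q (hgt Q - hgt q) (R ⧸ (Ideal.ofList xs • ⊤ : Submodule R R)) := by
        refine (dL_list xs (fun x hx => hqQ (hxs x hx)) hreg _).1 ((dL_self H Q).mono ?_)
        omega
      exact ((hcmp Q hqQ hsQ _).2 hne h1).mono (by omega)
  · obtain ⟨a, ha, haQ⟩ := Set.not_subset.1 hqQ
    refine dL_of_zero (fun m => ⟨a, haQ, ?_⟩) _
    obtain ⟨m, rfl⟩ := Ideal.Quotient.mk_surjective m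
    rw [Algebra.smul_def]
    show Ideal.Quotient.mk q.asIdeal a * _ = 0
    rw [Ideal.Quotient.eq_zero_iff_mem.2 ha, zero_mul]

/-- passing to a high syzygy. -/
lemma mcm_syz (H : HR R) (n : ℕ) : ∀ (N : ModuleCat.{u} R), Module.Finite R N →
    (∀ Q : PrimeSpectrum R, dL Q (hgt Q - n) N) →
    ∃ M : ModuleCat.{u} R, Module.Finite R M ∧ (∀ Q : PrimeSpectrum R, dL Q (hgt Q) M) ∧
      IPD R M = IPD R N := by
  induction n with
  | zero => exact fun N hN h => ⟨N, hN, h, rfl⟩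
  | succ n ih =>
    intro N hN h
    obtain ⟨m, g, hg⟩ := exists_cover (R := R) N
    have s := isSES_ker g hg
    have hfin : Module.Finite R (LinearMap.ker g) := s.finite_left inferInstance
    obtain ⟨M, h1, h2, h3⟩ := ih (ModuleCat.of R (LinearMap.ker g)) hfin (by
      intro Q
      by_cases hc : hgt Q - n = 0
      · rw [hc]; exact dL_zero
      · have h2 : hgt Q - n = (hgt Q - (n+1)) + 1 := by omega
        rw [h2]
        exact dL_syz H s (by omega) (h Q))
    refine ⟨M, h1, h2, h3.trans ?_⟩
    ext p
    haveI : Module.Finite R (ModuleCat.of R (LinearMap.ker g)) := hfin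
    rw [mem_IPD_iff', mem_IPD_iff']
    have hl : IsResolving R (locT (PJ R) p.asIdeal.primeCompl) := (PJ_resolving (R := R)).locT _
    constructor
    · intro hK i hi
      exact hK i ((hl.syzN i).syz s hi)
    · intro hN i hi
      exact hN (i+1) ((in_Syz1 (M := N)).2 ⟨m, g, hg, hi⟩)

lemma ipd_quot_le {p q : PrimeSpectrum R} (h : q ∈ IPD R (ModuleCat.of R (R ⧸ p.asIdeal))) : p ≤ q := by
  by_contra hc
  obtain ⟨a, ha, haq⟩ := Set.not_subset.1 hc
  haveI : Module.Finite R (ModuleCat.of R (R ⧸ p.asIdeal)) :=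
    inferInstanceAs (Module.Finite R (R ⧸ p.asIdeal))
  refine (mem_IPD_iff' _ q).1 h 0 ?_
  have hR : In (PJ R) R := (PJ_resolving (R := R)).proj
  refine in_locT.2 ⟨inferInstanceAs (Module.Finite R (R ⧸ p.asIdeal)), a, haq,
    Fac.mk hR 0 0 fun m => ?_⟩
  obtain ⟨m, rfl⟩ := Ideal.Quotient.mk_surjective m
  rw [Algebra.smul_def]
  show _ = Ideal.Quotient.mk p.asIdeal a * _
  rw [Ideal.Quotient.eq_zero_iff_mem.2 ha, zero_mul]
  rfl

lemma kk_lo (p : PrimeSpectrum R) : Nonempty (Lo p (R ⧸ p.asIdeal) ≃ₗ[Rp p] kk (Rp p)) := by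
  let ψ₀ : R →ₛₗ[algebraMap R (Rp p)] kk (Rp p) :=
    { toFun := fun r => (maximalIdeal (Rp p)).mkQ (algebraMap R (Rp p) r)
      map_add' := fun a b => by simp only [map_add]
      map_smul' := fun a b => by simp only [smul_eq_mul, map_mul]; rw [← smul_eq_mul, map_smul] }
  have h0 : p.asIdeal ≤ LinearMap.ker ψ₀ := by
    intro a ha
    refine LinearMap.mem_ker.2 ((Submodule.Quotient.mk_eq_zero _).2 ?_)
    exact (IsLocalization.AtPrime.to_map_mem_maximal_iff (Rp p) p.asIdeal a).2 ha
  let ψ : (R ⧸ p.asIdeal) →ₛₗ[algebraMap R (Rp p)] kk (Rp p) := Submodule.liftQ p.asIdeal ψ₀ h0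
  have hψ : IsLoc p.asIdeal.primeCompl ψ := by
    constructor
    · intro n
      obtain ⟨x, rfl⟩ := Submodule.mkQ_surjective _ n
      obtain ⟨r, s, rfl⟩ := IsLocalization.exists_mk'_eq p.asIdeal.primeCompl x
      refine ⟨s, s.2, Submodule.Quotient.mk r, ?_⟩
      rw [← map_smul, smul_eq_mul, mul_comm, IsLocalization.mk'_spec]
      rfl
    · intro m hm
      obtain ⟨r, rfl⟩ := Submodule.mkQ_surjective _ m
      refine ⟨1, one_notMem p, ?_⟩
      rw [one_smul]
      refine (Submodule.Quotient.mk_eq_zero _).2 ?_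
      have : (maximalIdeal (Rp p)).mkQ (algebraMap R (Rp p) r) = 0 := hm
      exact (IsLocalization.AtPrime.to_map_mem_maximal_iff (Rp p) p.asIdeal r).1
        ((Submodule.Quotient.mk_eq_zero _).1 this)
  obtain ⟨e, -⟩ := (isLoc_locMap p.asIdeal.primeCompl (R ⧸ p.asIdeal)).unique hψ
  exact ⟨e⟩

lemma mem_ipd_quot {p : PrimeSpectrum R} (hhyp : IsHypersurfaceLocalRing (Localization.AtPrime p.asIdeal))
    (hp : p ∈ SingLocus R) : p ∈ IPD R (ModuleCat.of R (R ⧸ p.asIdeal)) := by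
  haveI : Module.Finite R (ModuleCat.of R (R ⧸ p.asIdeal)) :=
    inferInstanceAs (Module.Finite R (R ⧸ p.asIdeal))
  rw [mem_IPD_iff]
  intro n hn
  obtain ⟨e⟩ := kk_lo p
  have hk : In (SyzN n (PJ (Rp p))) (kk (Rp p)) := ((PJ_resolving (R := Rp p)).syzN n).equiv e hn
  obtain ⟨xs, t, m, hD, hreg⟩ := hyp_data (S := Rp p) hhyp
  exact hp (reg_of_gen (S := Rp p) hD.reg (hreg ⟨n, hk⟩))

theorem psi_ipd (hhyp : ∀ p : PrimeSpectrum R, IsHypersurfaceLocalRing (Localization.AtPrime p.asIdeal))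
    (H : HR R) {W : Set (PrimeSpectrum R)} (f : PrimeSpectrum R → ℕ) (hW : SpecClosed R W)
    (hS : W ⊆ SingLocus R) : IPDcat R (PsiHyp R W f) = W := by
  apply Set.Subset.antisymm
  · exact Set.iUnion₂_subset fun M hM => hM.2.1
  · intro p hp
    obtain ⟨n, hn⟩ := bd_prime H p
    obtain ⟨M, hM1, hM2, hM3⟩ := mcm_syz H n (ModuleCat.of R (R ⧸ p.asIdeal))
      (inferInstanceAs (Module.Finite R (R ⧸ p.asIdeal))) hn
    haveI := hM1
    refine Set.mem_iUnion₂.2 ⟨M, ⟨hM1, ?_, fun q => ?_⟩, ?_⟩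
    · rw [hM3]
      intro q hq
      exact hW p hp q (ipd_quot_le hq)
    · exact (psi_cond q _ M).2 ((hM2 q).mono (Nat.sub_le _ _))
    · rw [hM3]
      exact mem_ipd_quot (hhyp p) (hS hp)

end PartNineteen

theorem locally_hypersurface_aux (R : Type u) [CommRing R] [IsNoetherianRing R]
    (hhyp : ∀ p : PrimeSpectrum R, IsHypersurfaceLocalRing (Localization.AtPrime p.asIdeal)) :
    HR R := fun p hp => by
  obtain ⟨xs, t, n, h, -⟩ := hyp_data (hhyp ⟨p, hp⟩)
  exact ⟨xs, t, n, h⟩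

end Chunk19

/-- Theorem: over a locally hypersurface ring, `Φ` and `Ψ` are mutually inverse bijections
between the resolving subcategories of `mod R` and pairs consisting of a specialization
closed subset of `Sing R` and a grade consistent function on `Spec R`. -/
theorem locally_hypersurface_classification [IsNoetherianRing R]
    (hhyp : ∀ p : PrimeSpectrum R,
      IsHypersurfaceLocalRing (Localization.AtPrime p.asIdeal)) :
    (∀ 𝒳 : Set (ModuleCat.{u} R), IsResolving R 𝒳 →
      SpecClosed R (IPDcat R 𝒳) ∧ IPDcat R 𝒳 ⊆ SingLocus R ∧
      ∃ f : PrimeSpectrum R → ℕ, GradeConsistent R f ∧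
        (∀ p : PrimeSpectrum R,
          (f p : ℕ∞) = heightE R p - ⨅ X ∈ 𝒳, localDepth R p X) ∧
        PsiHyp R (IPDcat R 𝒳) f = 𝒳) ∧
    (∀ (W : Set (PrimeSpectrum R)) (f : PrimeSpectrum R → ℕ),
      SpecClosed R W → W ⊆ SingLocus R → GradeConsistent R f →
      IsResolving R (PsiHyp R W f) ∧ IPDcat R (PsiHyp R W f) = W ∧
      (∀ p : PrimeSpectrum R,
        (f p : ℕ∞) = heightE R p - ⨅ X ∈ PsiHyp R W f, localDepth R p X)) := by
  have H : HR R := locally_hypersurface_aux R hhyp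
  exact ⟨fun 𝒳 hr => first_half H hr, fun W f hW hS hf =>
    ⟨psi_resolving H W f, psi_ipd hhyp H f hW hS, fun p => psi_inf H W hf p⟩⟩

end ResolvPaper
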